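/- Let u be a harmonic function on the ball B(0,2) ⊂ ℝⁿ whose gradient has doubling index bounded above by N ≥ 1 on B(0,1) (i.e., log( sup_{B(x,2r)} |∇u| / sup_{B(x,r)} |∇u| ) ≤ N for all balls B(x,2r) ⊆ B(0,1)). Then there is a constant C = C(n) such that for all 0 < r < 1, Vol( B(0,1/2) ∩ B_r(𝒞_r(u)) ) ≤ C^{N²} · r², where B_r(S) denotes the open r-neighborhood of a set S. -/

import Mathlib

open MeasureTheory Metric Set ENNReal Matrix RealInnerProductSpace

/-- `sup` of `|∇u|` over a set. -/
noncomputable def supGrad {n : ℕ} (u : EuclideanSpace ℝ (Fin n) → ℝ)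
    (s : Set (EuclideanSpace ℝ (Fin n))) : ℝ :=
  sSup ((fun x => ‖fderiv ℝ u x‖) '' s)

/-- `u` is harmonic on `U`: smooth on `U` and its Laplacian vanishes on `U`. -/
def IsHarmonicOn {n : ℕ} (u : EuclideanSpace ℝ (Fin n) → ℝ)
    (U : Set (EuclideanSpace ℝ (Fin n))) : Prop :=
  ContDiffOn ℝ (⊤ : ℕ∞) u U ∧
    ∀ x ∈ U, ∑ i : Fin n,
      fderiv ℝ (fun y => fderiv ℝ u y (EuclideanSpace.single i 1)) x (EuclideanSpace.single i 1) = 0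

/-- normalized doubling index of the gradient on `B(x,r)`:
`N(x,r) = log ( sup_{B(x,2r)} |∇u| / sup_{B(x,r)} |∇u| )`. -/
noncomputable def doublingIndex {n : ℕ} (u : EuclideanSpace ℝ (Fin n) → ℝ)
    (x : EuclideanSpace ℝ (Fin n)) (r : ℝ) : ℝ :=
  Real.log (supGrad u (ball x (2 * r)) / supGrad u (ball x r))

/-- the closed axis-parallel cube with center `c` and side length `ℓ` -/
def cube {n : ℕ} (c : EuclideanSpace ℝ (Fin n)) (ℓ : ℝ) : Set (EuclideanSpace ℝ (Fin n)) :=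
  {x | ∀ i, |x i - c i| ≤ ℓ / 2}

/-- maximal normalized doubling index of the cube of center `c` and side `ℓ`:
`N(Q) = sup_{x ∈ Q, 0 < r ≤ ℓ(Q)} log ( sup_{B(x,10nr)} |∇u| / sup_{B(x,r)} |∇u| )`. -/
noncomputable def cubeDoublingIndex {n : ℕ} (u : EuclideanSpace ℝ (Fin n) → ℝ)
    (c : EuclideanSpace ℝ (Fin n)) (ℓ : ℝ) : ℝ :=
  sSup {t | ∃ x ∈ cube c ℓ, ∃ r : ℝ, 0 < r ∧ r ≤ ℓ ∧
    t = Real.log (supGrad u (ball x (10 * n * r)) / supGrad u (ball x r))}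

/-- `s`-dimensional Hausdorff content -/
noncomputable def hausdorffContent {n : ℕ} (s : ℝ) (E : Set (EuclideanSpace ℝ (Fin n))) : ℝ≥0∞ :=
  ⨅ (U : ℕ → Set (EuclideanSpace ℝ (Fin n))) (_ : E ⊆ ⋃ i, U i), ∑' i, EMetric.diam (U i) ^ s

/-- Riesz `s`-energy of a measure: `I_s(μ) = ∬ |x-y|^{-s} dμ(x) dμ(y)`. -/
noncomputable def rieszEnergy {n : ℕ} (s : ℝ) (μ : Measure (EuclideanSpace ℝ (Fin n))) : ℝ≥0∞ :=
  ∫⁻ x, ∫⁻ y, edist x y ^ (-s) ∂μ ∂μ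

/-- Riesz `s`-capacity of a set: the sup of `I_s(μ)⁻¹` over probability measures compactly
supported in `E`. -/
noncomputable def rieszCapacity {n : ℕ} (s : ℝ) (E : Set (EuclideanSpace ℝ (Fin n))) : ℝ≥0∞ :=
  ⨆ (μ : Measure (EuclideanSpace ℝ (Fin n)))
    (_ : μ E = 1 ∧ ∃ K, IsCompact K ∧ K ⊆ E ∧ μ Kᶜ = 0), (rieszEnergy s μ)⁻¹

/-- a function `Fin n → ℝ` regarded as a point of `EuclideanSpace ℝ (Fin n)` -/
noncomputable def vec {n : ℕ} (f : Fin n → ℝ) : EuclideanSpace ℝ (Fin n) :=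
  (EuclideanSpace.equiv (Fin n) ℝ).symm f

/-- center of the subcube indexed by `k` when the cube of center `c` and side `ℓ` is divided
into `M^n` congruent subcubes -/
noncomputable def subCenter {n : ℕ} (c : EuclideanSpace ℝ (Fin n)) (ℓ : ℝ) (M : ℕ)
    (k : Fin n → Fin M) : EuclideanSpace ℝ (Fin n) :=
  vec (fun i => c i + (((k i : ℝ) + 1 / 2) / M - 1 / 2) * ℓ)

/-- the last coordinate index of `Fin n` -/
def lastIdx (n : ℕ) (hn : 0 < n) : Fin n := ⟨n - 1, Nat.sub_lt hn Nat.one_pos⟩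

/-- the hyperplane `{xₙ = 0}` -/
def lastHyperplane (n : ℕ) (hn : 0 < n) : Set (EuclideanSpace ℝ (Fin n)) :=
  {x | x (lastIdx n hn) = 0}

/-- the `r`-effective critical set of `u`:
`𝒞_r(u) = {x : inf_{B(x,r)} |∇u|² < (n/16) r⁻² ⨍_{∂B(x,2r)} |u(y) - u(x)|² dσ(y)}`,
where the sphere average is taken with respect to `(n-1)`-dimensional Hausdorff measure. -/
noncomputable def effCriticalSet {n : ℕ} (u : EuclideanSpace ℝ (Fin n) → ℝ) (r : ℝ) :
    Set (EuclideanSpace ℝ (Fin n)) :=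
  {x | sInf ((fun y => ‖fderiv ℝ u y‖ ^ 2) '' ball x r) <
    (n / 16) * r⁻¹ ^ 2 * ⨍ y in Metric.sphere x (2 * r), (u y - u x) ^ 2 ∂μH[(n : ℝ) - 1]}



namespace EC

/-- second directional derivative -/
noncomputable def dd {E : Type*} [NormedAddCommGroup E] [NormedSpace ℝ E] (f : E → ℝ) (p w : E) : ℝ :=
  fderiv ℝ (fun y => fderiv ℝ f y w) p w

lemma two_le_top : (2 : WithTop ℕ∞) ≤ ((⊤ : ℕ∞) : WithTop ℕ∞) := by
  exact WithTop.coe_le_coe.2 (le_top : (2 : ℕ∞) ≤ ⊤)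

section dd
variable {E : Type*} [NormedAddCommGroup E] [NormedSpace ℝ E]

lemma cda_fderiv_apply {f : E → ℝ} {p : E} {m k : ℕ∞} (hf : ContDiffAt ℝ m f p) (hk : k + 1 ≤ m) (w : E) :
    ContDiffAt ℝ k (fun y => fderiv ℝ f y w) p := by
  have h : ContDiffAt ℝ k (fderiv ℝ f) p := hf.fderiv_right (by exact_mod_cast hk)
  exact h.clm_apply contDiffAt_const

lemma cda_diff_ev {f : E → ℝ} {p : E} (hf : ContDiffAt ℝ 2 f p) :
    ∀ᶠ y in nhds p, DifferentiableAt ℝ f y := by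
  have := hf.eventually (by simp)
  filter_upwards [this] with y hy
  exact hy.differentiableAt (by norm_num)

lemma cda_diff1 {f : E → ℝ} {p : E} (hf : ContDiffAt ℝ 2 f p) (w : E) :
    DifferentiableAt ℝ (fun y => fderiv ℝ f y w) p :=
  (cda_fderiv_apply (m := 2) (k := 1) hf (by norm_num) w).differentiableAt (by norm_num)

lemma dd_mul {f g : E → ℝ} {p : E} (hf : ContDiffAt ℝ 2 f p) (hg : ContDiffAt ℝ 2 g p) (w : E) :
    dd (fun y => f y * g y) p w = f p * dd g p w + 2 * (fderiv ℝ f p w * fderiv ℝ g p w)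
      + g p * dd f p w := by
  unfold dd
  have h1 : (fun y => fderiv ℝ (fun y => f y * g y) y w) =ᶠ[nhds p]
      fun y => f y * fderiv ℝ g y w + g y * fderiv ℝ f y w := by
    filter_upwards [cda_diff_ev hf, cda_diff_ev hg] with y h1 h2
    rw [fderiv_fun_mul h1 h2]; simp
  rw [h1.fderiv_eq]
  have a := hf.differentiableAt (by norm_num)
  have b := hg.differentiableAt (by norm_num)
  have a' := cda_diff1 hf w
  have b' := cda_diff1 hg w
  rw [fderiv_fun_add (a.fun_mul b') (b.fun_mul a'), fderiv_fun_mul a b', fderiv_fun_mul b a']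
  simp; ring

lemma dd_add {f g : E → ℝ} {p : E} (hf : ContDiffAt ℝ 2 f p) (hg : ContDiffAt ℝ 2 g p) (w : E) :
    dd (fun y => f y + g y) p w = dd f p w + dd g p w := by
  unfold dd
  have h1 : (fun y => fderiv ℝ (fun y => f y + g y) y w) =ᶠ[nhds p]
      fun y => fderiv ℝ f y w + fderiv ℝ g y w := by
    filter_upwards [cda_diff_ev hf, cda_diff_ev hg] with y h1 h2
    rw [fderiv_fun_add h1 h2]; simp
  rw [h1.fderiv_eq, fderiv_fun_add (cda_diff1 hf w) (cda_diff1 hg w)]; simp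

lemma dd_sum {ι : Type*} (s : Finset ι) {f : ι → E → ℝ} {p : E} (hf : ∀ i, ContDiffAt ℝ 2 (f i) p) (w : E) :
    dd (fun y => ∑ i ∈ s, f i y) p w = ∑ i ∈ s, dd (f i) p w := by
  classical
  induction s using Finset.induction_on with
  | empty => simp [dd]
  | insert a s ha ih =>
    simp only [Finset.sum_insert ha]
    rw [dd_add (hf a) (ContDiffAt.sum fun i _ => hf i), ih]

lemma dd_const_mul {f : E → ℝ} {p : E} (c : ℝ) (w : E) :
    dd (fun y => c * f y) p w = c * dd f p w := by
  unfold dd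
  have : (fun y => fderiv ℝ (fun y => c * f y) y w) = fun y => c * fderiv ℝ f y w := by
    ext y
    have : fderiv ℝ (fun y => c * f y) y = c • fderiv ℝ f y := congrFun (fderiv_const_smul_field (𝕜 := ℝ) (f := f) c) y
    rw [this]; simp
  rw [this]
  have : fderiv ℝ (fun y => c * fderiv ℝ f y w) p = c • fderiv ℝ (fun y => fderiv ℝ f y w) p :=
    congrFun (fderiv_const_smul_field (𝕜 := ℝ) (f := fun y => fderiv ℝ f y w) c) p
  rw [this]; simp

lemma sd_max {g g' : ℝ → ℝ} {c : ℝ} (h1 : ∀ᶠ t in nhds (0:ℝ), HasDerivAt g (g' t) t)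
    (h2 : HasDerivAt g' c 0) (hmax : IsLocalMax g 0) : c ≤ 0 := by
  by_contra! hc
  have e1 : deriv g =ᶠ[nhds 0] g' := by filter_upwards [h1] with t ht using ht.deriv
  have e2 : deriv (deriv g) 0 = c := by rw [e1.deriv_eq, h2.deriv]
  have hmin := isLocalMin_of_deriv_deriv_pos (f := g) (x₀ := 0) (by rw [e2]; exact hc)
    hmax.deriv_eq_zero h1.self_of_nhds.continuousAt
  have h3 : g =ᶠ[nhds 0] fun _ => g 0 := by
    filter_upwards [hmax, hmin] with t a b using le_antisymm a b
  have h4 : deriv g =ᶠ[nhds 0] fun _ => 0 := by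
    have := h3.deriv
    simpa using this
  rw [h4.deriv_eq] at e2
  simp at e2; linarith

lemma dd_max {f : E → ℝ} {p : E} (hf : ContDiffAt ℝ 2 f p) (hm : IsLocalMax f p) (w : E) :
    dd f p w ≤ 0 := by
  have hl : ∀ t : ℝ, HasDerivAt (fun t : ℝ => p + t • w) w t := fun t => by
    simpa using ((hasDerivAt_id t).smul_const w).const_add p
  have hc : Filter.Tendsto (fun t : ℝ => p + t • w) (nhds 0) (nhds p) := by
    have : Continuous (fun t : ℝ => p + t • w) := by fun_prop
    simpa using this.tendsto 0
  refine sd_max (g := fun t => f (p + t • w)) (g' := fun t => fderiv ℝ f (p + t • w) w) ?_ ?_ ?_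
  · filter_upwards [hc.eventually (cda_diff_ev hf)] with t ht
    exact ht.hasFDerivAt.comp_hasDerivAt t (hl t)
  · have h := (cda_diff1 hf w).hasFDerivAt
    have h' : HasFDerivAt (fun y => fderiv ℝ f y w) (fderiv ℝ (fun y => fderiv ℝ f y w) p) (p + (0:ℝ) • w) := by
      simpa using h
    exact h'.comp_hasDerivAt (0:ℝ) (hl 0)
  · have := hc.eventually hm
    unfold IsLocalMax IsMaxFilter
    simpa using this
end dd

section bern
variable {n : ℕ}
local notation "E" => EuclideanSpace ℝ (Fin n)

lemma phi_fderiv (z x w : E) (s : ℝ) :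
    fderiv ℝ (fun y : E => s ^ 2 - ‖y - z‖ ^ 2) x w = -2 * (inner ℝ (x - z) (w)) := by
  have h : HasFDerivAt (fun y : E => y - z) (ContinuousLinearMap.id ℝ E) x :=
    (hasFDerivAt_id x).sub_const z
  have := (h.norm_sq).const_sub (s ^ 2)
  rw [this.fderiv]; simp [inner_sub_left]

lemma phi_dd (z x w : E) (s : ℝ) :
    dd (fun y : E => s ^ 2 - ‖y - z‖ ^ 2) x w = -2 * ‖w‖ ^ 2 := by
  unfold dd
  simp only [phi_fderiv]
  have h : HasFDerivAt (fun y : E => -2 * (inner ℝ (w) (y - z))) ((-2:ℝ) • (innerSL ℝ w)) x := by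
    have h1 : HasFDerivAt (fun y : E => y - z) (ContinuousLinearMap.id ℝ E) x :=
      (hasFDerivAt_id x).sub_const z
    have h2 := ((innerSL ℝ w).hasFDerivAt (x := x - z)).comp x h1
    simpa using h2.const_mul (-2)
  have e : (fun y : E => -2 * (inner ℝ (y - z) (w))) = fun y : E => -2 * (inner ℝ (w) (y - z)) := by
    ext y; rw [real_inner_comm]
  rw [e, h.fderiv]; simp

lemma norm_fderiv_sq (f : E → ℝ) (x : E) :
    ‖fderiv ℝ f x‖ ^ 2 = ∑ i, (fderiv ℝ f x (EuclideanSpace.single i 1)) ^ 2 := by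
  set g := (InnerProductSpace.toDual ℝ E).symm (fderiv ℝ f x) with hg
  have h1 : ‖fderiv ℝ f x‖ = ‖g‖ := by rw [hg, LinearIsometryEquiv.norm_map]
  have h2 : ∀ w, fderiv ℝ f x w = (inner ℝ (g) (w)) := fun w => by
    rw [hg, InnerProductSpace.toDual_symm_apply]
  rw [h1, EuclideanSpace.norm_sq_eq]
  simp [h2, EuclideanSpace.inner_single_right]

/-- Bernstein gradient estimate. -/
lemma bernstein {v : E → ℝ} {U : Set E} (hU : IsOpen U) (hv : IsHarmonicOn v U)
    (hv' : ∀ i, IsHarmonicOn (fun y => fderiv ℝ v y (EuclideanSpace.single i 1)) U)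
    {z : E} {s m : ℝ} (hs : 0 < s) (hsub : closedBall z s ⊆ U)
    (hm : ∀ x ∈ closedBall z s, |v x| ≤ m) : ‖fderiv ℝ v z‖ ≤ (13 + 2 * n) / s * m := by
  have hm0 : 0 ≤ m := (abs_nonneg _).trans (hm z (mem_closedBall_self hs.le))
  set lam : ℝ := (13 + 2 * n) * s ^ 2 with hlam
  have hlam0 : 0 < lam := by positivity
  set φ : E → ℝ := fun y => s ^ 2 - ‖y - z‖ ^ 2 with hφ
  have hφc : ∀ x, ContDiffAt ℝ 2 φ x := fun x => by
    have : ContDiff ℝ 2 φ := by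
      have h0 : ContDiff ℝ 2 (fun y : E => y - z) := contDiff_id.sub contDiff_const
      exact contDiff_const.sub (h0.norm_sq (𝕜 := ℝ))
    exact this.contDiffAt
  set vi : Fin n → E → ℝ := fun i y => fderiv ℝ v y (EuclideanSpace.single i 1) with hvi
  have hvc : ∀ x ∈ U, ContDiffAt ℝ 2 v x := fun x hx =>
    ((hv.1.contDiffAt (hU.mem_nhds hx))).of_le two_le_top
  have hvic : ∀ i, ∀ x ∈ U, ContDiffAt ℝ 2 (vi i) x := fun i x hx =>
    (((hv' i).1.contDiffAt (hU.mem_nhds hx))).of_le two_le_top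
  set w : E → ℝ := fun y => (∑ j, (φ y * vi j y) * (φ y * vi j y)) + lam * (v y * v y) with hw
  have hwc : ∀ x ∈ U, ContDiffAt ℝ 2 w x := fun x hx => by
    refine ContDiffAt.add (ContDiffAt.sum fun i _ => ?_) (contDiffAt_const.mul ((hvc x hx).mul (hvc x hx)))
    exact ((hφc x).mul (hvic i x hx)).mul ((hφc x).mul (hvic i x hx))
  have hcont : ContinuousOn w (closedBall z s) := fun x hx =>
    ((hwc x (hsub hx)).continuousAt).continuousWithinAt
  obtain ⟨p, hp, hpmax⟩ := (isCompact_closedBall z s).exists_isMaxOn ⟨z, mem_closedBall_self hs.le⟩ hcont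
  have hsumeq : ∀ y, ∑ j, (φ y * vi j y) * (φ y * vi j y) = φ y ^ 2 * ‖fderiv ℝ v y‖ ^ 2 := fun y => by
    rw [norm_fderiv_sq, Finset.mul_sum]; refine Finset.sum_congr rfl fun j _ => ?_; simp only [hvi]; ring
  have hwp : w p ≤ lam * m ^ 2 := by
    have hvp : lam * (v p * v p) ≤ lam * m ^ 2 := by
      have := hm p hp
      have h2 : v p * v p ≤ m ^ 2 := by rw [← pow_two, ← sq_abs]; gcongr
      gcongr
    suffices h : φ p ^ 2 * ‖fderiv ℝ v p‖ ^ 2 = 0 by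
      simp only [hw]; rw [hsumeq, h]; linarith
    by_contra hne
    have hφp : φ p ≠ 0 := by rintro h; simp [h] at hne
    have hgp : ‖fderiv ℝ v p‖ ≠ 0 := by rintro h; simp [h] at hne
    have hpz : ‖p - z‖ ≤ s := by simpa [dist_eq_norm] using hp
    have hφpos : 0 ≤ φ p := by
      simp only [hφ]; nlinarith [norm_nonneg (p - z)]
    have hφs : φ p ≤ s ^ 2 := by simp only [hφ]; nlinarith [norm_nonneg (p - z)]
    have hpb : p ∈ ball z s := by
      rw [mem_ball, dist_eq_norm]
      refine lt_of_le_of_ne hpz fun h => hφp ?_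
      simp [hφ, h]
    have hloc : IsLocalMax w p := by
      refine hpmax.isLocalMax ?_
      exact Filter.mem_of_superset (isOpen_ball.mem_nhds hpb) ball_subset_closedBall
    have hpU := hsub hp
    have hle : ∑ i : Fin n, dd w p (EuclideanSpace.single i 1) ≤ 0 :=
      Finset.sum_nonpos fun i _ => dd_max (hwc p hpU) hloc _
    have hdd : ∀ i : Fin n, dd w p (EuclideanSpace.single i 1) =
        (∑ j, (2 * (φ p * fderiv ℝ (vi j) p (EuclideanSpace.single i 1)
            + vi j p * (-2 * (p i - z i))) ^ 2
          + 2 * (φ p * vi j p) * (φ p * dd (vi j) p (EuclideanSpace.single i 1)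
            + 2 * ((-2 * (p i - z i)) * fderiv ℝ (vi j) p (EuclideanSpace.single i 1)) + vi j p * (-2))))
        + lam * (2 * (vi i p) ^ 2 + 2 * v p * dd v p (EuclideanSpace.single i 1)) := fun i => by
      have c1 : ∀ j, ContDiffAt ℝ 2 (fun y => φ y * vi j y) p := fun j => (hφc p).mul (hvic j p hpU)
      have hf : fderiv ℝ φ p (EuclideanSpace.single i 1) = -2 * (p i - z i) := by
        simp only [hφ]; rw [phi_fderiv]; simp [EuclideanSpace.inner_single_right]
      have hfd : dd φ p (EuclideanSpace.single i 1) = -2 := by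
        simp only [hφ]; rw [phi_dd]; simp
      simp only [hw]
      rw [dd_add (ContDiffAt.sum fun j _ => (c1 j).mul (c1 j)) (contDiffAt_const.mul ((hvc p hpU).mul (hvc p hpU))),
        dd_sum _ (fun j => (c1 j).mul (c1 j)), dd_const_mul, dd_mul (hvc p hpU) (hvc p hpU)]
      congr 1
      · refine Finset.sum_congr rfl fun j _ => ?_
        rw [dd_mul (c1 j) (c1 j), dd_mul (hφc p) (hvic j p hpU), hfd,
          fderiv_fun_mul ((hφc p).differentiableAt (by norm_num)) ((hvic j p hpU).differentiableAt (by norm_num))]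
        simp [hf]; ring
      · simp only [hvi]; ring
    have hlv : ∑ i, dd v p (EuclideanSpace.single i 1) = 0 := hv.2 p hpU
    have hlvi : ∀ j, ∑ i, dd (vi j) p (EuclideanSpace.single i 1) = 0 := fun j => (hv' j).2 p hpU
    have hpzsum : ∑ i, (p i - z i) ^ 2 = ‖p - z‖ ^ 2 := by
      rw [EuclideanSpace.norm_sq_eq]; simp
    have hj : ∀ j, -(24 + 4 * n) * s ^ 2 * (vi j p) ^ 2 ≤ ∑ i, (2 * (φ p * fderiv ℝ (vi j) p (EuclideanSpace.single i 1)
            + vi j p * (-2 * (p i - z i))) ^ 2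
          + 2 * (φ p * vi j p) * (φ p * dd (vi j) p (EuclideanSpace.single i 1)
            + 2 * ((-2 * (p i - z i)) * fderiv ℝ (vi j) p (EuclideanSpace.single i 1)) + vi j p * (-2))) := fun j => by
      have h1 : ∀ i, -24 * (vi j p) ^ 2 * (p i - z i) ^ 2 + (-4 * φ p * (vi j p) ^ 2)
          + 2 * φ p ^ 2 * vi j p * dd (vi j) p (EuclideanSpace.single i 1) ≤
          (2 * (φ p * fderiv ℝ (vi j) p (EuclideanSpace.single i 1)
            + vi j p * (-2 * (p i - z i))) ^ 2
          + 2 * (φ p * vi j p) * (φ p * dd (vi j) p (EuclideanSpace.single i 1)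
            + 2 * ((-2 * (p i - z i)) * fderiv ℝ (vi j) p (EuclideanSpace.single i 1)) + vi j p * (-2))) := fun i => by
        nlinarith [sq_nonneg (φ p * fderiv ℝ (vi j) p (EuclideanSpace.single i 1) - 4 * vi j p * (p i - z i))]
      refine le_trans ?_ (Finset.sum_le_sum fun i _ => h1 i)
      rw [Finset.sum_add_distrib, Finset.sum_add_distrib, ← Finset.mul_sum, ← Finset.mul_sum, ← Finset.mul_sum, hlvi, hpzsum]
      simp only [Finset.sum_const, Finset.card_univ, Fintype.card_fin, nsmul_eq_mul]
      have hh : ‖p - z‖ ^ 2 ≤ s ^ 2 := by gcongr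
      have n0 : (0:ℝ) ≤ n := Nat.cast_nonneg n
      have e1 : (vi j p) ^ 2 * ‖p - z‖ ^ 2 ≤ (vi j p) ^ 2 * s ^ 2 := by gcongr
      have e2 : (n:ℝ) * (φ p * (vi j p) ^ 2) ≤ n * (s ^ 2 * (vi j p) ^ 2) := by gcongr
      nlinarith
    have hgs : ‖fderiv ℝ v p‖ ^ 2 = ∑ j, (vi j p) ^ 2 := norm_fderiv_sq v p
    simp only [hdd] at hle
    rw [Finset.sum_add_distrib, Finset.sum_comm, ← Finset.mul_sum, Finset.sum_add_distrib,
      ← Finset.mul_sum, ← Finset.mul_sum, hlv, ← hgs] at hle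
    have h2 := Finset.sum_le_sum fun j (_ : j ∈ Finset.univ) => hj j
    rw [← Finset.mul_sum, ← hgs] at h2
    have hgp2 : 0 < ‖fderiv ℝ v p‖ ^ 2 := by positivity
    have : 0 < s ^ 2 * ‖fderiv ℝ v p‖ ^ 2 := by positivity
    simp only [hlam] at hle
    nlinarith
  have hwz : s ^ 4 * ‖fderiv ℝ v z‖ ^ 2 ≤ lam * m ^ 2 := by
    have h1 := hpmax (mem_closedBall_self hs.le)
    have h2 : w z ≤ lam * m ^ 2 := le_trans h1 hwp
    simp only [hw] at h2
    rw [hsumeq] at h2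
    have h3 : φ z = s ^ 2 := by simp [hφ]
    rw [h3] at h2
    have : 0 ≤ lam * (v z * v z) := mul_nonneg hlam0.le (mul_self_nonneg _)
    nlinarith
  have n0 : (0:ℝ) ≤ n := Nat.cast_nonneg n
  have h5 : (s * ‖fderiv ℝ v z‖) ^ 2 ≤ ((13 + 2 * n) * m) ^ 2 := by
    have : s ^ 2 * (s ^ 2 * ‖fderiv ℝ v z‖ ^ 2) ≤ s ^ 2 * ((13 + 2 * n) * m ^ 2) := by
      simp only [hlam] at hwz; nlinarith
    have h6 := le_of_mul_le_mul_left this (by positivity)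
    have : (13 + 2 * n) * m ^ 2 ≤ (13 + 2 * (n:ℝ)) ^ 2 * m ^ 2 := by
      gcongr; nlinarith
    nlinarith
  have h7 := abs_le_of_sq_le_sq h5 (by positivity)
  rw [div_mul_eq_mul_div, le_div_iff₀ hs]
  linarith [le_abs_self (s * ‖fderiv ℝ v z‖)]
end bern
end EC


namespace EC

section harm
variable {n : ℕ}
local notation "E" => EuclideanSpace ℝ (Fin n)

lemma harm_cda {v : E → ℝ} {U : Set E} (hU : IsOpen U) (hv : IsHarmonicOn v U) {x : E} (hx : x ∈ U) :
    ContDiffAt ℝ (⊤ : ℕ∞) v x := hv.1.contDiffAt (hU.mem_nhds hx)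

lemma sd_swap {f : E → ℝ} {x : E} (hf : ContDiffAt ℝ (⊤ : ℕ∞) f x) (a b : E) :
    fderiv ℝ (fun y => fderiv ℝ f y a) x b = fderiv ℝ (fun y => fderiv ℝ f y b) x a := by
  have h1 : DifferentiableAt ℝ (fderiv ℝ f) x :=
    (hf.fderiv_right (m := 1) (by exact two_le_top)).differentiableAt (by norm_num)
  have h := (hf.isSymmSndFDerivAt (by simpa using two_le_top)).eq b a
  rw [fderiv_clm_apply h1 (by fun_prop), fderiv_clm_apply h1 (by fun_prop)]
  simpa using h

lemma harm_congr {v w : E → ℝ} {U : Set E} (hU : IsOpen U) (hv : IsHarmonicOn v U)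
    (h : ∀ x ∈ U, w x = v x) : IsHarmonicOn w U := by
  refine ⟨hv.1.congr h, fun x hx => ?_⟩
  rw [← hv.2 x hx]
  refine Finset.sum_congr rfl fun i _ => ?_
  have e : ∀ y ∈ U, w =ᶠ[nhds y] v := fun y hy => by
    filter_upwards [hU.mem_nhds hy] with z hz using h z hz
  have : (fun y => fderiv ℝ w y (EuclideanSpace.single i 1)) =ᶠ[nhds x]
      fun y => fderiv ℝ v y (EuclideanSpace.single i 1) := by
    filter_upwards [hU.mem_nhds hx] with y hy
    rw [(e y hy).fderiv_eq]
  rw [this.fderiv_eq]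

lemma harm_fderiv {v : E → ℝ} {U : Set E} (hU : IsOpen U) (hv : IsHarmonicOn v U) (w : E) :
    IsHarmonicOn (fun x => fderiv ℝ v x w) U := by
  have hs : ∀ a : E, ∀ x ∈ U, ContDiffAt ℝ (⊤ : ℕ∞) (fun x => fderiv ℝ v x a) x := fun a x hx =>
    cda_fderiv_apply (m := ⊤) (k := ⊤) (harm_cda hU hv hx) (by simp) a
  refine ⟨fun x hx => (hs w x hx).contDiffWithinAt, fun x hx => ?_⟩
  have key : ∀ i : Fin n, fderiv ℝ (fun y => fderiv ℝ (fun x => fderiv ℝ v x w) y (EuclideanSpace.single i 1)) x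
      (EuclideanSpace.single i 1) = fderiv ℝ (fun y => fderiv ℝ (fun x => fderiv ℝ v x (EuclideanSpace.single i 1)) y
        (EuclideanSpace.single i 1)) x w := by
    intro i
    have e : (fun y => fderiv ℝ (fun x => fderiv ℝ v x w) y (EuclideanSpace.single i 1)) =ᶠ[nhds x]
        fun y => fderiv ℝ (fun x => fderiv ℝ v x (EuclideanSpace.single i 1)) y w := by
      filter_upwards [hU.mem_nhds hx] with y hy
      exact sd_swap (harm_cda hU hv hy) _ _
    rw [e.fderiv_eq, sd_swap (hs _ x hx)]
  rw [Finset.sum_congr rfl fun i _ => key i]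
  have hd : ∀ i : Fin n, DifferentiableAt ℝ (fun y => fderiv ℝ (fun x => fderiv ℝ v x (EuclideanSpace.single i 1)) y
        (EuclideanSpace.single i 1)) x := fun i =>
    (cda_fderiv_apply (m := ⊤) (k := ⊤) (hs _ x hx) (by simp) _).differentiableAt (by simp)
  have e0 : (fun y => ∑ i : Fin n, fderiv ℝ (fun x => fderiv ℝ v x (EuclideanSpace.single i 1)) y
        (EuclideanSpace.single i 1)) =ᶠ[nhds x] fun _ => 0 := by
    filter_upwards [hU.mem_nhds hx] with y hy using hv.2 y hy
  have := e0.fderiv_eq (𝕜 := ℝ)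
  rw [fderiv_fun_sum (fun i _ => hd i)] at this
  have := congrArg (fun L => L w) this
  simpa using this

lemma cda_iter {v : E → ℝ} {x : E} (h : ContDiffAt ℝ (⊤ : ℕ∞) v x) (k : ℕ) :
    ContDiffAt ℝ (⊤ : ℕ∞) (iteratedFDeriv ℝ k v) x :=
  h.iteratedFDeriv_right (m := (⊤ : ℕ∞)) (i := k) (by
    exact_mod_cast (le_top : (⊤ : ℕ∞) + (k : ℕ∞) ≤ ⊤))

lemma iter_succ_apply {v : E → ℝ} {x : E} (h : ContDiffAt ℝ (⊤ : ℕ∞) v x) (k : ℕ) (w : Fin (k+1) → E) :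
    iteratedFDeriv ℝ (k+1) v x w = fderiv ℝ (fun y => iteratedFDeriv ℝ k v y (Fin.tail w)) x (w 0) := by
  have hd : DifferentiableAt ℝ (iteratedFDeriv ℝ k v) x := (cda_iter h k).differentiableAt (by simp)
  rw [iteratedFDeriv_succ_apply_left]
  have := (hd.hasFDerivAt.continuousMultilinear_apply_const (Fin.tail w)).fderiv
  rw [this]; rfl

lemma harm_iter {v : E → ℝ} {U : Set E} (hU : IsOpen U) (hv : IsHarmonicOn v U) (k : ℕ) :
    ∀ w : Fin k → E, IsHarmonicOn (fun x => iteratedFDeriv ℝ k v x w) U := by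
  induction k with
  | zero => intro w; exact harm_congr hU hv fun x _ => by simp
  | succ k ih =>
    intro w
    refine harm_congr hU (harm_fderiv hU (ih (Fin.tail w)) (w 0)) fun x hx => ?_
    exact iter_succ_apply (harm_cda hU hv hx) k w

/-- symmetric under transpositions -/
def SymT {k : ℕ} (T : ContinuousMultilinearMap ℝ (fun _ : Fin k => E) ℝ) : Prop :=
  ∀ (i j : Fin k) (v : Fin k → E), T (v ∘ Equiv.swap i j) = T v

/-- trace free in every orthonormal basis -/
def TrF {k : ℕ} (T : ContinuousMultilinearMap ℝ (fun _ : Fin k => E) ℝ) : Prop :=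
  ∀ (b : OrthonormalBasis (Fin n) ℝ E) (i j : Fin k) (v : Fin k → E), i ≠ j →
    ∑ l, T (Function.update (Function.update v i (b l)) j (b l)) = 0

lemma iter_two_apply {v : E → ℝ} {U : Set E} (hU : IsOpen U) (hv : IsHarmonicOn v U) {x : E} (hx : x ∈ U)
    (k : ℕ) (w : Fin (k+2) → E) :
    iteratedFDeriv ℝ (k+2) v x w =
      fderiv ℝ (fun y => fderiv ℝ (fun y => iteratedFDeriv ℝ k v y (Fin.tail (Fin.tail w))) y (w 1)) x (w 0) := by
  rw [iter_succ_apply (harm_cda hU hv hx)]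
  have e : (fun y => iteratedFDeriv ℝ (k+1) v y (Fin.tail w)) =ᶠ[nhds x]
      fun y => fderiv ℝ (fun y => iteratedFDeriv ℝ k v y (Fin.tail (Fin.tail w))) y (w 1) := by
    filter_upwards [hU.mem_nhds hx] with y hy
    rw [iter_succ_apply (harm_cda hU hv hy)]; rfl
  rw [e.fderiv_eq]

lemma symT_iter {v : E → ℝ} {U : Set E} (hU : IsOpen U) (hv : IsHarmonicOn v U) (k : ℕ) :
    ∀ x ∈ U, SymT (iteratedFDeriv ℝ k v x) := by
  induction k with
  | zero => intro x _ i; exact i.elim0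
  | succ k ih =>
    intro x hx
    have hpos : ∀ (i j : Fin k) (w : Fin (k+1) → E),
        iteratedFDeriv ℝ (k+1) v x (w ∘ Equiv.swap i.succ j.succ) = iteratedFDeriv ℝ (k+1) v x w := by
      intro i j w
      rw [iter_succ_apply (harm_cda hU hv hx), iter_succ_apply (harm_cda hU hv hx)]
      have h0 : (w ∘ Equiv.swap i.succ j.succ) 0 = w 0 := by
        simp [Equiv.swap_apply_of_ne_of_ne (Fin.succ_ne_zero i).symm (Fin.succ_ne_zero j).symm]
      have ht : Fin.tail (w ∘ Equiv.swap i.succ j.succ) = Fin.tail w ∘ Equiv.swap i j := by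
        ext1 l
        simp only [Fin.tail, Function.comp]
        rw [(Fin.succ_injective k).swap_apply]
      rw [h0, ht]
      have e : (fun y => iteratedFDeriv ℝ k v y (Fin.tail w ∘ Equiv.swap i j)) =ᶠ[nhds x]
        fun y => iteratedFDeriv ℝ k v y (Fin.tail w) := by
        filter_upwards [hU.mem_nhds hx] with y hy using ih y hy i j _
      rw [e.fderiv_eq]
    have h0 : ∀ (j : Fin k) (w : Fin (k+1) → E),
        iteratedFDeriv ℝ (k+1) v x (w ∘ Equiv.swap 0 j.succ) = iteratedFDeriv ℝ (k+1) v x w := by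
      cases k with
      | zero => intro j; exact j.elim0
      | succ k =>
        have h01 : ∀ w : Fin (k+2) → E,
          iteratedFDeriv ℝ (k+2) v x (w ∘ Equiv.swap 0 1) = iteratedFDeriv ℝ (k+2) v x w := by
          intro w
          rw [iter_two_apply hU hv hx, iter_two_apply hU hv hx]
          have : Fin.tail (Fin.tail (w ∘ Equiv.swap 0 1)) = Fin.tail (Fin.tail w) := by
            ext1 l
            simp only [Fin.tail, Function.comp]
            rw [Equiv.swap_apply_of_ne_of_ne (Fin.succ_ne_zero _)]
            intro h
            have := Fin.succ_injective _ (h.trans (Fin.succ_zero_eq_one).symm)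
            exact Fin.succ_ne_zero _ this
          rw [this, sd_swap (harm_cda hU (harm_iter hU hv k _) hx)]
          simp
        intro j w
        by_cases hj : j = 0
        · subst hj; exact h01 w
        · have : Equiv.swap (0 : Fin (k+2)) j.succ = Equiv.swap 1 j.succ * Equiv.swap 0 1 * Equiv.swap 1 j.succ := by
            have h1 : j.succ ≠ 0 := Fin.succ_ne_zero _
            have h3 : (0 : Fin (k+2)) ≠ 1 := by simp
            have := Equiv.swap_mul_swap_mul_swap (x := (0 : Fin (k+2))) (y := 1) (z := j.succ) h3 h1.symm
            rw [this, Equiv.swap_comm]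
          have e : w ∘ Equiv.swap (0 : Fin (k+2)) j.succ =
            ((w ∘ Equiv.swap (1 : Fin (k+2)) j.succ) ∘ Equiv.swap 0 1) ∘ Equiv.swap 1 j.succ := by
            rw [this]; rfl
          have hp := hpos 0 j
          rw [Fin.succ_zero_eq_one] at hp
          rw [e, hp, h01, hp]
    intro i j w
    rcases Fin.eq_zero_or_eq_succ i with hi | ⟨i, rfl⟩
    · subst hi
      rcases Fin.eq_zero_or_eq_succ j with hj | ⟨j, rfl⟩
      · subst hj; simp
      · exact h0 j w
    · rcases Fin.eq_zero_or_eq_succ j with hj | ⟨j, rfl⟩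
      · subst hj; rw [Equiv.swap_comm]; exact h0 i w
      · exact hpos i j w

lemma lap_basis {g : E → ℝ} {U : Set E} (hU : IsOpen U) (hg : IsHarmonicOn g U) {x : E} (hx : x ∈ U)
    (b : OrthonormalBasis (Fin n) ℝ E) :
    ∑ l, fderiv ℝ (fun y => fderiv ℝ g y (b l)) x (b l) = 0 := by
  have h1 : DifferentiableAt ℝ (fderiv ℝ g) x :=
    ((harm_cda hU hg hx).fderiv_right (m := 1) (by exact two_le_top)).differentiableAt (by norm_num)
  have e : ∀ a : E, fderiv ℝ (fun y => fderiv ℝ g y a) x a = iteratedFDeriv ℝ 2 g x ![a, a] := by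
    intro a
    rw [iteratedFDeriv_two_apply, fderiv_clm_apply h1 (by fun_prop)]; simp
  have a1 := congrFun (InnerProductSpace.laplacian_eq_iteratedFDeriv_orthonormalBasis g b) x
  have a2 := congrFun (InnerProductSpace.laplacian_eq_iteratedFDeriv_orthonormalBasis g (EuclideanSpace.basisFun (Fin n) ℝ)) x
  have a3 := hg.2 x hx
  simp only [e] at a3 ⊢
  rw [a1] at a2
  simpa [a3] using a2

lemma update_update_swap {k : ℕ} {T : ContinuousMultilinearMap ℝ (fun _ : Fin k => E) ℝ} (hT : SymT T)
    {i j i' : Fin k} (hij : i ≠ j) (hi' : i' ≠ j) (v : Fin k → E) :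
    ∃ v', ∀ a, T (Function.update (Function.update v i a) j a) =
      T (Function.update (Function.update v' i' a) j a) := by
  refine ⟨v ∘ Equiv.swap i i', fun a => ?_⟩
  rw [← hT i i']
  congr 1
  ext1 l
  by_cases hl : l = j
  · subst hl; simp [Equiv.swap_apply_of_ne_of_ne hij.symm hi'.symm]
  · by_cases hl' : l = i'
    · subst hl'
      simp [Equiv.swap_apply_right, hij, hl]
    · have h2 : Equiv.swap i i' l ≠ i := by
        intro h
        have := congrArg (Equiv.swap i i') h
        simp at this; exact hl' this
      have h1 : Equiv.swap i i' l ≠ j := by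
        intro h
        have := congrArg (Equiv.swap i i') h
        rw [Equiv.swap_apply_of_ne_of_ne hij.symm hi'.symm] at this
        simp at this; exact hl this
      simp [hl, hl', h1, h2]

lemma trF_of_sym {k : ℕ} {T : ContinuousMultilinearMap ℝ (fun _ : Fin (k+2) => E) ℝ} (hT : SymT T)
    (h : ∀ (b : OrthonormalBasis (Fin n) ℝ E) (v : Fin (k+2) → E),
      ∑ l, T (Function.update (Function.update v 0 (b l)) 1 (b l)) = 0) : TrF T := by
  intro b i j v hij
  have comm : ∀ (p q : Fin (k+2)) (v : Fin (k+2) → E) (a : E), p ≠ q →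
      Function.update (Function.update v p a) q a = Function.update (Function.update v q a) p a :=
    fun p q v a hpq => Function.update_comm hpq _ _ _
  -- general: can move
  have h1 : ∀ (j : Fin (k+2)) (v : Fin (k+2) → E), j ≠ 0 →
      ∑ l, T (Function.update (Function.update v 0 (b l)) j (b l)) = 0 := by
    intro j v hj
    obtain ⟨v', hv'⟩ := update_update_swap hT (i := j) (j := 0) (i' := 1) hj (by simp) v
    rw [← h b v']
    refine Finset.sum_congr rfl fun l _ => ?_
    rw [comm 0 j v _ hj.symm, hv', comm 1 0 _ _ (by simp)]
  by_cases hj : j = 0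
  · subst hj
    rw [← h1 i v hij]
    exact Finset.sum_congr rfl fun l _ => by rw [comm i 0 v _ hij]
  · obtain ⟨v', hv'⟩ := update_update_swap hT (i := i) (j := j) (i' := 0) hij (Ne.symm hj) v
    rw [← h1 j v' hj]
    exact Finset.sum_congr rfl fun l _ => hv' _

lemma trF_iter {v : E → ℝ} {U : Set E} (hU : IsOpen U) (hv : IsHarmonicOn v U) (k : ℕ) {x : E} (hx : x ∈ U) :
    TrF (iteratedFDeriv ℝ (k+2) v x) := by
  refine trF_of_sym (symT_iter hU hv _ x hx) fun b w => ?_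
  rw [← lap_basis hU (harm_iter hU hv k (Fin.tail (Fin.tail w))) hx b]
  refine Finset.sum_congr rfl fun l _ => ?_
  rw [iter_two_apply hU hv hx]
  have : Fin.tail (Fin.tail (Function.update (Function.update w 0 (b l)) 1 (b l))) = Fin.tail (Fin.tail w) := by
    ext1 l
    have h1 : l.succ.succ ≠ 1 := by
      intro h
      have := Fin.succ_injective _ (h.trans (Fin.succ_zero_eq_one).symm)
      exact Fin.succ_ne_zero _ this
    simp [Fin.tail, h1]
  rw [this]
  simp

lemma iter_norm_step {v : E → ℝ} {U : Set E} (hU : IsOpen U) (hv : IsHarmonicOn v U) (k : ℕ) {z : E} {s m : ℝ}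
    (hs : 0 < s) (hsub : closedBall z s ⊆ U) (hm : ∀ x ∈ closedBall z s, ‖iteratedFDeriv ℝ k v x‖ ≤ m) :
    ‖iteratedFDeriv ℝ (k+1) v z‖ ≤ (13 + 2 * n) / s * m := by
  have hz : z ∈ closedBall z s := mem_closedBall_self hs.le
  have hm0 : 0 ≤ m := (norm_nonneg _).trans (hm z hz)
  refine ContinuousMultilinearMap.opNorm_le_bound (by positivity) fun w => ?_
  rw [iter_succ_apply (harm_cda hU hv (hsub hz))]
  have hg := harm_iter hU hv k (Fin.tail w)
  have := bernstein hU hg (fun i => harm_fderiv hU hg _) hs hsub (m := m * ∏ i, ‖Fin.tail w i‖) (fun x hx => by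
    refine ((iteratedFDeriv ℝ k v x).le_opNorm _).trans ?_
    exact mul_le_mul_of_nonneg_right (hm x hx) (Finset.prod_nonneg fun i _ => norm_nonneg _))
  refine (ContinuousLinearMap.le_opNorm _ _).trans ((mul_le_mul_of_nonneg_right this (norm_nonneg _)).trans ?_)
  rw [Fin.prod_univ_succ]
  simp only [Fin.tail]
  apply le_of_eq; ring
end harm
end EC


namespace EC

section cauchy
variable {n : ℕ}
local notation "E" => EuclideanSpace ℝ (Fin n)

/-- normalized Taylor coefficient of the gradient -/
noncomputable def bb (u : E → ℝ) (j : ℕ) (x : E) : ℝ := ‖iteratedFDeriv ℝ (j+1) u x‖ / (j.factorial : ℝ)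

/-- sup of the gradient on a ball -/
noncomputable def MM (u : E → ℝ) (x : E) (s : ℝ) : ℝ := supGrad u (ball x s)

/-- Cauchy constant -/
noncomputable def Cc (n : ℕ) : ℝ := 24 * (13 + 2 * n)

lemma Cc_ge (n : ℕ) : 1 ≤ Cc n := by unfold Cc; linarith [(Nat.cast_nonneg n : (0:ℝ) ≤ n)]

lemma bb_nonneg (u : E → ℝ) (j : ℕ) (x : E) : 0 ≤ bb u j x := by unfold bb; positivity

lemma bb_zero (u : E → ℝ) (x : E) : bb u 0 x = ‖fderiv ℝ u x‖ := by
  unfold bb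
  rw [← norm_iteratedFDeriv_fderiv]; simp

lemma ball_sub_one {x : E} {s : ℝ} (h : ‖x‖ + s ≤ 1) : ball x s ⊆ ball 0 1 := by
  apply ball_subset_ball'; rw [dist_zero_right]; linarith

lemma sub_two {x y : E} {s : ℝ} (h : ‖x‖ + s ≤ 1) (hy : y ∈ ball x s) : y ∈ ball (0:E) 2 :=
  ball_subset_ball (by norm_num) (ball_sub_one h hy)

lemma bdd_grad {u : E → ℝ} (hu : IsHarmonicOn u (ball 0 2)) {A : Set E} (hA : A ⊆ ball 0 1) :
    BddAbove ((fun x => ‖fderiv ℝ u x‖) '' A) := by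
  have hc : ContinuousOn (fun x => ‖fderiv ℝ u x‖) (closedBall (0:E) 1) := by
    intro x hx
    have hx2 : x ∈ ball (0:E) 2 := closedBall_subset_ball (by norm_num) hx
    have h1 : ContinuousAt (fderiv ℝ u) x :=
      ((harm_cda isOpen_ball hu hx2).fderiv_right (m := 1) (by exact two_le_top)).continuousAt
    exact h1.norm.continuousWithinAt
  exact ((isCompact_closedBall (0:E) 1).image_of_continuousOn hc).bddAbove.mono
    (image_mono (hA.trans ball_subset_closedBall))

lemma le_MM {u : E → ℝ} (hu : IsHarmonicOn u (ball 0 2)) {x y : E} {s : ℝ} (hx : ‖x‖ + s ≤ 1)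
    (hy : y ∈ ball x s) : ‖fderiv ℝ u y‖ ≤ MM u x s :=
  le_csSup (bdd_grad hu (ball_sub_one hx)) ⟨y, hy, rfl⟩

lemma MM_le {u : E → ℝ} {x : E} {s c : ℝ} (hs : 0 < s) (h : ∀ y ∈ ball x s, ‖fderiv ℝ u y‖ ≤ c) :
    MM u x s ≤ c :=
  csSup_le ((nonempty_ball.2 hs).image _) (by rintro _ ⟨y, hy, rfl⟩; exact h y hy)

lemma MM_nonneg (u : E → ℝ) (x : E) (s : ℝ) : 0 ≤ MM u x s := by
  apply Real.sSup_nonneg; rintro _ ⟨y, _, rfl⟩; exact norm_nonneg _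

lemma MM_mono {u : E → ℝ} (hu : IsHarmonicOn u (ball 0 2)) {x y : E} {s t : ℝ} (hs : 0 < s)
    (hy : ‖y‖ + t ≤ 1) (h : dist x y + s ≤ t) : MM u x s ≤ MM u y t :=
  MM_le hs fun _ hz => le_MM hu hy (ball_subset_ball' (by linarith) hz)

lemma cauchy_aux {u : E → ℝ} {U : Set E} (hU : IsOpen U) (hu : IsHarmonicOn u U) {δ m : ℝ} (hδ : 0 < δ) (j : ℕ) :
    ∀ z : E, closedBall z (j * δ) ⊆ U → (∀ y ∈ closedBall z (j * δ), ‖fderiv ℝ u y‖ ≤ m) →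
      ‖iteratedFDeriv ℝ (j+1) u z‖ ≤ ((13 + 2 * n) / δ) ^ j * m := by
  induction j with
  | zero =>
    intro z hz hm
    have := hm z (by simp)
    rw [← norm_iteratedFDeriv_fderiv]; simpa using this
  | succ j ih =>
    intro z hz hm
    have hsub : ∀ y ∈ closedBall z δ, closedBall y (j * δ) ⊆ closedBall z ((j+1 : ℕ) * δ) := by
      intro y hy
      apply closedBall_subset_closedBall'
      rw [mem_closedBall] at hy; push_cast; linarith
    have hj : (0:ℝ) ≤ j * δ := by positivity
    have := iter_norm_step hU hu (j+1) (z := z) hδ (m := ((13 + 2 * n) / δ) ^ j * m)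
      (fun y hy => hz (hsub y hy (mem_closedBall_self hj)))
      (fun y hy => ih y ((hsub y hy).trans hz) fun y' hy' => hm y' (hsub y hy hy'))
    refine this.trans (le_of_eq ?_); ring

lemma pow_self_le (j : ℕ) : (j:ℝ)^j ≤ 3^j * (j.factorial : ℝ) := by
  have h := Real.pow_div_factorial_le_exp (j:ℝ) (by positivity) j
  have h2 : Real.exp j ≤ 3^j := by
    have h1 : Real.exp 1 ≤ 3 := by have := Real.exp_one_lt_d9; linarith
    calc Real.exp j = (Real.exp 1)^j := by rw [← Real.exp_nat_mul]; simp
      _ ≤ 3^j := pow_le_pow_left₀ (Real.exp_pos _).le h1 _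
  have h3 : (0:ℝ) < j.factorial := by exact_mod_cast j.factorial_pos
  rw [div_le_iff₀ h3] at h
  nlinarith

lemma cauchy {u : E → ℝ} (hu : IsHarmonicOn u (ball 0 2)) {x z : E} {s : ℝ} (hs : 0 < s) (hx : ‖x‖ + s ≤ 1)
    (hz : dist z x ≤ s / 2) (j : ℕ) : bb u j z ≤ (Cc n / 2 / s) ^ j * MM u x s := by
  have hf : (0:ℝ) < j.factorial := by exact_mod_cast j.factorial_pos
  have hM := MM_nonneg u x s
  unfold bb
  rw [div_le_iff₀ hf]
  rcases Nat.eq_zero_or_pos j with hj | hj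
  · subst hj
    have : ‖iteratedFDeriv ℝ (0+1) u z‖ = ‖fderiv ℝ u z‖ := by
      rw [← norm_iteratedFDeriv_fderiv]; simp
    rw [this]
    simpa using le_MM hu hx (by rw [mem_ball]; linarith)
  have hj' : (0:ℝ) < j := by exact_mod_cast hj
  have hδ : 0 < s / 4 / j := by positivity
  have hsub : closedBall z (j * (s/4/j)) ⊆ ball x s := by
    intro y hy
    rw [mem_closedBall, mul_div_cancel₀ _ hj'.ne'] at hy
    rw [mem_ball]
    linarith [dist_triangle y z x]
  have := cauchy_aux isOpen_ball hu hδ j z (fun y hy => sub_two hx (hsub hy)) (m := MM u x s)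
    (fun y hy => le_MM hu hx (hsub hy))
  refine this.trans ?_
  have e : ((13 + 2 * (n:ℝ)) / (s/4/j))^j = (4 * (13 + 2 * n) / s)^j * (j:ℝ)^j := by
    rw [← mul_pow]; congr 1; field_simp
  have e2 : (Cc n / 2 / s)^j = (4 * (13 + 2 * n) / s)^j * 3^j := by
    rw [← mul_pow]; congr 1; unfold Cc; ring
  rw [e, e2]
  have h4 : 0 ≤ (4 * (13 + 2 * (n:ℝ)) / s)^j := by positivity
  have := mul_le_mul_of_nonneg_left (pow_self_le j) (mul_nonneg h4 hM)
  nlinarith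

lemma bb_bound {u : E → ℝ} (j : ℕ) (x : E) : ‖iteratedFDeriv ℝ (j+1) u x‖ = j.factorial * bb u j x := by
  have hf : (j.factorial:ℝ) ≠ 0 := by exact_mod_cast j.factorial_pos.ne'
  unfold bb; field_simp

lemma cauchy' {u : E → ℝ} (hu : IsHarmonicOn u (ball 0 2)) {x z : E} {s : ℝ} (hs : 0 < s) (hx : ‖x‖ + s ≤ 1)
    (hz : dist z x ≤ s / 2) (j : ℕ) : bb u j z ≤ (Cc n / s) ^ j * MM u x s := by
  refine (cauchy hu hs hx hz j).trans ?_
  have := Cc_ge n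
  have hM := MM_nonneg u x s
  gcongr
  linarith

lemma taylor {u : E → ℝ} (hu : IsHarmonicOn u (ball 0 2)) {x h : E} {s : ℝ} (hs : 0 < s) (hx : ‖x‖ + s ≤ 1)
    (hh : ‖h‖ ≤ s / 2) (d : ℕ) :
    ‖fderiv ℝ u (x + h) - ∑ k ∈ Finset.range (d+1), (k.factorial : ℝ)⁻¹ •
      iteratedFDeriv ℝ k (fderiv ℝ u) x (fun _ => h)‖ ≤ (Cc n * ‖h‖ / s) ^ (d+1) * MM u x s := by
  have hM := MM_nonneg u x s
  have hseg : ∀ t : ℝ, t ∈ Icc (0:ℝ) 1 → dist (x + t • h) x ≤ s / 2 := by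
    intro t ht
    rw [dist_eq_norm, add_sub_cancel_left, norm_smul, Real.norm_eq_abs, abs_of_nonneg ht.1]
    nlinarith [ht.2, norm_nonneg h]
  have hT := map_add_eq_sum_add_integral_iteratedFDeriv (f := fderiv ℝ u) (x := x) (y := h) (n := d) (by
    intro t ht
    have hy : x + t • h ∈ ball (0:E) 2 := sub_two hx (by rw [mem_ball]; linarith [hseg t ht])
    refine (harm_cda isOpen_ball hu hy).fderiv_right ?_
    have : ((d + 1 + 1 : ℕ) : WithTop ℕ∞) ≤ ((⊤ : ℕ∞) : WithTop ℕ∞) :=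
      WithTop.coe_le_coe.2 (le_top : ((d+1+1 : ℕ) : ℕ∞) ≤ ⊤)
    exact_mod_cast this)
  rw [hT, add_sub_cancel_left, norm_smul]
  set B : ℝ := (d+1).factorial * ((Cc n / 2 / s)^(d+1) * MM u x s) * ‖h‖^(d+1) with hB
  have hB0 : 0 ≤ B := by have := Cc_ge n; positivity
  have hI : ‖∫ t in (0:ℝ)..1, (1 - t)^d • iteratedFDeriv ℝ (d + 1) (fderiv ℝ u) (x + t • h) (fun _ => h)‖ ≤ B * |1 - 0| := by
    apply intervalIntegral.norm_integral_le_of_norm_le_const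
    intro t ht
    rw [uIoc_of_le zero_le_one] at ht
    have ht' : t ∈ Icc (0:ℝ) 1 := ⟨ht.1.le, ht.2⟩
    rw [norm_smul]
    have h1 : ‖(1 - t)^d‖ ≤ 1 := by
      rw [norm_pow, Real.norm_eq_abs, abs_of_nonneg (by linarith [ht.2])]
      exact pow_le_one₀ (by linarith [ht.2]) (by linarith [ht.1])
    have h2 : ‖iteratedFDeriv ℝ (d + 1) (fderiv ℝ u) (x + t • h) (fun _ => h)‖ ≤ B := by
      refine (ContinuousMultilinearMap.le_opNorm _ _).trans ?_
      rw [norm_iteratedFDeriv_fderiv, bb_bound, hB]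
      simp only [Finset.prod_const, Finset.card_univ, Fintype.card_fin]
      have := cauchy hu hs hx (hseg t ht') (d+1)
      gcongr
    calc _ ≤ 1 * B := mul_le_mul h1 h2 (norm_nonneg _) zero_le_one
      _ = B := one_mul _
  rw [sub_zero, abs_one, mul_one] at hI
  have hf : (0:ℝ) < d.factorial := by exact_mod_cast d.factorial_pos
  rw [norm_inv, Real.norm_eq_abs, abs_of_pos hf]
  refine (mul_le_mul_of_nonneg_left hI (by positivity)).trans ?_
  have e : (d.factorial:ℝ)⁻¹ * B = (d+1) * ((Cc n / 2 / s)^(d+1) * ‖h‖^(d+1) * MM u x s) := by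
    rw [hB, Nat.factorial_succ]; push_cast; field_simp
  have e2 : (Cc n * ‖h‖ / s)^(d+1) = 2^(d+1) * ((Cc n / 2 / s)^(d+1) * ‖h‖^(d+1)) := by
    rw [← mul_pow, ← mul_pow]; congr 1; ring
  rw [e, e2]
  have h2 : ((d:ℝ)+1) ≤ 2^(d+1) := by
    have := Nat.lt_two_pow_self (n := d+1)
    exact_mod_cast this.le
  have h5 : 0 ≤ (Cc n / 2 / s)^(d+1) * ‖h‖^(d+1) * MM u x s := by have := Cc_ge n; positivity
  have := mul_le_mul_of_nonneg_right h2 h5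
  linarith

lemma term_le (u : E → ℝ) (x h : E) (k : ℕ) :
    ‖(k.factorial : ℝ)⁻¹ • iteratedFDeriv ℝ k (fderiv ℝ u) x (fun _ => h)‖ ≤ bb u k x * ‖h‖^k := by
  have hf : (0:ℝ) < k.factorial := by exact_mod_cast k.factorial_pos
  rw [norm_smul, norm_inv, Real.norm_eq_abs, abs_of_pos hf]
  have := (iteratedFDeriv ℝ k (fderiv ℝ u) x).le_opNorm (fun _ => h)
  rw [norm_iteratedFDeriv_fderiv] at this
  simp only [Finset.prod_const, Finset.card_univ, Fintype.card_fin] at this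
  unfold bb
  rw [inv_mul_le_iff₀ hf]
  refine this.trans (le_of_eq ?_); field_simp

lemma T1 {u : E → ℝ} (hu : IsHarmonicOn u (ball 0 2)) {x : E} {s ρ : ℝ} (hρ : 0 < ρ) (hx : ‖x‖ + s ≤ 1)
    (hh : ρ ≤ s / 2) (d : ℕ) :
    MM u x ρ ≤ ∑ k ∈ Finset.range (d+1), bb u k x * ρ ^ k + (Cc n * ρ / s) ^ (d+1) * MM u x s := by
  have hs : 0 < s := by linarith
  refine MM_le hρ fun y hy => ?_
  rw [mem_ball, dist_eq_norm] at hy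
  have h := taylor hu hs hx (h := y - x) (by linarith) d
  rw [add_sub_cancel] at h
  have h2 : ‖∑ k ∈ Finset.range (d+1), (k.factorial : ℝ)⁻¹ •
      iteratedFDeriv ℝ k (fderiv ℝ u) x (fun _ => y - x)‖ ≤ ∑ k ∈ Finset.range (d+1), bb u k x * ρ ^ k := by
    refine (norm_sum_le _ _).trans (Finset.sum_le_sum fun k _ => (term_le u x (y-x) k).trans ?_)
    have := bb_nonneg u k x
    gcongr
  have h3 : (Cc n * ‖y - x‖ / s) ^ (d+1) * MM u x s ≤ (Cc n * ρ / s) ^ (d+1) * MM u x s := by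
    have := MM_nonneg u x s
    have := Cc_ge n
    gcongr
  have := norm_sub_norm_le (fderiv ℝ u y) (∑ k ∈ Finset.range (d+1), (k.factorial : ℝ)⁻¹ •
      iteratedFDeriv ℝ k (fderiv ℝ u) x (fun _ => y - x))
  linarith

lemma T2 {u : E → ℝ} (hu : IsHarmonicOn u (ball 0 2)) {x y : E} {s : ℝ} (hs : 0 < s) (hx : ‖x‖ + s ≤ 1)
    (hh : ‖y - x‖ ≤ s / 2) (d : ℕ) (v : E) :
    |iteratedFDeriv ℝ (d+1) u x (Function.update (fun _ => y - x) (Fin.last d) v)| ≤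
     d.factorial * (‖fderiv ℝ u y‖ + ∑ k ∈ Finset.range d, bb u k x * ‖y - x‖ ^ k +
       (Cc n * ‖y - x‖ / s) ^ (d+1) * MM u x s) * ‖v‖ := by
  have h := taylor hu hs hx hh d
  rw [add_sub_cancel, Finset.sum_range_succ] at h
  set S := ∑ k ∈ Finset.range d, (k.factorial : ℝ)⁻¹ •
      iteratedFDeriv ℝ k (fderiv ℝ u) x (fun _ => y - x) with hS
  have h2 : ‖S‖ ≤ ∑ k ∈ Finset.range d, bb u k x * ‖y - x‖ ^ k :=
    (norm_sum_le _ _).trans (Finset.sum_le_sum fun k _ => (term_le u x (y-x) k))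
  have hf : (0:ℝ) < d.factorial := by exact_mod_cast d.factorial_pos
  set X := iteratedFDeriv ℝ d (fderiv ℝ u) x (fun _ => y - x) with hX
  have h3 : ‖(d.factorial : ℝ)⁻¹ • X‖ ≤ ‖fderiv ℝ u y‖ + ∑ k ∈ Finset.range d, bb u k x * ‖y - x‖ ^ k +
       (Cc n * ‖y - x‖ / s) ^ (d+1) * MM u x s := by
    have e : (d.factorial : ℝ)⁻¹ • X = fderiv ℝ u y - S - (fderiv ℝ u y - (S + (d.factorial : ℝ)⁻¹ • X)) := by abel
    rw [e]
    linarith [norm_sub_le (fderiv ℝ u y - S) (fderiv ℝ u y - (S + (d.factorial : ℝ)⁻¹ • X)),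
      norm_sub_le (fderiv ℝ u y) S]
  rw [norm_smul, norm_inv, Real.norm_eq_abs, abs_of_pos hf, inv_mul_le_iff₀ hf] at h3
  rw [iteratedFDeriv_succ_apply_right]
  have e1 : Fin.init (Function.update (fun _ : Fin (d+1) => y - x) (Fin.last d) v) = fun _ => y - x := by
    ext1 i
    simp [Fin.init, (Fin.castSucc_lt_last i).ne]
  rw [e1, Function.update_self]
  exact (ContinuousLinearMap.le_opNorm X v).trans (mul_le_mul_of_nonneg_right h3 (norm_nonneg v))

lemma T3 {u : E → ℝ} (hu : IsHarmonicOn u (ball 0 2)) {x y z : E} {s c : ℝ} (hz : ‖z‖ + s ≤ 1)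
    (hx : x ∈ ball z s) (hy : y ∈ ball z s) (d : ℕ)
    (hc : ∀ w ∈ ball z s, ‖iteratedFDeriv ℝ (d+1) u w - iteratedFDeriv ℝ (d+1) u x‖ ≤ c) :
    ‖(iteratedFDeriv ℝ (d+1) u x).curryLeft (y - x)‖ ≤
      ‖iteratedFDeriv ℝ d u y‖ + ‖iteratedFDeriv ℝ d u x‖ + c * ‖y - x‖ := by
  have h := Convex.norm_image_sub_le_of_norm_fderiv_le' (𝕜 := ℝ) (f := iteratedFDeriv ℝ d u)
    (φ := fderiv ℝ (iteratedFDeriv ℝ d u) x) (C := c) (s := ball z s) (x := x) (y := y)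
    (fun w hw => (cda_iter (harm_cda isOpen_ball hu (sub_two hz hw)) d).differentiableAt (by simp))
    (fun w hw => by
      refine le_trans (le_of_eq ?_) (hc w hw)
      rw [fderiv_iteratedFDeriv]
      simp only [Function.comp]
      rw [← LinearIsometryEquiv.map_sub, LinearIsometryEquiv.norm_map]) (convex_ball z s) hx hy
  have e : (iteratedFDeriv ℝ (d+1) u x).curryLeft (y - x) = fderiv ℝ (iteratedFDeriv ℝ d u) x (y - x) := rfl
  rw [e]
  set A := iteratedFDeriv ℝ d u y
  set B := iteratedFDeriv ℝ d u x
  set X := fderiv ℝ (iteratedFDeriv ℝ d u) x (y - x)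
  have e2 : X = A - B - (A - B - X) := by abel
  rw [e2]
  linarith [norm_sub_le (A - B) (A - B - X), norm_sub_le A B]

lemma T4 {u : E → ℝ} (hu : IsHarmonicOn u (ball 0 2)) {x y : E} {s : ℝ} (hs : 0 < s) (hx : ‖x‖ + s ≤ 1)
    (hy : ‖y - x‖ ≤ s / 2) (d : ℕ) :
    ‖iteratedFDeriv ℝ (d+1) u y - iteratedFDeriv ℝ (d+1) u x‖ ≤
      (d+1).factorial * ((Cc n / s)^(d+1) * MM u x s) * ‖y - x‖ := by
  have h2 : closedBall x (s/2) ⊆ ball x s := closedBall_subset_ball (by linarith)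
  refine Convex.norm_image_sub_le_of_norm_fderiv_le (𝕜 := ℝ) (f := iteratedFDeriv ℝ (d+1) u) (s := closedBall x (s/2))
    (fun w hw => (cda_iter (harm_cda isOpen_ball hu (sub_two hx (h2 hw))) _).differentiableAt (by simp))
    (fun w hw => ?_) (convex_closedBall x (s/2)) (mem_closedBall_self (by linarith)) (by rwa [mem_closedBall, dist_eq_norm])
  rw [norm_fderiv_iteratedFDeriv, bb_bound]
  have := cauchy' hu hs hx (z := w) (by simpa using hw) (d+1)
  gcongr
end cauchy
end EC


namespace EC

section bad
variable {n : ℕ}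
local notation "E" => EuclideanSpace ℝ (Fin n)

lemma sph_inv (x v w : E) (R : ℝ) (h : ‖v‖ = ‖w‖) :
    ∫ y in sphere x R, (inner ℝ v (y - x))^2 ∂μH[(n:ℝ) - 1] =
    ∫ y in sphere x R, (inner ℝ w (y - x))^2 ∂μH[(n:ℝ) - 1] := by
  let Q : E ≃ₗᵢ[ℝ] E := (Submodule.span ℝ {v - w})ᗮ.reflection
  have hQ : Q v = w := Submodule.reflection_sub h
  let e : E ≃ᵢ E := ((IsometryEquiv.subRight x).trans Q.toIsometryEquiv).trans (IsometryEquiv.addRight x)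
  have he : ∀ y, e y - x = Q (y - x) := fun y => by simp [e]
  have hp := e.measurePreserving_hausdorffMeasure ((n:ℝ) - 1)
  have h1 := hp.setIntegral_preimage_emb e.toHomeomorph.measurableEmbedding (fun y => (inner ℝ w (y - x))^2) (sphere x R)
  have hS : e ⁻¹' (sphere x R) = sphere x R := by
    ext y
    simp only [mem_preimage, mem_sphere, dist_eq_norm, he, LinearIsometryEquiv.norm_map]
  rw [hS] at h1
  rw [← h1]
  congr 1
  ext1 y
  rw [he, ← hQ, LinearIsometryEquiv.inner_map_map]

lemma sph_avg (x v : E) (R : ℝ) (hfin : (μH[(n:ℝ) - 1] : Measure E) (sphere x R) ≠ ∞) :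
    n * ∫ y in sphere x R, (inner ℝ v (y - x))^2 ∂μH[(n:ℝ) - 1] =
      ‖v‖^2 * R^2 * ((μH[(n:ℝ) - 1] : Measure E) (sphere x R)).toReal := by
  have hint : ∀ w : E, IntegrableOn (fun y => (inner ℝ w (y - x))^2) (sphere x R) (μH[(n:ℝ) - 1] : Measure E) := by
    intro w
    have hc : Continuous (fun y : E => (inner ℝ w (y - x))^2) := by fun_prop
    refine hc.continuousOn.integrableOn_of_subset_isCompact (isCompact_sphere x R) (isClosed_sphere.measurableSet) subset_rfl hfin
  have h1 : ∀ i : Fin n, ∫ y in sphere x R, (inner ℝ v (y - x))^2 ∂μH[(n:ℝ) - 1] =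
     ∫ y in sphere x R, (inner ℝ (EuclideanSpace.single i ‖v‖ : E) (y - x))^2 ∂μH[(n:ℝ) - 1] := fun i =>
    sph_inv x v _ R (by simp)
  have h2 : n * ∫ y in sphere x R, (inner ℝ v (y - x))^2 ∂μH[(n:ℝ) - 1] =
     ∑ i : Fin n, ∫ y in sphere x R, (inner ℝ (EuclideanSpace.single i ‖v‖ : E) (y - x))^2 ∂μH[(n:ℝ) - 1] := by
    rw [← Finset.sum_congr rfl fun i _ => h1 i]; simp
  rw [h2, ← integral_finsetSum _ fun i _ => hint _]
  have h3 : ∫ y in sphere x R, ∑ i : Fin n, (inner ℝ (EuclideanSpace.single i ‖v‖ : E) (y - x))^2 ∂μH[(n:ℝ) - 1] =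
    ∫ y in sphere x R, ‖v‖^2 * R^2 ∂μH[(n:ℝ) - 1] := by
    refine setIntegral_congr_fun isClosed_sphere.measurableSet fun y hy => ?_
    have : ‖y - x‖^2 = R^2 := by rw [mem_sphere, dist_eq_norm] at hy; rw [hy]
    rw [← this, EuclideanSpace.real_norm_sq_eq (y - x), Finset.mul_sum]
    refine Finset.sum_congr rfl fun i _ => ?_
    rw [EuclideanSpace.inner_single_left]; simp; ring
  rw [h3, setIntegral_const]
  simp [Measure.real]; ring

/-- bad-point lemma -/
lemma bad_point {u : E → ℝ} (hu : IsHarmonicOn u (ball 0 2)) {x : E} {r : ℝ} (hr : 0 < r) (hx : ‖x‖ + 3 * r ≤ 1)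
    (hn : 1 ≤ n) (hb : x ∈ effCriticalSet u r) :
    ∃ z ∈ ball x (3 * r), ‖fderiv ℝ u x‖ < 10 * (n + 1) * r * bb u 1 z := by
  by_contra! hcon
  set a := ‖fderiv ℝ u x‖ with ha
  have ha0 : 0 ≤ a := norm_nonneg _
  set H := a / (10 * (n + 1) * r) with hH
  have hn' : (1:ℝ) ≤ n := by exact_mod_cast hn
  have hH0 : 0 ≤ H := by positivity
  have hF2 : ∀ z ∈ ball x (3 * r), ‖fderiv ℝ (fderiv ℝ u) z‖ ≤ H := by
    intro z hz
    have := hcon z hz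
    rw [hH, le_div_iff₀ (by positivity)]
    have e : ‖fderiv ℝ (fderiv ℝ u) z‖ = bb u 1 z := by
      unfold bb
      rw [← norm_iteratedFDeriv_fderiv, ← norm_iteratedFDeriv_fderiv]; simp
    rw [e]; linarith
  have hG : ∀ y ∈ ball x (3 * r), ‖fderiv ℝ u y - fderiv ℝ u x‖ ≤ H * ‖y - x‖ := by
    intro y hy
    refine Convex.norm_image_sub_le_of_norm_fderiv_le (𝕜 := ℝ) (s := ball x (3*r)) (fun w hw => ?_) hF2 (convex_ball _ _)
      (mem_ball_self (by positivity)) hy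
    exact ((harm_cda isOpen_ball hu (sub_two hx hw)).fderiv_right (m := 1) (by exact two_le_top)).differentiableAt (by norm_num)
  have hHr : H * r * 20 ≤ a := by
    have e : H * r * (10 * (n+1)) = a := by rw [hH]; field_simp
    have h0 : 0 ≤ H * r := by positivity
    nlinarith
  have hHn : (H * r)^2 * n * 100 ≤ a^2 / 2 := by
    have e : H * r * (10 * (n+1)) = a := by rw [hH]; field_simp
    rw [← e]
    have h0 : 0 ≤ (H * r)^2 := by positivity
    have : (n:ℝ) * 100 ≤ (10 * (n+1))^2/2 := by nlinarith
    nlinarith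
  -- lower bound for the infimum
  have hinf : (19/20 * a)^2 ≤ sInf ((fun y => ‖fderiv ℝ u y‖ ^ 2) '' ball x r) := by
    refine le_csInf ((nonempty_ball.2 hr).image _) ?_
    rintro _ ⟨y, hy, rfl⟩
    have h1 := hG y (ball_subset_ball (by linarith) hy)
    rw [mem_ball, dist_eq_norm] at hy
    have h2 : H * ‖y - x‖ ≤ H * r := by gcongr
    have h3 := norm_sub_norm_le (fderiv ℝ u x) (fderiv ℝ u y)
    rw [norm_sub_rev] at h3
    have : 19/20 * a ≤ ‖fderiv ℝ u y‖ := by linarith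
    exact pow_le_pow_left₀ (by positivity) this 2
  -- first order expansion
  have hL : ∀ y ∈ sphere x (2 * r), |u y - u x - fderiv ℝ u x (y - x)| ≤ H * (2*r) * (2 * r) := by
    intro y hy
    have hs : closedBall x (2*r) ⊆ ball x (3*r) := closedBall_subset_ball (by linarith)
    have := Convex.norm_image_sub_le_of_norm_fderiv_le' (𝕜 := ℝ) (f := u) (φ := fderiv ℝ u x) (C := H * (2 * r))
      (s := closedBall x (2*r)) (x := x) (y := y)
      (fun w hw => (harm_cda isOpen_ball hu (sub_two hx (hs hw))).differentiableAt (by simp))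
      (fun w hw => (hG w (hs hw)).trans (by
        rw [mem_closedBall, dist_eq_norm] at hw; gcongr)) (convex_closedBall _ _)
        (mem_closedBall_self (by positivity)) (sphere_subset_closedBall hy)
    rw [mem_sphere, dist_eq_norm] at hy
    rw [hy] at this
    exact this
  have hmem : sInf ((fun y => ‖fderiv ℝ u y‖ ^ 2) '' ball x r) <
    (n / 16) * r⁻¹ ^ 2 * ⨍ y in Metric.sphere x (2 * r), (u y - u x) ^ 2 ∂μH[(n : ℝ) - 1] := hb
  set A := ⨍ y in Metric.sphere x (2 * r), (u y - u x) ^ 2 ∂μH[(n : ℝ) - 1] with hA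
  have hAle : n * A ≤ 8 * a^2 * r^2 + 32 * n * (H * r)^2 * r^2 := by
    have hR0 : 0 ≤ 8 * a^2 * r^2 + 32 * n * (H * r)^2 * r^2 := by positivity
    rw [setAverage_eq] at hA
    by_cases hfin : (μH[(n:ℝ) - 1] : Measure E) (sphere x (2*r)) = ∞
    · have : A = 0 := by rw [hA]; simp [Measure.real, hfin]
      rw [this]; simpa using hR0
    by_cases hzero : ((μH[(n:ℝ) - 1] : Measure E) (sphere x (2*r))).toReal = 0
    · have : A = 0 := by rw [hA]; simp [Measure.real, hzero]
      rw [this]; simpa using hR0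
    obtain ⟨v, hv⟩ : ∃ v : E, ∀ w, fderiv ℝ u x w = inner ℝ v w :=
      ⟨(InnerProductSpace.toDual ℝ E).symm (fderiv ℝ u x), fun w => by simp⟩
    have hva : ‖v‖ = a := by
      have : fderiv ℝ u x = InnerProductSpace.toDual ℝ E v := by ext w; simp [hv]
      rw [ha, this]; simp
    have havg := sph_avg x v (2*r) hfin
    set m := ((μH[(n:ℝ) - 1] : Measure E) (sphere x (2*r))).toReal with hm
    have hm0 : 0 < m := lt_of_le_of_ne ENNReal.toReal_nonneg (Ne.symm hzero)
    have hci : Continuous (fun y : E => 2 * (inner ℝ v (y - x))^2) := by fun_prop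
    have hi : IntegrableOn (fun y => 2 * (inner ℝ v (y - x))^2) (sphere x (2*r)) (μH[(n:ℝ) - 1] : Measure E) :=
      hci.continuousOn.integrableOn_of_subset_isCompact (isCompact_sphere x _) (isClosed_sphere.measurableSet) subset_rfl hfin
    have hi2 : IntegrableOn (fun _ => 2 * (H * (2*r) * (2*r))^2) (sphere x (2*r)) (μH[(n:ℝ) - 1] : Measure E) :=
      integrableOn_const hfin
    have hint : ∫ y in sphere x (2*r), (u y - u x) ^ 2 ∂μH[(n : ℝ) - 1] ≤
       ∫ y in sphere x (2*r), (2 * (inner ℝ v (y - x))^2 + 2 * (H * (2*r) * (2*r))^2) ∂μH[(n : ℝ) - 1] := by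
      refine integral_mono_of_nonneg (Filter.Eventually.of_forall fun y => sq_nonneg _) (hi.add hi2) ?_
      refine (ae_restrict_iff' isClosed_sphere.measurableSet).2 (Filter.Eventually.of_forall fun y hy => ?_)
      have h1 := hL y hy
      rw [hv] at h1
      have h2 := sq_le_sq' (neg_le_of_abs_le h1) (le_of_abs_le h1)
      simp only
      nlinarith [sq_nonneg (inner ℝ v (y - x) - (u y - u x - inner ℝ v (y - x)))]
    rw [integral_add hi hi2, integral_const_mul, setIntegral_const] at hint
    simp only [Measure.real, smul_eq_mul] at hint hA
    rw [← hm] at hint hA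
    rw [hva] at havg
    rw [hA]
    have e : (n:ℝ) * (m⁻¹ * ∫ y in sphere x (2*r), (u y - u x) ^ 2 ∂μH[(n : ℝ) - 1]) ≤
      n * (m⁻¹ * (2 * ∫ y in sphere x (2*r), (inner ℝ v (y - x))^2 ∂μH[(n : ℝ) - 1] +
        m * (2 * (H * (2*r) * (2*r))^2))) := by gcongr
    refine e.trans (le_of_eq ?_)
    have : (n:ℝ) * (m⁻¹ * (2 * ∫ y in sphere x (2*r), (inner ℝ v (y - x))^2 ∂μH[(n : ℝ) - 1] +
        m * (2 * (H * (2*r) * (2*r))^2))) = m⁻¹ * (2 * (n * ∫ y in sphere x (2*r), (inner ℝ v (y - x))^2 ∂μH[(n : ℝ) - 1]))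
         + m⁻¹ * m * (n * (2 * (H * (2*r) * (2*r))^2)) := by ring
    rw [this, havg]; field_simp; ring
  have : (n / 16) * r⁻¹ ^ 2 * A ≤ a^2/2 + 2 * n * (H * r)^2 := by
    have e : (n / 16) * r⁻¹ ^ 2 * A = (n * A) * (r⁻¹^2 / 16) := by ring
    rw [e]
    refine (mul_le_mul_of_nonneg_right hAle (by positivity)).trans (le_of_eq ?_)
    field_simp; ring
  nlinarith [sq_nonneg a]
end bad
end EC


namespace EC

section tens
variable {n : ℕ}
local notation "E" => EuclideanSpace ℝ (Fin n)

lemma slot_le {d : ℕ} {T : ContinuousMultilinearMap ℝ (fun _ : Fin (d+1) => E) ℝ} (hT : SymT T)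
    {c : ℝ} (j : Fin (d+1)) (v : Fin (d+1) → E) (ha : ‖T.curryLeft (v j)‖ ≤ c) :
    |T v| ≤ c * ∏ l ∈ Finset.univ.erase j, ‖v l‖ := by
  rw [← hT 0 j]
  have e : T (v ∘ Equiv.swap 0 j) = T.curryLeft (v j) (Fin.tail (v ∘ Equiv.swap 0 j)) := by
    rw [ContinuousMultilinearMap.curryLeft_apply]
    congr 1
    have : v j = (v ∘ Equiv.swap 0 j) 0 := by simp
    rw [this, Fin.cons_self_tail]
  rw [e]
  refine ((T.curryLeft (v j)).le_opNorm _).trans ?_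
  have e2 : ∏ i, ‖Fin.tail (v ∘ Equiv.swap 0 j) i‖ = ∏ l ∈ Finset.univ.erase j, ‖v l‖ := by
    have h1 : ∏ l ∈ (Finset.univ : Finset (Fin (d+1))).erase j, ‖v l‖ =
      ∏ l ∈ (Finset.univ : Finset (Fin (d+1))).erase 0, ‖v (Equiv.swap 0 j l)‖ := by
      symm
      refine Finset.prod_bij (fun l _ => Equiv.swap 0 j l) ?_ ?_ ?_ ?_
      · intro l hl
        simp only [Finset.mem_erase, Finset.mem_univ, and_true] at hl ⊢
        intro h
        apply hl
        have := congrArg (Equiv.swap 0 j) h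
        simpa using this
      · intro a _ b _ h; exact (Equiv.swap 0 j).injective h
      · intro l hl
        refine ⟨Equiv.swap 0 j l, ?_, by simp⟩
        simp only [Finset.mem_erase, Finset.mem_univ, and_true] at hl ⊢
        intro h
        apply hl
        have := congrArg (Equiv.swap 0 j) h
        simpa using this
      · intro l _; rfl
    rw [h1]
    have h2 : (Finset.univ : Finset (Fin (d+1))).erase 0 = Finset.univ.map (Fin.succEmb d) := by
      ext l
      simp only [Finset.mem_erase, Finset.mem_univ, and_true, Finset.mem_map, true_and]
      constructor
      · intro h; exact ⟨l.pred h, by simp⟩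
      · rintro ⟨a, rfl⟩; simp
    rw [h2, Finset.prod_map]
    rfl
  rw [e2]
  exact mul_le_mul_of_nonneg_right ha (Finset.prod_nonneg fun _ _ => norm_nonneg _)

lemma norm_le_comps {k : ℕ} {T : ContinuousMultilinearMap ℝ (fun _ : Fin k => E) ℝ}
    (b : OrthonormalBasis (Fin n) ℝ E) {X : ℝ} (h : ∀ f : Fin k → Fin n, |T (b ∘ f)| ≤ X) (hX : 0 ≤ X) :
    ‖T‖ ≤ n ^ k * X := by
  refine T.opNorm_le_bound (by positivity) fun v => ?_
  have e : v = fun i => ∑ j, (inner ℝ (b j) (v i)) • b j := by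
    ext1 i; exact (b.sum_repr' (v i)).symm
  have e2 : T v = ∑ f : Fin k → Fin n, (∏ i, inner ℝ (b (f i)) (v i)) * T (b ∘ f) := by
    conv_lhs => rw [e]
    rw [ContinuousMultilinearMap.map_sum]
    refine Finset.sum_congr rfl fun f _ => ?_
    rw [ContinuousMultilinearMap.map_smul_univ]; rfl
  rw [e2]
  refine (norm_sum_le _ _).trans ?_
  have : ∀ f ∈ (Finset.univ : Finset (Fin k → Fin n)), ‖(∏ i, inner ℝ (b (f i)) (v i)) * T (b ∘ f)‖ ≤ X * ∏ i, ‖v i‖ := by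
    intro f _
    rw [norm_mul, norm_prod, mul_comm]
    refine mul_le_mul (h f) (Finset.prod_le_prod (fun _ _ => norm_nonneg _) fun i _ => ?_)
      (Finset.prod_nonneg fun _ _ => norm_nonneg _) hX
    have := norm_inner_le_norm (𝕜 := ℝ) (b (f i)) (v i)
    simpa using this
  refine (Finset.sum_le_card_nsmul _ _ _ this).trans (le_of_eq ?_)
  simp; ring

lemma swap_last {d : ℕ} {T : ContinuousMultilinearMap ℝ (fun _ : Fin (d+1) => E) ℝ} (hT : SymT T)
    (j : Fin (d+1)) (v : Fin (d+1) → E) (h : E) (hv : ∀ l, l ≠ j → v l = h) :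
    T v = T (Function.update (fun _ => h) (Fin.last d) (v j)) := by
  rw [← hT j (Fin.last d)]
  congr 1
  ext1 l
  by_cases hl : l = Fin.last d
  · subst hl; simp
  · rw [Function.update_of_ne hl]
    refine hv _ fun h' => hl ?_
    have := congrArg (Equiv.swap j (Fin.last d)) h'
    simpa using this

lemma lemK_comp {d : ℕ} {T : ContinuousMultilinearMap ℝ (fun _ : Fin (d+1) => E) ℝ} (hT : SymT T) (hT' : TrF T)
    (b : OrthonormalBasis (Fin n) ℝ E) {i0 i1 : Fin n} (h01 : i0 ≠ i1) {η A : ℝ} (hη : 0 ≤ η) (hA0 : 0 ≤ A)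
    (hb : ∀ i, i ≠ i0 → i ≠ i1 → ‖T.curryLeft (b i)‖ ≤ η)
    (hA : ∀ v, |T (Function.update (fun _ => b i0) (Fin.last d) v)| ≤ A * ‖v‖) (p : ℕ) :
    ∀ f : Fin (d+1) → Fin n, (Finset.univ.filter fun l => f l = i1).card ≤ p →
      |T (b ∘ f)| ≤ A + (p+1) * (n * η) := by
  have hn : (1:ℝ) ≤ n := by
    have : 0 < n := i0.pos
    exact_mod_cast this
  have hnη : η ≤ n * η := by nlinarith
  have hη0 : 0 ≤ n * η := by positivity
  have hoth : ∀ f : Fin (d+1) → Fin n, ∀ l, f l ≠ i0 → f l ≠ i1 → |T (b ∘ f)| ≤ η := by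
    intro f l h0 h1
    have := slot_le hT l (b ∘ f) (hb _ h0 h1)
    simpa using this
  induction p using Nat.strong_induction_on with
  | _ p ih =>
    intro f hf
    have hp : (0:ℝ) ≤ p := by positivity
    by_cases hex : ∃ l, f l ≠ i0 ∧ f l ≠ i1
    · obtain ⟨l, h0, h1⟩ := hex
      have := hoth f l h0 h1
      nlinarith
    push Not at hex
    by_cases hcard : (Finset.univ.filter fun l => f l = i1).card ≤ 1
    · -- at most one
      have : ∃ j, ∀ l, l ≠ j → f l = i0 := by
        by_cases hne : ∃ j, f j = i1
        · obtain ⟨j, hj⟩ := hne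
          refine ⟨j, fun l hl => ?_⟩
          by_contra h
          exact hl (Finset.card_le_one.1 hcard l (by simp [hex l h]) j (by simp [hj]))
        · push Not at hne
          exact ⟨0, fun l _ => by by_contra h; exact hne l (hex l h)⟩
      obtain ⟨j, hj⟩ := this
      rw [swap_last hT j (b ∘ f) (b i0) (fun l hl => by simp [hj l hl])]
      have := hA ((b ∘ f) j)
      simp at this
      simp only [Function.comp]
      nlinarith
    · push Not at hcard
      obtain ⟨j, hj, k, hk, hjk⟩ := Finset.one_lt_card.1 hcard
      simp only [Finset.mem_filter, Finset.mem_univ, true_and] at hj hk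
      have hp2 : 2 ≤ p := by omega
      have htr := hT' b j k (b ∘ f) hjk
      have hup : ∀ l, Function.update (Function.update (b ∘ f) j (b l)) k (b l) =
          b ∘ (Function.update (Function.update f j l) k l) := by
        intro l
        rw [Function.comp_update, Function.comp_update]
      simp only [hup] at htr
      have h1 : Function.update (Function.update f j i1) k i1 = f := by
        rw [← hj, Function.update_eq_self, hj, ← hk, Function.update_eq_self]
      rw [← Finset.add_sum_erase _ _ (Finset.mem_univ i1), h1,
        ← Finset.add_sum_erase _ _ (Finset.mem_erase.2 ⟨h01, Finset.mem_univ i0⟩)] at htr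
      have hb0 : |T (b ∘ Function.update (Function.update f j i0) k i0)| ≤ A + ((p - 2 : ℕ)+1) * (n * η) := by
        refine ih (p-2) (by omega) _ ?_
        have hsub : (Finset.univ.filter fun l => Function.update (Function.update f j i0) k i0 l = i1) ⊆
          ((Finset.univ.filter fun l => f l = i1).erase j).erase k := by
          intro l hl
          simp only [Finset.mem_filter, Finset.mem_univ, true_and, Finset.mem_erase] at hl ⊢
          by_cases hlk : l = k
          · subst hlk; simp [h01] at hl
          · rw [Function.update_of_ne hlk] at hl
            by_cases hlj : l = j
            · subst hlj; simp [h01] at hl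
            · rw [Function.update_of_ne hlj] at hl; exact ⟨hlk, hlj, hl⟩
        refine (Finset.card_le_card hsub).trans ?_
        rw [Finset.card_erase_of_mem (by simp [hk, Ne.symm hjk]), Finset.card_erase_of_mem (by simp [hj])]
        omega
      have hrest : |∑ l ∈ (Finset.univ.erase i1).erase i0, T (b ∘ Function.update (Function.update f j l) k l)| ≤ n * η := by
        refine (Finset.abs_sum_le_sum_abs _ _).trans ?_
        have : ∀ l ∈ ((Finset.univ : Finset (Fin n)).erase i1).erase i0, |T (b ∘ Function.update (Function.update f j l) k l)| ≤ η := by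
          intro l hl
          simp only [Finset.mem_erase, Finset.mem_univ, and_true] at hl
          exact hoth _ k (by simpa using hl.1) (by simpa using hl.2)
        refine (Finset.sum_le_card_nsmul _ _ _ this).trans ?_
        rw [nsmul_eq_mul]
        have hc : (((Finset.univ : Finset (Fin n)).erase i1).erase i0).card ≤ n := by
          refine (Finset.card_le_univ _).trans (by simp)
        gcongr
      have hcast : ((p - 2 : ℕ) : ℝ) = p - 2 := by push_cast [hp2]; ring
      rw [hcast] at hb0
      have h5 : T (b ∘ f) = -(T (b ∘ Function.update (Function.update f j i0) k i0)) -
        ∑ l ∈ (Finset.univ.erase i1).erase i0, T (b ∘ Function.update (Function.update f j l) k l) := by linarith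
      rw [h5]
      refine (abs_sub _ _).trans ?_
      rw [abs_neg]
      nlinarith

lemma lemK {d : ℕ} {T : ContinuousMultilinearMap ℝ (fun _ : Fin (d+1) => E) ℝ} (hT : SymT T) (hT' : TrF T)
    (b : OrthonormalBasis (Fin n) ℝ E) {i0 i1 : Fin n} (h01 : i0 ≠ i1) {η A : ℝ} (hη : 0 ≤ η) (hA0 : 0 ≤ A)
    (hb : ∀ i, i ≠ i0 → i ≠ i1 → ‖T.curryLeft (b i)‖ ≤ η)
    (hA : ∀ v, |T (Function.update (fun _ => b i0) (Fin.last d) v)| ≤ A * ‖v‖) :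
    ‖T‖ ≤ n ^ (d+1) * (A + (d+2) * (n * η)) := by
  refine norm_le_comps b (fun f => ?_) (by positivity)
  have := lemK_comp hT hT' b h01 hη hA0 hb hA (d+1) f ((Finset.card_le_univ _).trans (by simp))
  refine this.trans (le_of_eq ?_)
  push_cast; ring

lemma ext_basis (b : OrthonormalBasis (Fin n) ℝ E) {m : ℕ} (hm : m < n) {h : E} (hh : ‖h‖ = 1)
    (horth : ∀ i : Fin n, (i:ℕ) < m → inner ℝ (b i) h = 0) :
    ∃ b' : OrthonormalBasis (Fin n) ℝ E, (∀ i : Fin n, (i:ℕ) < m → b' i = b i) ∧ b' ⟨m, hm⟩ = h := by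
  classical
  let v : Fin n → E := fun i => if i = ⟨m, hm⟩ then h else b i
  have hv : Orthonormal ℝ (({i : Fin n | (i:ℕ) ≤ m} : Set (Fin n)).domRestrict v) := by
    constructor
    · rintro ⟨i, hi⟩
      simp only [Set.domRestrict_apply, v]
      split_ifs
      · exact hh
      · simp
    · rintro ⟨i, hi⟩ ⟨j, hj⟩ hij
      have hij' : i ≠ j := fun h => hij (Subtype.ext h)
      simp only [Set.domRestrict_apply, v]
      simp only [Set.mem_ofPred_eq] at hi hj
      by_cases h1 : i = ⟨m, hm⟩ <;> by_cases h2 : j = ⟨m, hm⟩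
      · exact absurd (h1.trans h2.symm) hij'
      · rw [if_pos h1, if_neg h2, real_inner_comm]
        exact horth j (lt_of_le_of_ne hj fun h => h2 (Fin.ext h))
      · rw [if_neg h1, if_pos h2]
        exact horth i (lt_of_le_of_ne hi fun h => h1 (Fin.ext h))
      · rw [if_neg h1, if_neg h2]
        exact b.orthonormal.2 hij'
  obtain ⟨b', hb'⟩ := hv.exists_orthonormalBasis_extension_of_card_eq (by simp)
  refine ⟨b', fun i hi => ?_, ?_⟩
  · rw [hb' i (by simp; omega)]
    have : i ≠ ⟨m, hm⟩ := fun h => by rw [h] at hi; simp at hi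
    simp [v, this]
  · rw [hb' _ (by simp)]; simp [v]

/-- coordinates on the first m basis vectors -/
noncomputable def prj (b : OrthonormalBasis (Fin n) ℝ E) {m : ℕ} (hm : m ≤ n) : E →ₗ[ℝ] EuclideanSpace ℝ (Fin m) where
  toFun w := WithLp.toLp 2 fun i => inner ℝ (b (Fin.castLE hm i)) w
  map_add' x y := by ext i; simp [inner_add_right]
  map_smul' c x := by ext i; simp [inner_smul_right]

lemma prj_apply (b : OrthonormalBasis (Fin n) ℝ E) {m : ℕ} (hm : m ≤ n) (w : E) (i : Fin m) :
    prj b hm w i = inner ℝ (b (Fin.castLE hm i)) w := rfl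

lemma sub_orth (b : OrthonormalBasis (Fin n) ℝ E) {m : ℕ} (hm : m ≤ n) :
    Orthonormal ℝ (fun i : Fin m => b (Fin.castLE hm i)) :=
  b.orthonormal.comp _ (Fin.castLE_injective hm)

lemma prj_sq (b : OrthonormalBasis (Fin n) ℝ E) {m : ℕ} (hm : m ≤ n) (w : E) :
    ‖prj b hm w‖^2 = ∑ i : Fin m, (inner ℝ (b (Fin.castLE hm i)) w)^2 := by
  rw [EuclideanSpace.real_norm_sq_eq]; rfl

lemma prj_le (b : OrthonormalBasis (Fin n) ℝ E) {m : ℕ} (hm : m ≤ n) (w : E) : ‖prj b hm w‖ ≤ ‖w‖ := by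
  have h := (sub_orth b hm).sum_inner_products_le w (s := Finset.univ)
  refine le_of_sq_le_sq ?_ (norm_nonneg _)
  rw [prj_sq]
  simpa using h

/-- perpendicular part -/
noncomputable def par (b : OrthonormalBasis (Fin n) ℝ E) {m : ℕ} (hm : m ≤ n) (w : E) : E :=
  ∑ i : Fin m, (inner ℝ (b (Fin.castLE hm i)) w) • b (Fin.castLE hm i)

lemma perp_inner (b : OrthonormalBasis (Fin n) ℝ E) {m : ℕ} (hm : m ≤ n) (w : E) (i : Fin m) :
    inner ℝ (b (Fin.castLE hm i)) (w - par b hm w) = 0 := by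
  have := (sub_orth b hm).inner_right_fintype (fun i : Fin m => inner ℝ (b (Fin.castLE hm i)) w) i
  rw [inner_sub_right]
  unfold par
  rw [this]; simp

lemma perp_norm (b : OrthonormalBasis (Fin n) ℝ E) {m : ℕ} (hm : m ≤ n) (w : E) :
    ‖w‖^2 = ‖prj b hm w‖^2 + ‖w - par b hm w‖^2 := by
  have h0 : inner ℝ (par b hm w) (w - par b hm w) = 0 := by
    conv_lhs => enter [2]; unfold par
    rw [sum_inner]
    refine Finset.sum_eq_zero fun i _ => ?_
    rw [inner_smul_left, perp_inner]; simp
  have h1 : ‖par b hm w‖^2 = ‖prj b hm w‖^2 := by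
    rw [← real_inner_self_eq_norm_sq, prj_sq]
    have : inner ℝ (par b hm w) (par b hm w) = inner ℝ (par b hm w) w := by
      have := h0
      rw [inner_sub_right] at this; linarith
    rw [this]
    unfold par
    rw [sum_inner]
    refine Finset.sum_congr rfl fun i _ => ?_
    rw [inner_smul_left]; simp; ring
  have e : w = par b hm w + (w - par b hm w) := by abel
  conv_lhs => rw [e]
  rw [norm_add_sq_real, h0, h1]; ring

lemma perp_big (b : OrthonormalBasis (Fin n) ℝ E) {m : ℕ} (hm : m ≤ n) (w : E) (h : 2 * ‖prj b hm w‖ < ‖w‖) :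
    ‖w‖ ≤ 2 * ‖w - par b hm w‖ ∧ 0 < ‖w - par b hm w‖ := by
  have e := perp_norm b hm w
  have h0 := norm_nonneg (prj b hm w)
  have h1 := norm_nonneg (w - par b hm w)
  have : ‖w‖ ≤ 2 * ‖w - par b hm w‖ := by nlinarith
  exact ⟨this, by linarith⟩

lemma curry_par {d : ℕ} {T : ContinuousMultilinearMap ℝ (fun _ : Fin (d+1) => E) ℝ}
    (b : OrthonormalBasis (Fin n) ℝ E) {m : ℕ} (hm : m ≤ n) {η : ℝ} (hη : 0 ≤ η)
    (hb : ∀ i : Fin n, (i:ℕ) < m → ‖T.curryLeft (b i)‖ ≤ η) (w : E) :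
    ‖T.curryLeft (par b hm w)‖ ≤ n * η * ‖w‖ := by
  unfold par
  rw [map_sum]
  refine (norm_sum_le _ _).trans ?_
  have : ∀ i ∈ (Finset.univ : Finset (Fin m)), ‖T.curryLeft ((inner ℝ (b (Fin.castLE hm i)) w) • b (Fin.castLE hm i))‖ ≤ η * ‖w‖ := by
    intro i _
    rw [map_smul, norm_smul, mul_comm]
    refine mul_le_mul (hb _ (by simp)) ?_ (norm_nonneg _) hη
    have := norm_inner_le_norm (𝕜 := ℝ) (b (Fin.castLE hm i)) w
    simpa using this
  refine (Finset.sum_le_card_nsmul _ _ _ this).trans ?_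
  have hm' : (m:ℝ) ≤ n := by exact_mod_cast hm
  simp only [Finset.card_univ, Fintype.card_fin, nsmul_eq_mul]
  rw [mul_assoc]
  gcongr

lemma tele {e : ℕ} {T : ContinuousMultilinearMap ℝ (fun _ : Fin (e+2) => E) ℝ} (hT : SymT T) {w w' v : E} {c R : ℝ}
    (hc : ‖T.curryLeft (w - w')‖ ≤ c) (hw : ‖w‖ ≤ R) (hw' : ‖w'‖ ≤ R) :
    |T (Function.update (fun _ => w') (Fin.last (e+1)) v)| ≤
      |T (Function.update (fun _ => w) (Fin.last (e+1)) v)| + (e+1) * (c * (R^e * ‖v‖)) := by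
  have hc0 : 0 ≤ c := (norm_nonneg _).trans hc
  have hR0 : 0 ≤ R := (norm_nonneg _).trans hw
  let g : ℕ → Fin (e+2) → E := fun k => Function.update (fun i => if (i:ℕ) < k then w' else w) (Fin.last (e+1)) v
  have key : ∀ k, k ≤ e + 1 → |T (g k)| ≤ |T (g 0)| + k * (c * (R^e * ‖v‖)) := by
    intro k
    induction k with
    | zero => intro _; simp
    | succ k ih =>
      intro hk
      have hk' : k < e + 2 := by omega
      let j : Fin (e+2) := ⟨k, hk'⟩
      have hj : j ≠ Fin.last (e+1) := by
        intro h; have := congrArg Fin.val h; simp [j] at this; omega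
      have e1 : g (k+1) = Function.update (g k) j w' := by
        ext1 i
        by_cases hi : i = j
        · subst hi; simp [g, hj]; simp [j]
        · rw [Function.update_of_ne hi]
          simp only [g]
          by_cases hl : i = Fin.last (e+1)
          · subst hl; simp
          · rw [Function.update_of_ne hl, Function.update_of_ne hl]
            have : (i:ℕ) ≠ k := fun h => hi (Fin.ext h)
            by_cases h1 : (i:ℕ) < k
            · rw [if_pos h1, if_pos (by omega)]
            · rw [if_neg h1, if_neg (by omega)]
      have e2 : g k = Function.update (g k) j w := by
        symm; rw [Function.update_eq_self_iff]
        simp [g, hj]; simp [j]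
      have e3 : T (g k) - T (g (k+1)) = T (Function.update (g k) j (w - w')) := by
        rw [ContinuousMultilinearMap.map_update_sub, ← e1, ← e2]
      have e4 : |T (Function.update (g k) j (w - w'))| ≤ c * (R^e * ‖v‖) := by
        refine (slot_le hT j _ (by simpa using hc)).trans ?_
        refine mul_le_mul_of_nonneg_left ?_ hc0
        rw [← Finset.prod_erase_mul _ _ (Finset.mem_erase.2 ⟨hj.symm, Finset.mem_univ (Fin.last (e+1))⟩)]
        have hlast : Function.update (g k) j (w - w') (Fin.last (e+1)) = v := by
          rw [Function.update_of_ne hj.symm]; simp [g]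
        rw [hlast]
        refine mul_le_mul_of_nonneg_right ?_ (norm_nonneg _)
        have hcard : (((Finset.univ : Finset (Fin (e+2))).erase j).erase (Fin.last (e+1))).card = e := by
          rw [Finset.card_erase_of_mem (Finset.mem_erase.2 ⟨hj.symm, Finset.mem_univ _⟩),
            Finset.card_erase_of_mem (Finset.mem_univ _)]
          simp
        have : ∏ l ∈ ((Finset.univ : Finset (Fin (e+2))).erase j).erase (Fin.last (e+1)), ‖Function.update (g k) j (w - w') l‖
            ≤ ∏ l ∈ ((Finset.univ : Finset (Fin (e+2))).erase j).erase (Fin.last (e+1)), R := by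
          refine Finset.prod_le_prod (fun _ _ => norm_nonneg _) fun l hl => ?_
          simp only [Finset.mem_erase, Finset.mem_univ, and_true] at hl
          rw [Function.update_of_ne hl.2]
          simp only [g]
          rw [Function.update_of_ne hl.1]
          split_ifs <;> assumption
        rwa [Finset.prod_const, hcard] at this
      have h5 := ih (by omega)
      have h6 : |T (g (k+1))| ≤ |T (g k)| + |T (Function.update (g k) j (w - w'))| := by
        rw [← e3]
        have := abs_sub (T (g k)) (T (g k) - T (g (k+1)))
        simpa using this
      push_cast
      linarith
  have h := key (e+1) le_rfl
  have g0 : g 0 = Function.update (fun _ => w) (Fin.last (e+1)) v := by simp [g]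
  have g1 : g (e+1) = Function.update (fun _ => w') (Fin.last (e+1)) v := by
    ext1 i
    simp only [g]
    by_cases hl : i = Fin.last (e+1)
    · subst hl; simp
    · rw [Function.update_of_ne hl, Function.update_of_ne hl, if_pos]
      have := Fin.val_lt_last hl
      simpa using this
  rw [g0, g1] at h
  push_cast at h
  linarith

lemma smul_last {d : ℕ} (T : ContinuousMultilinearMap ℝ (fun _ : Fin (d+1) => E) ℝ) (c : ℝ) (w v : E) :
    T (Function.update (fun _ => c • w) (Fin.last d) v) = c^d * T (Function.update (fun _ => w) (Fin.last d) v) := by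
  have e : Function.update (fun _ => c • w) (Fin.last d) v =
    fun i => (Function.update (fun _ => c) (Fin.last d) 1 : Fin (d+1) → ℝ) i • Function.update (fun _ => w) (Fin.last d) v i := by
    ext1 i
    by_cases hl : i = Fin.last d
    · subst hl; simp
    · simp [hl]
  rw [e, ContinuousMultilinearMap.map_smul_univ]
  congr 1
  rw [Fin.prod_univ_castSucc]
  simp [(Fin.castSucc_lt_last _).ne]

lemma Vmax (hn : 2 ≤ n) {e : ℕ} {T : ContinuousMultilinearMap ℝ (fun _ : Fin (e+2) => E) ℝ} (hT : SymT T) (hT' : TrF T)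
    (hT0 : 0 < ‖T‖) {η0 : ℝ} (hη0 : 0 < η0)
    (hsm : η0 * (2*(n+1))^n * (n^(e+2) * (2^(e+1) * (1 + 2*n*(e+2)))) < 1) :
    ∃ m, m ≤ n - 2 ∧ ∃ π : E →ₗ[ℝ] EuclideanSpace ℝ (Fin m), (∀ w, ‖π w‖ ≤ ‖w‖) ∧
      (∀ w, ‖T.curryLeft w‖ ≤ η0 * ‖T‖ * ‖w‖ → ‖w‖ ≤ 2 * ‖π w‖) ∧
      (m = n - 2 → ∀ w, (∀ v, |T (Function.update (fun _ => w) (Fin.last (e+1)) v)| ≤ η0 * ‖T‖ * ‖w‖^(e+1) * ‖v‖) →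
        ‖w‖ ≤ 2 * ‖π w‖) := by
  classical
  set B : ℝ := 2 * (n+1) with hB
  have hn2 : (2:ℝ) ≤ n := by exact_mod_cast hn
  have hB1 : 1 ≤ B := by rw [hB]; linarith
  let P : ℕ → Prop := fun m => ∃ b : OrthonormalBasis (Fin n) ℝ E, ∀ i : Fin n, (i:ℕ) < m →
    ‖T.curryLeft (b i)‖ ≤ η0 * B^m * ‖T‖
  have hP0 : P 0 := ⟨EuclideanSpace.basisFun (Fin n) ℝ, fun i hi => absurd hi (by omega)⟩
  set m := Nat.findGreatest P n with hm
  have hPm : P m := Nat.findGreatest_spec (P := P) (Nat.zero_le n) hP0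
  have hmn : m ≤ n := Nat.findGreatest_le n
  obtain ⟨b, hb⟩ := hPm
  set η := η0 * B^m with hη
  have hηpos : 0 < η := by positivity
  have hη0η : η0 ≤ η := by
    rw [hη]; exact le_mul_of_one_le_right hη0.le (one_le_pow₀ hB1)
  have hηn : η ≤ η0 * B^n := by rw [hη]; gcongr
  have hsm' : η * (n^(e+2) * (2^(e+1) * (1 + 2*n*(e+2)))) < 1 :=
    lt_of_le_of_lt (mul_le_mul_of_nonneg_right hηn (by positivity)) hsm
  have contra : ∀ A : ℝ, A ≤ 2^(e+1) * (1 + n*(e+1)) * η * ‖T‖ →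
      ¬ (‖T‖ ≤ n ^ (e+1+1) * (A + ((e+1:ℕ)+2) * (n * (η * ‖T‖)))) := by
    intro A hA h
    have h1 : n ^ (e+1+1) * (A + ((e+1:ℕ)+2) * (n * (η * ‖T‖))) ≤
      n^(e+2) * (2^(e+1) * (1 + n*(e+1)) * η * ‖T‖ + 2^(e+1) * (n * (e+3)) * (η * ‖T‖)) := by
      have h2 : (1:ℝ) ≤ 2^(e+1) := one_le_pow₀ (by norm_num)
      have h3 : ((e+1:ℕ)+2) * (n * (η * ‖T‖)) ≤ 2^(e+1) * (n * (e+3)) * (η * ‖T‖) := by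
        push_cast
        have : 0 ≤ (n * ((e:ℝ)+3)) * (η * ‖T‖) := by positivity
        nlinarith
      exact mul_le_mul_of_nonneg_left (by linarith) (by positivity)
    have h4 : n^(e+2) * (2^(e+1) * (1 + n*(e+1)) * η * ‖T‖ + 2^(e+1) * (n * (e+3)) * (η * ‖T‖)) =
      η * (n^(e+2) * (2^(e+1) * (1 + 2*n*(e+2)))) * ‖T‖ := by ring
    rw [h4] at h1
    nlinarith
  have hm2 : m ≤ n - 2 := by
    by_contra hcon
    have hm1 : n - 1 ≤ m := by omega
    have h01 : (⟨0, by omega⟩ : Fin n) ≠ ⟨n-1, by omega⟩ := by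
      intro h; have := congrArg Fin.val h; simp at this; omega
    refine contra (η * ‖T‖) ?_ (lemK hT hT' b h01 (by positivity) (by positivity) (fun i _ h1 => hb i ?_) fun v => ?_)
    · have h2 : (1:ℝ) ≤ 2^(e+1) := one_le_pow₀ (by norm_num)
      have : (1:ℝ) ≤ 2^(e+1) * (1 + n*(e+1)) := by
        have : (0:ℝ) ≤ n * (e+1) := by positivity
        nlinarith
      have h3 : 0 ≤ η * ‖T‖ := by positivity
      nlinarith
    · have h2 : (i:ℕ) ≠ n - 1 := fun h => h1 (Fin.ext h)
      have := i.2
      omega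
    · have h0 : (0 : Fin (e+1+1)) ≠ Fin.last (e+1) := by
        intro h; have := congrArg Fin.val h; simp at this
      have := slot_le hT 0 (Function.update (fun _ => b ⟨0, by omega⟩) (Fin.last (e+1)) v) (c := η * ‖T‖) (by
        rw [Function.update_of_ne h0]; exact hb _ (by simp; omega))
      refine this.trans (le_of_eq ?_)
      congr 1
      rw [Finset.prod_eq_single (Fin.last (e+1))]
      · simp
      · intro l _ hl; simp [hl]
      · intro h; simp at h
  have hmlt : m < n := by omega
  refine ⟨m, hm2, prj b hmn, prj_le b hmn, fun w hw => ?_, fun hmeq w hw => ?_⟩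
  · by_contra! hcon
    obtain ⟨h1, h2⟩ := perp_big b hmn w hcon
    set w' := w - par b hmn w with hw'
    obtain ⟨b', hb', hbm⟩ := ext_basis b hmlt (h := ‖w'‖⁻¹ • w') (by
      rw [norm_smul, norm_inv, norm_norm, inv_mul_cancel₀ h2.ne']) (fun i hi => by
      rw [inner_smul_right]
      have := perp_inner b hmn w ⟨i, hi⟩
      have e : Fin.castLE hmn ⟨i, hi⟩ = i := rfl
      rw [e] at this
      rw [this, mul_zero])
    have hle : η ≤ η0 * B^(m+1) := by rw [hη, pow_succ, ← mul_assoc]; exact le_mul_of_one_le_right hηpos.le hB1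
    have hPm1 : P (m+1) := by
      refine ⟨b', fun i hi => ?_⟩
      by_cases him : (i:ℕ) < m
      · rw [hb' i him]
        exact (hb i him).trans (mul_le_mul_of_nonneg_right hle hT0.le)
      · have : i = ⟨m, hmlt⟩ := Fin.ext (by simp; omega)
        rw [this, hbm, map_smul, norm_smul, norm_inv, norm_norm, inv_mul_le_iff₀ h2]
        have h3 := curry_par (T := T) b hmn (η := η * ‖T‖) (by positivity) hb w
        have h4 : ‖T.curryLeft w'‖ ≤ ‖T.curryLeft w‖ + ‖T.curryLeft (par b hmn w)‖ := by
          rw [hw', map_sub]; exact norm_sub_le _ _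
        have h5 : η0 * ‖T‖ * ‖w‖ ≤ η * ‖T‖ * ‖w‖ := by gcongr
        have e : η0 * B^(m+1) = η * (2 * (n+1)) := by rw [hη, pow_succ, hB]; ring
        rw [e]
        have h6 : (n+1) * η * ‖T‖ * ‖w‖ ≤ (n+1) * η * ‖T‖ * (2 * ‖w'‖) := by gcongr
        linarith
    have := Nat.le_findGreatest (P := P) (show m + 1 ≤ n by omega) hPm1
    omega
  · by_contra! hcon
    obtain ⟨h1, h2⟩ := perp_big b hmn w hcon
    set w' := w - par b hmn w with hw'
    obtain ⟨b', hb', hbm⟩ := ext_basis b hmlt (h := ‖w'‖⁻¹ • w') (by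
      rw [norm_smul, norm_inv, norm_norm, inv_mul_cancel₀ h2.ne']) (fun i hi => by
      rw [inner_smul_right]
      have := perp_inner b hmn w ⟨i, hi⟩
      have e : Fin.castLE hmn ⟨i, hi⟩ = i := rfl
      rw [e] at this
      rw [this, mul_zero])
    have hle : ‖w'‖ ≤ ‖w‖ := by
      have := perp_norm b hmn w
      refine le_of_sq_le_sq ?_ (norm_nonneg _)
      nlinarith [sq_nonneg ‖prj b hmn w‖]
    have h01 : (⟨m, hmlt⟩ : Fin n) ≠ ⟨n-1, by omega⟩ := by
      intro h; have := congrArg Fin.val h; simp at this; omega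
    refine contra (2^(e+1) * (1 + n*(e+1)) * η * ‖T‖) le_rfl
      (lemK hT hT' b' h01 (by positivity) (by positivity) (fun i hi0 hi1 => ?_) fun v => ?_)
    · have h3 : (i:ℕ) ≠ n - 1 := fun h => hi1 (Fin.ext h)
      have h4 : (i:ℕ) ≠ m := fun h => hi0 (Fin.ext h)
      have := i.2
      have him : (i:ℕ) < m := by omega
      rw [hb' i him]; exact hb i him
    · rw [hbm, smul_last, abs_mul]
      have h3 := curry_par (T := T) b hmn (η := η * ‖T‖) (by positivity) hb w
      have e5 : w - w' = par b hmn w := by rw [hw']; abel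
      have h4 := tele hT (w := w) (w' := w') (v := v) (c := n * (η * ‖T‖) * ‖w‖) (R := ‖w‖) (by rw [e5]; exact h3) le_rfl hle
      have h5 := hw v
      have h6 : η0 * ‖T‖ * ‖w‖^(e+1) * ‖v‖ ≤ η * ‖T‖ * ‖w‖^(e+1) * ‖v‖ := by gcongr
      have h7 : |T (Function.update (fun _ => w') (Fin.last (e+1)) v)| ≤ (1 + n * (e+1)) * η * ‖T‖ * ‖w‖^(e+1) * ‖v‖ := by
        have : η * ‖T‖ * ‖w‖^(e+1) * ‖v‖ + (e+1) * (n * (η * ‖T‖) * ‖w‖ * (‖w‖^e * ‖v‖)) =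
          (1 + n * (e+1)) * η * ‖T‖ * ‖w‖^(e+1) * ‖v‖ := by ring
        linarith
      have h8 : |‖w'‖⁻¹^(e+1)| * ‖w‖^(e+1) ≤ 2^(e+1) := by
        rw [abs_of_nonneg (by positivity), ← mul_pow]
        refine pow_le_pow_left₀ (by positivity) ?_ _
        rw [inv_mul_le_iff₀ h2]; linarith
      calc _ ≤ |‖w'‖⁻¹^(e+1)| * ((1 + n * (e+1)) * η * ‖T‖ * ‖w‖^(e+1) * ‖v‖) := by gcongr
        _ = (|‖w'‖⁻¹^(e+1)| * ‖w‖^(e+1)) * ((1 + n * (e+1)) * η * ‖T‖ * ‖v‖) := by ring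
        _ ≤ 2^(e+1) * ((1 + n * (e+1)) * η * ‖T‖ * ‖v‖) := by gcongr
        _ = _ := by ring
end tens
end EC


namespace EC

section comb

lemma pack {α : Type*} {m : ℕ} (S : Finset α) (p : α → EuclideanSpace ℝ (Fin m)) (t : α → ℝ)
    (ht : ∀ x ∈ S, 0 < t x) {R : ℝ} (hR : 0 < R) (c : EuclideanSpace ℝ (Fin m))
    (hin : ∀ x ∈ S, dist (p x) c + t x ≤ R)
    (hd : ∀ x ∈ S, ∀ y ∈ S, x ≠ y → t x + t y ≤ dist (p x) (p y)) :
    ∑ x ∈ S, t x ^ m ≤ R ^ m := by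
  classical
  set μ : Measure (EuclideanSpace ℝ (Fin m)) := volume
  have h1 : μ (⋃ x ∈ S, ball (p x) (t x)) = ∑ x ∈ S, μ (ball (p x) (t x)) := by
    apply measure_biUnion_finset
    · intro x hx y hy hxy
      exact ball_disjoint_ball (hd x hx y hy hxy)
    · intro x _; exact measurableSet_ball
  have h2 : μ (⋃ x ∈ S, ball (p x) (t x)) ≤ μ (ball c R) := by
    apply measure_mono
    intro w hw
    simp only [mem_iUnion] at hw
    obtain ⟨x, hx, hw⟩ := hw
    exact ball_subset_ball' (by linarith [hin x hx]) hw
  have hb : ∀ (a : EuclideanSpace ℝ (Fin m)) (ρ : ℝ), 0 < ρ →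
      μ (ball a ρ) = ENNReal.ofReal (ρ ^ m) * μ (ball 0 1) := by
    intro a ρ hρ
    have := Measure.addHaar_ball_of_pos μ a hρ
    rwa [finrank_euclideanSpace_fin] at this
  have h0 : μ (ball 0 1) ≠ 0 := (measure_ball_pos μ _ one_pos).ne'
  have h0' : μ (ball 0 1) ≠ ⊤ := measure_ball_lt_top.ne
  rw [h1, hb c R hR, Finset.sum_congr rfl (fun x hx => hb (p x) (t x) (ht x hx)), ← Finset.sum_mul,
    ENNReal.mul_le_mul_iff_left h0 h0',
    ← ENNReal.ofReal_sum_of_nonneg (fun x hx => pow_nonneg (ht x hx).le _),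
    ENNReal.ofReal_le_ofReal_iff (by positivity)] at h2
  exact h2

lemma greedy {α : Type*} [DecidableEq α] (t : α → ℝ) (R : α → α → Prop) (hR : ∀ x, R x x) :
    ∀ (k : ℕ) (A : Finset α), A.card ≤ k → ∃ S ⊆ A,
      (∀ x ∈ S, ∀ y ∈ S, x ≠ y → (t x ≤ t y ∧ ¬ R x y) ∨ (t y ≤ t x ∧ ¬ R y x)) ∧
      ∀ y ∈ A, ∃ x ∈ S, t x ≤ t y ∧ R x y := by
  classical
  intro k
  induction k with
  | zero =>
    intro A hA
    have : A = ∅ := by simpa using hA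
    subst this
    exact ⟨∅, by simp, by simp, by simp⟩
  | succ k ih =>
    intro A hA
    rcases A.eq_empty_or_nonempty with rfl | hne
    · exact ⟨∅, by simp, by simp, by simp⟩
    obtain ⟨x, hx, hmin⟩ := A.exists_min_image t hne
    have hlt : (A.filter (fun y => ¬ R x y)).card < A.card := by
      apply Finset.card_lt_card
      refine (Finset.ssubset_iff_of_subset (Finset.filter_subset _ _)).2 ⟨x, hx, ?_⟩
      simp [hR x]
    obtain ⟨S, hSA, h1, h2⟩ := ih _ (by omega : (A.filter (fun y => ¬ R x y)).card ≤ k)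
    refine ⟨insert x S, ?_, ?_, ?_⟩
    · intro y hy
      rcases Finset.mem_insert.1 hy with rfl | hy
      · exact hx
      · exact (Finset.mem_filter.1 (hSA hy)).1
    · intro y hy w hw hyw
      rcases Finset.mem_insert.1 hy with hyx | hy'
      · subst hyx
        rcases Finset.mem_insert.1 hw with rfl | hw
        · exact absurd rfl hyw
        · have := Finset.mem_filter.1 (hSA hw)
          exact Or.inl ⟨hmin _ this.1, this.2⟩
      · rcases Finset.mem_insert.1 hw with rfl | hw
        · have := Finset.mem_filter.1 (hSA hy')
          exact Or.inr ⟨hmin _ this.1, this.2⟩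
        · exact h1 y hy' w hw hyw
    · intro y hy
      by_cases h : R x y
      · exact ⟨x, Finset.mem_insert_self _ _, hmin y hy, h⟩
      · obtain ⟨w, hw, h3⟩ := h2 y (Finset.mem_filter.2 ⟨hy, h⟩)
        exact ⟨w, Finset.mem_insert_of_mem hw, h3⟩

variable {n : ℕ}
local notation "E" => EuclideanSpace ℝ (Fin n)

lemma sep_count (A : Finset E) {z : E} {R r : ℝ} (hr : 0 < r) (hR : 0 < R)
    (hA : ∀ x ∈ A, dist x z ≤ R) (hs : ∀ x ∈ A, ∀ y ∈ A, x ≠ y → r ≤ dist x y) :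
    (A.card : ℝ) ≤ (1 + 2 * R / r) ^ n := by
  have h := pack A id (fun _ => r / 2) (fun _ _ => by linarith) (R := R + r / 2) (by linarith) z
    (fun x hx => by simpa using hA x hx) (fun x hx y hy hxy => by simpa using hs x hx y hy hxy)
  rw [Finset.sum_const, nsmul_eq_mul] at h
  have e : R + r / 2 = (1 + 2 * R / r) * (r / 2) := by field_simp; ring
  rw [e, mul_pow] at h
  exact le_of_mul_le_mul_right h (by positivity)

lemma subdiv (A : Finset E) {z : E} {R ε B : ℝ} (hε : 0 < ε) (hR : 0 < R)
    (hA : ∀ x ∈ A, dist x z ≤ R)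
    (hB : ∀ x ∈ A, ((A.filter (fun y => dist y x < ε)).card : ℝ) ≤ B) (hB0 : 0 ≤ B) :
    (A.card : ℝ) ≤ (1 + 2 * R / ε) ^ n * B := by
  classical
  obtain ⟨S, hSA, h1, h2⟩ := greedy (fun _ : E => (0:ℝ)) (fun x y => dist y x < ε)
    (fun x => by simpa using hε) A.card A le_rfl
  have hS := sep_count S (r := ε) hε hR (fun x hx => hA x (hSA hx)) (fun x hx y hy hxy => by
    rcases h1 x hx y hy hxy with h | h
    · rw [dist_comm]; exact not_lt.1 h.2
    · exact not_lt.1 h.2)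
  have hc : A ⊆ S.biUnion (fun x => A.filter (fun y => dist y x < ε)) := by
    intro y hy
    obtain ⟨x, hx, _, h⟩ := h2 y hy
    exact Finset.mem_biUnion.2 ⟨x, hx, Finset.mem_filter.2 ⟨hy, h⟩⟩
  have h3 : (A.card : ℝ) ≤ ∑ x ∈ S, ((A.filter (fun y => dist y x < ε)).card : ℝ) := by
    exact_mod_cast (Finset.card_le_card hc).trans Finset.card_biUnion_le
  calc (A.card : ℝ) ≤ ∑ x ∈ S, B := h3.trans (Finset.sum_le_sum fun x hx => hB x (hSA hx))
    _ = S.card * B := by simp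
    _ ≤ _ := by gcongr

lemma packSum {m : ℕ} (S : Finset E) (t : E → ℝ) (ht : ∀ x ∈ S, 0 < t x) {σ : ℝ} (hσ : 0 < σ)
    (hts : ∀ x ∈ S, t x ≤ σ) {z : E} (hz : ∀ x ∈ S, dist x z ≤ σ)
    (π : E →ₗ[ℝ] EuclideanSpace ℝ (Fin m)) (hπ : ∀ w, ‖π w‖ ≤ ‖w‖)
    (hsep : ∀ x ∈ S, ∀ y ∈ S, x ≠ y → t y / 2 ≤ dist x y)
    (hp : ∀ x ∈ S, ∀ y ∈ S, x ≠ y → ‖x - y‖ ≤ 2 * ‖π (x - y)‖) :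
    ∑ x ∈ S, t x ^ m ≤ (16 * σ) ^ m := by
  have h := pack S (fun x => π x) (fun x => t x / 8) (fun x hx => by linarith [ht x hx]) (R := 2 * σ)
    (by linarith) (π z) (fun x hx => by
      rw [dist_eq_norm, ← map_sub]
      have := hπ (x - z)
      have h2 := hz x hx
      rw [dist_eq_norm] at h2
      linarith [hts x hx]) (fun x hx y hy hxy => by
      rw [dist_eq_norm, ← map_sub]
      have h1 := hp x hx y hy hxy
      have h2 := hsep x hx y hy hxy
      have h3 := hsep y hy x hx hxy.symm
      rw [dist_comm, dist_eq_norm] at h3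
      rw [dist_eq_norm] at h2
      linarith)
  simp only [div_pow] at h
  rw [← Finset.sum_div, div_le_iff₀ (by positivity), ← mul_pow] at h
  refine h.trans (le_of_eq ?_)
  ring

lemma packTotal {m N : ℕ} (hmN : m ≤ N) (S : Finset E) (t : E → ℝ) {σ : ℝ} (hσ : 0 < σ)
    (ht : ∀ x ∈ S, ∃ k : ℕ, t x = σ / 2 ^ k) {z : E} (hz : ∀ x ∈ S, dist x z ≤ σ)
    (π : E →ₗ[ℝ] EuclideanSpace ℝ (Fin m)) (hπ : ∀ w, ‖π w‖ ≤ ‖w‖)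
    (hsep : ∀ x ∈ S, ∀ y ∈ S, x ≠ y → t y / 2 ≤ dist x y)
    (hp : ∀ x ∈ S, ∀ y ∈ S, x ≠ y → t x = t y → ‖x - y‖ ≤ 2 * ‖π (x - y)‖)
    (hp' : m = N → ∀ x ∈ S, ∀ y ∈ S, x ≠ y → ‖x - y‖ ≤ 2 * ‖π (x - y)‖) :
    ∑ x ∈ S, t x ^ N ≤ 2 * (16 * σ) ^ N := by
  classical
  have ht0 : ∀ x ∈ S, 0 < t x := fun x hx => by
    obtain ⟨k, hk⟩ := ht x hx; rw [hk]; positivity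
  have hts : ∀ x ∈ S, t x ≤ σ := fun x hx => by
    obtain ⟨k, hk⟩ := ht x hx; rw [hk]; exact div_le_self hσ.le (one_le_pow₀ (by norm_num))
  rcases hmN.eq_or_lt with rfl | hlt
  · have := packSum S t ht0 hσ hts hz π hπ hsep (hp' rfl)
    have h0 : 0 ≤ (16 * σ) ^ m := by positivity
    linarith
  have hch : ∀ x : E, ∃ k : ℕ, x ∈ S → t x = σ / 2 ^ k := fun x => by
    by_cases hx : x ∈ S
    · obtain ⟨k, hk⟩ := ht x hx; exact ⟨k, fun _ => hk⟩
    · exact ⟨0, fun h => absurd h hx⟩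
  choose κ hκ using hch
  obtain ⟨J, hJ⟩ : ∃ J, ∀ x ∈ S, κ x < J := ⟨S.sup κ + 1, fun x hx => Nat.lt_succ_of_le (Finset.le_sup hx)⟩
  rw [← Finset.sum_fiberwise_of_maps_to (t := Finset.range J) (g := κ) (fun x hx => Finset.mem_range.2 (hJ x hx))]
  have hcl : ∀ k ∈ Finset.range J, ∑ x ∈ S with κ x = k, t x ^ N ≤ (16 * σ) ^ N * (1/2) ^ k := by
    intro k _
    have h1 := packSum (S.filter (fun x => κ x = k)) t (fun x hx => ht0 x (Finset.mem_filter.1 hx).1) hσ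
      (fun x hx => hts x (Finset.mem_filter.1 hx).1) (fun x hx => hz x (Finset.mem_filter.1 hx).1) π hπ
      (fun x hx y hy => hsep x (Finset.mem_filter.1 hx).1 y (Finset.mem_filter.1 hy).1)
      (fun x hx y hy hxy => by
        rw [Finset.mem_filter] at hx hy
        refine hp x hx.1 y hy.1 hxy ?_
        rw [hκ x hx.1, hκ y hy.1, hx.2, hy.2])
    obtain ⟨j, rfl⟩ : ∃ j, N = m + (j + 1) := ⟨N - m - 1, by omega⟩
    have h2 : ∀ x ∈ S.filter (fun x => κ x = k), t x ^ (m + (j+1)) ≤ t x ^ m * ((16 * σ) ^ (j+1) * (1/2)^k) := by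
      intro x hx
      rw [Finset.mem_filter] at hx
      rw [pow_add]
      have h3 : t x ^ (j+1) ≤ (16 * σ) ^ (j+1) * (1/2)^k := by
        have e1 : t x = σ * (1/2)^k := by rw [hκ x hx.1, hx.2, one_div, inv_pow]; rfl
        have h4 : t x ^ j ≤ (16 * σ)^j := pow_le_pow_left₀ (ht0 x hx.1).le (by linarith [hts x hx.1]) _
        have h5 : t x ≤ 16 * σ * (1/2)^k := by
          rw [e1]; have : 0 < σ * (1/2:ℝ)^k := by positivity
          linarith
        calc t x ^ (j+1) = t x ^ j * t x := pow_succ _ _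
          _ ≤ (16*σ)^j * (16 * σ * (1/2)^k) := mul_le_mul h4 h5 (ht0 x hx.1).le (by positivity)
          _ = _ := by ring
      exact mul_le_mul_of_nonneg_left h3 (pow_nonneg (ht0 x hx.1).le _)
    refine (Finset.sum_le_sum h2).trans ?_
    rw [← Finset.sum_mul, pow_add (16 * σ) m (j+1), mul_assoc]
    exact mul_le_mul_of_nonneg_right h1 (by positivity)
  refine (Finset.sum_le_sum hcl).trans ?_
  rw [← Finset.mul_sum, mul_comm]
  refine mul_le_mul_of_nonneg_right ?_ (by positivity)
  have := geom_sum_eq (x := (1/2:ℝ)) (by norm_num) J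
  rw [this]
  have : (0:ℝ) < (1/2)^J := by positivity
  rw [div_le_iff_of_neg (by norm_num)]
  linarith

lemma exists_stop (P : ℝ → Prop) {σ r : ℝ} (hr : 0 < r) (hσ : r ≤ σ) (h : P σ) :
    ∃ t, (∃ k : ℕ, t = σ / 2 ^ k) ∧ r ≤ t ∧ P t ∧ (t / 2 < r ∨ ¬ P (t / 2)) := by
  classical
  have hex : ∃ k : ℕ, σ / 2 ^ k < r ∨ ¬ P (σ / 2 ^ k) := by
    obtain ⟨k, hk⟩ := pow_unbounded_of_one_lt (σ / r) (by norm_num : (1:ℝ) < 2)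
    refine ⟨k, Or.inl ?_⟩
    rw [div_lt_iff₀ hr] at hk
    rw [div_lt_iff₀ (by positivity)]; linarith
  have h1 := Nat.find_spec hex
  have h2 : Nat.find hex ≠ 0 := by
    intro h0
    rw [h0] at h1
    simp only [pow_zero, div_one] at h1
    rcases h1 with h1 | h1
    · linarith
    · exact h1 h
  obtain ⟨k, hk⟩ := Nat.exists_eq_succ_of_ne_zero h2
  have h3 := Nat.find_min hex (m := k) (by omega)
  push Not at h3
  refine ⟨σ / 2^k, ⟨k, rfl⟩, h3.1, h3.2, ?_⟩
  rw [hk, Nat.succ_eq_add_one, pow_succ, ← div_div] at h1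
  exact h1

end comb
end EC


namespace EC

section ul
variable {n : ℕ}
local notation "E" => EuclideanSpace ℝ (Fin n)

/-- largeness conditions on the parameter -/
structure QQ (n D : ℕ) (q : ℝ) : Prop where
  c0 : 1024 ≤ q
  c1 : Cc n ^ (D+1) ≤ q
  c2 : 10 * (n+1) * Cc n ≤ q
  c3 : 8 ^ (D+1) ≤ q
  c4 : (D:ℝ) + 2 ≤ q
  c5 : (2 * ((n:ℝ)+1)) ^ n ≤ q
  c6 : (n:ℝ) ^ (D+1) ≤ q
  c7 : 1 + 2 * (n:ℝ) * (D+1) ≤ q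

/-- upper degree bound -/
def UU (u : E → ℝ) (q : ℝ) (d : ℕ) (x : E) (s : ℝ) : Prop := ∃ i ≤ d, MM u x s ≤ q * (bb u i x * s ^ i)
/-- degree dominance -/
def LL (u : E → ℝ) (q : ℝ) (d : ℕ) (x : E) (t : ℝ) : Prop := MM u x t ≤ q * (bb u d x * t ^ d)
/-- wide degree dominance -/
def WW (u : E → ℝ) (q : ℝ) (d : ℕ) (x : E) (s : ℝ) : Prop := MM u x s ≤ q ^ 3 * (bb u d x * s ^ d)

variable {D d : ℕ} {q : ℝ} {u : EuclideanSpace ℝ (Fin n) → ℝ} {x y : EuclideanSpace ℝ (Fin n)} {s t r : ℝ}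

lemma cpow (hq : QQ n D q) {j : ℕ} (hj : j ≤ D+1) : Cc n ^ j ≤ q :=
  (pow_le_pow_right₀ (Cc_ge n) hj).trans hq.c1

lemma rem (hq : QQ n D q) {i : ℕ} (hi : i ≤ d) (hd : d ≤ D) (ht : 0 < t) (hts : t ≤ s) :
    (Cc n * t / s) ^ (d+1) * s ^ i ≤ q * (t / s) * t ^ i := by
  have hs : 0 < s := lt_of_lt_of_le ht hts
  have h1 : t / s ≤ 1 := (div_le_one hs).2 hts
  have h0 : 0 < t / s := by positivity
  have hq0 : 0 < q := by linarith [hq.c0]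
  have e1 : (Cc n * t / s) ^ (d+1) = Cc n ^ (d+1) * (t/s)^(d+1) := by rw [mul_div_assoc, mul_pow]
  have h2 : (t/s)^(d+1) ≤ (t/s)^(i+1) := pow_le_pow_of_le_one h0.le h1 (by omega)
  calc (Cc n * t / s) ^ (d+1) * s ^ i ≤ q * (t/s)^(i+1) * s^i := by
        rw [e1]
        gcongr
        exact cpow hq (by omega)
    _ = _ := by rw [pow_succ, div_pow]; field_simp

lemma Udown (hq : QQ n D q) (hu : IsHarmonicOn u (ball 0 2)) (hd : d ≤ D) (hx : ‖x‖ + s ≤ 1)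
    (h : UU u q d x s) (ht : 0 < t) (hts : q ^ 5 * t ≤ s) :
    ∃ j ≤ d, MM u x t ≤ (D+2) * (bb u j x * t ^ j) ∧ ∀ k ≤ d, bb u k x * t ^ k ≤ bb u j x * t ^ j := by
  have h1q : 1 ≤ q := by linarith [hq.c0]
  have hq2 : q^2 * t ≤ s := le_trans (by gcongr; norm_num) hts
  have hq20 : (4:ℝ) ≤ q^2 := by nlinarith [hq.c0]
  have hs : 0 < s := by nlinarith
  have hts2 : t ≤ s / 2 := by nlinarith
  obtain ⟨j, hj, hmax⟩ := (Finset.range (d+1)).exists_max_image (fun k => bb u k x * t ^ k) ⟨0, by simp⟩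
  have hjd : j ≤ d := by simpa [Nat.lt_succ_iff] using hj
  have hmax' : ∀ k ≤ d, bb u k x * t ^ k ≤ bb u j x * t ^ j := fun k hk => hmax k (by simp; omega)
  refine ⟨j, hjd, ?_, hmax'⟩
  obtain ⟨i, hi, hM⟩ := h
  have hT := T1 hu ht hx hts2 d
  have hsum : ∑ k ∈ Finset.range (d+1), bb u k x * t ^ k ≤ (d+1) * (bb u j x * t^j) := by
    refine (Finset.sum_le_card_nsmul _ _ _ hmax).trans ?_
    rw [nsmul_eq_mul]; simp
  have hr : (Cc n * t / s) ^ (d+1) * MM u x s ≤ bb u j x * t^j := by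
    have h0 : 0 ≤ bb u i x := bb_nonneg _ _ _
    have hC := Cc_ge n
    calc (Cc n * t / s) ^ (d+1) * MM u x s ≤ (Cc n * t / s) ^ (d+1) * (q * (bb u i x * s ^ i)) := by gcongr
      _ = q * bb u i x * ((Cc n * t / s) ^ (d+1) * s^i) := by ring
      _ ≤ q * bb u i x * (q * (t / s) * t ^ i) := by
        exact mul_le_mul_of_nonneg_left (rem hq hi hd ht (by linarith)) (by positivity)
      _ = (q^2 * t / s) * (bb u i x * t^i) := by ring
      _ ≤ 1 * (bb u i x * t^i) := by
        gcongr; exact (div_le_one hs).2 hq2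
      _ ≤ _ := by rw [one_mul]; exact hmax' i hi
  have h0 : 0 ≤ bb u j x * t ^ j := mul_nonneg (bb_nonneg _ _ _) (by positivity)
  have hdD : (d:ℝ) ≤ D := by exact_mod_cast hd
  nlinarith

lemma Udown' (hq : QQ n D q) (hu : IsHarmonicOn u (ball 0 2)) (hd : d ≤ D) (hx : ‖x‖ + s ≤ 1)
    (h : UU u q d x s) (ht : 0 < t) (hts : q ^ 5 * t ≤ s) (hL : ¬ LL u q d x t) {ρ : ℝ} (hρ : 0 < ρ) (hρt : ρ ≤ t) :
    ∃ e, d = e + 1 ∧ UU u q e x ρ := by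
  have h1q : 1 ≤ q := by linarith [hq.c0]
  obtain ⟨j, hj, h1, h2⟩ := Udown hq hu hd hx h ht hts
  have hjd : j ≠ d := by
    rintro rfl
    exact hL (h1.trans (mul_le_mul_of_nonneg_right hq.c4 (mul_nonneg (bb_nonneg _ _ _) (by positivity))))
  obtain ⟨e, rfl⟩ : ∃ e, d = e + 1 := ⟨d - 1, by omega⟩
  refine ⟨e, rfl, ?_⟩
  obtain ⟨k, hk, h3, h4⟩ := Udown hq hu hd hx h hρ (le_trans (by gcongr) hts)
  have h5 : MM u x ρ ≤ q * (bb u k x * ρ ^ k) :=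
    h3.trans (mul_le_mul_of_nonneg_right hq.c4 (mul_nonneg (bb_nonneg _ _ _) (by positivity)))
  by_cases hke : k ≤ e
  · exact ⟨k, hke, h5⟩
  obtain rfl : k = e + 1 := by omega
  refine ⟨j, by omega, h5.trans ?_⟩
  refine mul_le_mul_of_nonneg_left ?_ (by linarith)
  have h6 := h2 (e+1) le_rfl
  have h7 : (ρ/t)^(e+1) ≤ (ρ/t)^j := pow_le_pow_of_le_one (by positivity) ((div_le_one ht).2 hρt) hj
  have h8 : 0 ≤ bb u j x := bb_nonneg _ _ _
  calc bb u (e+1) x * ρ^(e+1) = (bb u (e+1) x * t^(e+1)) * (ρ/t)^(e+1) := by rw [div_pow]; field_simp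
    _ ≤ (bb u j x * t^j) * (ρ/t)^j := by gcongr
    _ = _ := by rw [div_pow]; field_simp

lemma base (hq : QQ n D q) (hu : IsHarmonicOn u (ball 0 2)) (hn : 1 ≤ n) (hx : ‖x‖ + s ≤ 1)
    (hr : 0 < r) (hs : q ^ 5 * r ≤ s) (h : UU u q 0 x s) (hb : x ∈ effCriticalSet u r) : False := by
  have h1q : 1 ≤ q := by linarith [hq.c0]
  have hq2 : q^2 * r ≤ s := le_trans (by gcongr; norm_num) hs
  have hq20 : (6:ℝ) ≤ q^2 := by nlinarith [hq.c0]
  have hs0 : 0 < s := by nlinarith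
  have h3 : 6 * r ≤ s := by nlinarith
  obtain ⟨i, hi, hM⟩ := h
  obtain rfl : i = 0 := by omega
  rw [pow_zero, mul_one, bb_zero] at hM
  obtain ⟨z, hz, hlt⟩ := bad_point hu hr (by linarith) hn hb
  have h4 := cauchy' hu hs0 hx (z := z) (by rw [mem_ball] at hz; linarith) 1
  rw [pow_one] at h4
  have hC := Cc_ge n
  set g := ‖fderiv ℝ u x‖ with hg
  have hg0 : 0 ≤ g := norm_nonneg _
  have : g < g := by
    calc g < 10*(n+1)*r*bb u 1 z := hlt
      _ ≤ 10*(n+1)*r*(Cc n / s * (q * g)) := by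
        have : 0 ≤ Cc n / s := by positivity
        gcongr
        exact h4.trans (by gcongr)
      _ = (10*(n+1)*Cc n) * q * r / s * g := by ring
      _ ≤ q * q * r / s * g := by gcongr; exact hq.c2
      _ ≤ 1 * g := by
        gcongr
        rw [div_le_one hs0]; linarith
      _ = g := one_mul _
  exact lt_irrefl _ this

lemma LLb (hq : QQ n D q) (hu : IsHarmonicOn u (ball 0 2)) (hd : d ≤ D) (hx : ‖x‖ + t ≤ 1) (ht : 0 < t)
    (h : LL u q d x t) {j : ℕ} (hj : j ≤ d) : bb u j x * t ^ j ≤ q ^ 2 * (bb u d x * t ^ d) := by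
  have hc := cauchy' hu ht hx (z := x) (by rw [dist_self]; positivity) j
  have hM := MM_nonneg u x t
  have h1q : 1 ≤ q := by linarith [hq.c0]
  calc bb u j x * t^j ≤ (Cc n / t)^j * MM u x t * t^j := by gcongr
    _ = Cc n ^ j * MM u x t := by rw [div_pow]; field_simp
    _ ≤ q * (q * (bb u d x * t^d)) := by
      gcongr
      · exact cpow hq (by omega)
      · exact h
    _ = _ := by ring

lemma LLb' (hq : QQ n D q) (hu : IsHarmonicOn u (ball 0 2)) (hd : d ≤ D) (hx : ‖x‖ + t ≤ 1) (ht : 0 < t)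
    (h : LL u q d x t) {j : ℕ} (hj : j < d) {ρ : ℝ} (hρ : t ≤ ρ) :
    bb u j x * ρ ^ j ≤ q ^ 2 * (t / ρ) * (bb u d x * ρ ^ d) := by
  have h1 := LLb hq hu hd hx ht h hj.le
  have hρ0 : 0 < ρ := by linarith
  have h1q : 1 ≤ q := by linarith [hq.c0]
  have hb := bb_nonneg u d x
  have h2 : (t/ρ)^d ≤ (t/ρ)^(j+1) := pow_le_pow_of_le_one (by positivity) ((div_le_one hρ0).2 hρ) hj
  calc bb u j x * ρ^j = bb u j x * t^j * (ρ/t)^j := by rw [div_pow]; field_simp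
    _ ≤ q ^ 2 * (bb u d x * t ^ d) * (ρ/t)^j := by gcongr
    _ = q^2 * (bb u d x * ρ^d) * ((t/ρ)^d * (ρ/t)^j) := by rw [div_pow, div_pow]; field_simp
    _ ≤ q^2 * (bb u d x * ρ^d) * ((t/ρ)^(j+1) * (ρ/t)^j) := by gcongr
    _ = _ := by rw [div_pow, div_pow]; field_simp; ring

lemma UL (hq : QQ n D q) (hu : IsHarmonicOn u (ball 0 2)) (hd : d ≤ D) (hx : ‖x‖ + s ≤ 1) (hs : 0 < s)
    (h : UU u q d x s) (hL : LL u q d x (s / q^5)) : WW u q d x s := by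
  have h1q : 1 ≤ q := by linarith [hq.c0]
  obtain ⟨i, hi, hM⟩ := h
  set σ := s / q^5 with hσ
  have hσ0 : 0 < σ := by positivity
  have hσs : σ ≤ s := div_le_self hs.le (one_le_pow₀ h1q)
  have h1 := LLb hq hu hd (by linarith) hσ0 hL hi
  have es : s = q^5 * σ := by rw [hσ]; field_simp
  have hb := bb_nonneg u d x
  have hbi := bb_nonneg u i x
  have h2 : (q^5)^i ≤ (q^5)^d := pow_le_pow_right₀ (one_le_pow₀ h1q) hi
  unfold WW
  calc MM u x s ≤ q * (bb u i x * s^i) := hM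
    _ = q * ((q^5)^i * (bb u i x * σ^i)) := by rw [es]; ring
    _ ≤ q * ((q^5)^d * (q^2 * (bb u d x * σ^d))) := by gcongr
    _ = _ := by rw [es]; ring

lemma osc (hq : QQ n D q) (hu : IsHarmonicOn u (ball 0 2)) (hd : d ≤ D) (hx : ‖x‖ + s ≤ 1) (hs : 0 < s)
    (hW : WW u q d x s) (hy : ‖y - x‖ ≤ s / 2) :
    ‖iteratedFDeriv ℝ (d+1) u y - iteratedFDeriv ℝ (d+1) u x‖ ≤
      q^5 * (‖y - x‖ / s) * ‖iteratedFDeriv ℝ (d+1) u x‖ := by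
  have h1q : 1 ≤ q := by linarith [hq.c0]
  have hC := Cc_ge n
  refine (T4 hu hs hx hy d).trans ?_
  rw [bb_bound, Nat.factorial_succ]
  have hb := bb_nonneg u d x
  have hM := MM_nonneg u x s
  have hd1 : (d:ℝ) + 1 ≤ q := by
    have : (d:ℝ) ≤ D := by exact_mod_cast hd
    linarith [hq.c4]
  have h1 : (Cc n / s)^(d+1) * MM u x s ≤ q^4 * bb u d x / s := by
    calc (Cc n / s)^(d+1) * MM u x s ≤ (Cc n / s)^(d+1) * (q ^ 3 * (bb u d x * s ^ d)) := by
          gcongr; exact hW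
      _ = Cc n^(d+1) * (q^3 * bb u d x / s) := by rw [div_pow, pow_succ s]; field_simp
      _ ≤ q * (q^3 * bb u d x / s) := by gcongr; exact cpow hq (by omega)
      _ = _ := by ring
  push_cast
  calc ((d:ℝ)+1) * d.factorial * ((Cc n / s)^(d+1) * MM u x s) * ‖y-x‖ ≤
      q * d.factorial * (q^4 * bb u d x / s) * ‖y - x‖ := by gcongr
    _ = _ := by ring

lemma osc10 (hq : QQ n D q) (hu : IsHarmonicOn u (ball 0 2)) (hd : d ≤ D) (hx : ‖x‖ + s ≤ 1) (hs : 0 < s)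
    (hW : WW u q d x s) (hy : q^15 * ‖y - x‖ ≤ s) :
    ‖iteratedFDeriv ℝ (d+1) u y - iteratedFDeriv ℝ (d+1) u x‖ ≤
      1 / q^10 * ‖iteratedFDeriv ℝ (d+1) u x‖ := by
  have h1q : 1 ≤ q := by linarith [hq.c0]
  have h2 : (2:ℝ) ≤ q^15 := by
    calc (2:ℝ) ≤ q := by linarith [hq.c0]
      _ = q^1 := (pow_one q).symm
      _ ≤ q^15 := pow_le_pow_right₀ h1q (by norm_num)
  have h3 : ‖y - x‖ ≤ s/2 := by nlinarith [norm_nonneg (y-x)]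
  refine (osc hq hu hd hx hs hW h3).trans ?_
  gcongr
  rw [le_div_iff₀ (by positivity)]
  calc q^5 * (‖y-x‖/s) * q^10 = q^15 * ‖y-x‖ / s := by ring
    _ ≤ 1 := (div_le_one hs).2 hy

end ul
end EC


namespace EC

section facts
variable {n : ℕ}
local notation "E" => EuclideanSpace ℝ (Fin n)
variable {D d : ℕ} {q : ℝ} {u : EuclideanSpace ℝ (Fin n) → ℝ} {x y x0 : EuclideanSpace ℝ (Fin n)} {s t r : ℝ}

lemma norm_cmp {F : Type*} [SeminormedAddCommGroup F] {a b : F} {c : ℝ} (h : ‖a - b‖ ≤ c * ‖b‖) (hc : c ≤ 1) : ‖a‖ ≤ 2 * ‖b‖ := by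
  have h1 : ‖a‖ ≤ ‖a - b‖ + ‖b‖ := by simpa using norm_add_le (a - b) b
  have h2 := norm_nonneg b
  nlinarith

lemma Tbase {e : ℕ} (A B : ContinuousMultilinearMap ℝ (fun _ : Fin (e+1) => E) ℝ) {δ c : ℝ}
    (h : ‖A - B‖ ≤ δ * ‖B‖) (hδ : δ ≤ 1) (hδ0 : 0 ≤ δ) (hc : 0 ≤ c) {w : E}
    (hw : ‖A.curryLeft w‖ ≤ c * ‖A‖ * ‖w‖) : ‖B.curryLeft w‖ ≤ (2 * c + δ) * ‖B‖ * ‖w‖ := by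
  have h1 : B.curryLeft w = A.curryLeft w - (A - B).curryLeft w := by ext v; simp
  have h2 : ‖(A - B).curryLeft w‖ ≤ ‖A - B‖ * ‖w‖ := by
    have := (A - B).curryLeft.le_opNorm w
    rwa [ContinuousMultilinearMap.curryLeft_norm] at this
  have h3 := norm_cmp h hδ
  rw [h1]
  calc _ ≤ ‖A.curryLeft w‖ + ‖(A - B).curryLeft w‖ := norm_sub_le _ _
    _ ≤ c * (2 * ‖B‖) * ‖w‖ + δ * ‖B‖ * ‖w‖ := by
      refine add_le_add (hw.trans (by gcongr)) (h2.trans (by gcongr))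
    _ = _ := by ring

lemma pairLem (hq : QQ n D q) (hu : IsHarmonicOn u (ball 0 2)) {e : ℕ} (hd : e + 1 ≤ D) (hs : 0 < s)
    (hx : ‖x‖ + s ≤ 1) (hy : ‖y‖ + s ≤ 1) (hx0 : ‖x0‖ + s ≤ 1)
    (hWx : WW u q (e+1) x s) (hW0 : WW u q (e+1) x0 s)
    {tx ty : ℝ} (htx : 0 < tx) (hty : 0 < ty) (htxs : tx ≤ s) (htys : ty ≤ s)
    (hLx : LL u q (e+1) x tx) (hLy : LL u q (e+1) y ty)
    (hxy1 : q^12 * tx ≤ ‖y - x‖) (hxy2 : q^12 * ty ≤ ‖y - x‖) (hclose : q^15 * ‖y - x‖ < s)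
    (hclose0 : q^15 * ‖x - x0‖ ≤ s) :
    ‖(iteratedFDeriv ℝ (e+2) u x0).curryLeft (y - x)‖ ≤
      (1 / q^5) * ‖iteratedFDeriv ℝ (e+2) u x0‖ * ‖y - x‖ := by
  have h1q : 1 ≤ q := by linarith [hq.c0]
  have hδ : 1 / q^10 ≤ 1 := by rw [div_le_one (by positivity)]; exact one_le_pow₀ h1q
  have hA := osc10 hq hu hd hx0 hs hW0 hclose0
  have hyx := osc10 hq hu hd hx hs hWx hclose.le
  have key : ∀ (w : E) (τ : ℝ), 0 < τ → ‖w‖ + τ ≤ 1 → LL u q (e+1) w τ → q^12 * τ ≤ ‖y-x‖ →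
      ‖iteratedFDeriv ℝ (e+1) u w‖ ≤ 1/q^10 * ‖iteratedFDeriv ℝ (e+2) u w‖ * ‖y-x‖ := by
    intro w τ hτ hw hL hτ2
    have h := LLb hq hu hd hw hτ hL (Nat.le_succ e)
    have hb := bb_nonneg u (e+1) w
    have h' : bb u e w ≤ q^2 * τ * bb u (e+1) w := by
      refine le_of_mul_le_mul_right (a := τ^e) ?_ (by positivity)
      refine h.trans (le_of_eq ?_); ring
    rw [bb_bound, bb_bound (e+1), Nat.factorial_succ]
    have h2 : q^2 * τ ≤ 1/q^10 * ‖y-x‖ := by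
      calc q^2 * τ = 1/q^10 * (q^12 * τ) := by field_simp
        _ ≤ _ := by gcongr
    push_cast
    calc e.factorial * bb u e w ≤ e.factorial * (1/q^10 * ‖y-x‖ * bb u (e+1) w) := by
          gcongr; exact h'.trans (by gcongr)
      _ = 1 * (e.factorial * (1/q^10 * ‖y-x‖ * bb u (e+1) w)) := (one_mul _).symm
      _ ≤ ((e:ℝ)+1) * (e.factorial * (1/q^10 * ‖y-x‖ * bb u (e+1) w)) := by
        gcongr; linarith [(Nat.cast_nonneg e : (0:ℝ) ≤ e)]
      _ = _ := by ring
  have kx := key x tx htx (by linarith) hLx hxy1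
  have ky := key y ty hty (by linarith) hLy hxy2
  have hny := norm_cmp hyx hδ
  have hlt : ‖y - x‖ < s / q^15 := by rw [lt_div_iff₀ (by positivity)]; linarith
  have hq15 : s / q^15 ≤ s := div_le_self hs.le (one_le_pow₀ h1q)
  have h3 := T3 hu (z := x) (s := s / q^15) (x := x) (y := y) (by linarith)
    (mem_ball_self (by positivity)) (by rwa [mem_ball, dist_eq_norm]) (e+1)
    (c := 1/q^10 * ‖iteratedFDeriv ℝ (e+2) u x‖) (fun w hw => by
      rw [mem_ball, dist_eq_norm, lt_div_iff₀ (by positivity)] at hw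
      exact osc10 hq hu hd hx hs hWx (by linarith))
  have h4 : ‖(iteratedFDeriv ℝ (e+2) u x).curryLeft (y - x)‖ ≤ (4 * (1/q^10)) * ‖iteratedFDeriv ℝ (e+2) u x‖ * ‖y-x‖ := by
    have h5 : ‖iteratedFDeriv ℝ (e+1) u y‖ ≤ 1/q^10 * (2 * ‖iteratedFDeriv ℝ (e+2) u x‖) * ‖y-x‖ :=
      ky.trans (by gcongr)
    refine h3.trans ?_
    linarith
  refine (Tbase _ _ hA hδ (by positivity) (by positivity) h4).trans ?_
  gcongr
  have : (9:ℝ) ≤ q^5 := by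
    calc (9:ℝ) ≤ q := by linarith [hq.c0]
      _ = q^1 := (pow_one q).symm
      _ ≤ q^5 := pow_le_pow_right₀ h1q (by norm_num)
  have e1 : 2 * (4 * (1/q^10)) + 1/q^10 = 9 / q^5 * (1/q^5) := by field_simp; norm_num
  rw [e1]
  have : 9 / q^5 ≤ 1 := by rw [div_le_one (by positivity)]; exact this
  have h0 : 0 < 1/q^5 := by positivity
  nlinarith

lemma remW (hq : QQ n D q) (hd : d ≤ D) (hW : WW u q d x s) (ht : 0 < t) (hts : t ≤ s) :
    (Cc n * t / s) ^ (d+1) * MM u x s ≤ q^4 * (t / s) * (bb u d x * t ^ d) := by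
  have h1q : 1 ≤ q := by linarith [hq.c0]
  have hs : 0 < s := by linarith
  have hC := Cc_ge n
  have hb := bb_nonneg u d x
  calc (Cc n * t / s) ^ (d+1) * MM u x s ≤ (Cc n * t / s) ^ (d+1) * (q ^ 3 * (bb u d x * s ^ d)) := by
        gcongr; exact hW
    _ = q^3 * bb u d x * ((Cc n * t / s) ^ (d+1) * s ^ d) := by ring
    _ ≤ q^3 * bb u d x * (q * (t / s) * t ^ d) := mul_le_mul_of_nonneg_left (rem hq le_rfl hd ht hts) (by positivity)
    _ = _ := by ring

lemma badLem (hq : QQ n D q) (hu : IsHarmonicOn u (ball 0 2)) (hn : 1 ≤ n) (hd : d ≤ D) (hs : 0 < s)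
    (hx : ‖x‖ + s ≤ 1) (hy : ‖y‖ + s ≤ 1) (hW : WW u q d x s) (ht : 0 < t) (hts : t ≤ s) (hL : LL u q d x t)
    (hr : 0 < r) (hrt : r ≤ t) (hb : y ∈ effCriticalSet u r)
    (hxy : q^12 * t ≤ ‖y - x‖) (hclose : q^15 * ‖y - x‖ ≤ s) (v : E) :
    |iteratedFDeriv ℝ (d+1) u x (Function.update (fun _ => y - x) (Fin.last d) v)| ≤
      (1/q^6) * ‖iteratedFDeriv ℝ (d+1) u x‖ * ‖y - x‖^d * ‖v‖ := by
  have h1q : 1 ≤ q := by linarith [hq.c0]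
  set h := ‖y - x‖ with hh
  have hq12 : (16:ℝ) ≤ q^12 := by
    calc (16:ℝ) ≤ q := by linarith [hq.c0]
      _ = q^1 := (pow_one q).symm
      _ ≤ q^12 := pow_le_pow_right₀ h1q (by norm_num)
  have h0 : 0 < h := by nlinarith
  have hth : 16 * t ≤ h := by nlinarith
  have hq15 : (16:ℝ) ≤ q^15 := hq12.trans (pow_le_pow_right₀ h1q (by norm_num))
  have hhs : 16 * h ≤ s := by nlinarith
  have hbn := bb_nonneg u d x
  have hC := Cc_ge n
  set B := bb u d x * h^d with hB
  have hB0 : 0 ≤ B := by positivity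
  have hth' : t / h ≤ 1 / q^12 := by rw [div_le_div_iff₀ h0 (by positivity)]; linarith
  have hhs' : h / s ≤ 1 / q^15 := by rw [div_le_div_iff₀ hs (by positivity)]; linarith
  have hdq : (d:ℝ) + 2 ≤ q := by
    have : (d:ℝ) ≤ D := by exact_mod_cast hd
    linarith [hq.c4]
  -- lower order terms
  have low : ∀ k < d, bb u k x * h^k ≤ 1/q^10 * B := by
    intro k hk
    refine (LLb' hq hu hd (by linarith) ht hL hk (ρ := h) (by linarith)).trans ?_
    refine mul_le_mul_of_nonneg_right ?_ hB0
    calc q^2 * (t/h) ≤ q^2 * (1/q^12) := by gcongr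
      _ = 1/q^10 := by field_simp
  have hsum : ∑ k ∈ Finset.range d, bb u k x * h^k ≤ 1/q^9 * B := by
    refine (Finset.sum_le_card_nsmul _ _ (1/q^10 * B) (fun k hk => low k (Finset.mem_range.1 hk))).trans ?_
    rw [nsmul_eq_mul, Finset.card_range]
    calc (d:ℝ) * (1/q^10 * B) ≤ q * (1/q^10 * B) := by gcongr; linarith
      _ = _ := by field_simp
  have hrem := remW hq hd hW h0 (by linarith)
  have hrem' : (Cc n * h / s) ^ (d+1) * MM u x s ≤ 1/q^9 * B := by
    refine hrem.trans ?_
    refine mul_le_mul_of_nonneg_right ?_ hB0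
    calc q^4 * (h/s) ≤ q^4 * (1/q^15) := by gcongr
      _ = 1/q^11 := by field_simp
      _ ≤ 1/q^9 := by gcongr <;> norm_num
  -- sup on larger ball
  have hbig : MM u x (8 * h) ≤ q^4 * B := by
    have hT := T1 hu (x := x) (s := s) (ρ := 8*h) (by positivity) hx (by linarith) d
    have h1 : ∀ k ∈ Finset.range (d+1), bb u k x * (8*h)^k ≤ 8^d * (q^2 * B) := by
      intro k hk
      have hk' : k ≤ d := by simpa [Nat.lt_succ_iff] using hk
      have h8 : (8:ℝ)^k ≤ 8^d := pow_le_pow_right₀ (by norm_num) hk'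
      have hl : bb u k x * h^k ≤ q^2 * B := by
        rcases hk'.eq_or_lt with rfl | hlt
        · exact le_mul_of_one_le_left hB0 (one_le_pow₀ h1q)
        · refine (low k hlt).trans ?_
          gcongr
          calc 1/q^10 ≤ 1 := by rw [div_le_one (by positivity)]; exact one_le_pow₀ h1q
            _ ≤ q^2 := one_le_pow₀ h1q
      have hbk := bb_nonneg u k x
      calc bb u k x * (8*h)^k = 8^k * (bb u k x * h^k) := by rw [mul_pow]; ring
        _ ≤ _ := by gcongr
    have h2 := Finset.sum_le_card_nsmul _ _ _ h1
    rw [nsmul_eq_mul, Finset.card_range] at h2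
    have h3 := remW hq hd hW (t := 8*h) (by positivity) (by linarith)
    have h88 : (8:ℝ)^d ≤ q := (pow_le_pow_right₀ (by norm_num) (by omega)).trans hq.c3
    have h4 : (Cc n * (8*h) / s) ^ (d+1) * MM u x s ≤ q^3 * B := by
      refine h3.trans ?_
      have e1 : bb u d x * (8*h)^d = 8^d * B := by rw [mul_pow]; ring
      rw [e1]
      calc q^4 * (8*h/s) * (8^d * B) = q^4 * 8 * (h/s) * (8^d * B) := by ring
        _ ≤ q^4 * q * (1/q^15) * (q * B) := by
          gcongr; linarith [hq.c0]
        _ = 1/q^9 * B := by field_simp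
        _ ≤ q^3 * B := by
          gcongr
          calc 1/q^9 ≤ 1 := by rw [div_le_one (by positivity)]; exact one_le_pow₀ h1q
            _ ≤ q^3 := one_le_pow₀ h1q
    have h5 : ((d+1:ℕ):ℝ) * (8^d * (q^2 * B)) ≤ (d+1) * (q * (q^2 * B)) := by
      push_cast
      gcongr
    have h6 : ((d:ℝ)+2) * (q^3 * B) ≤ q * (q^3 * B) := by gcongr
    calc MM u x (8*h) ≤ (d+1) * (q * (q^2 * B)) + q^3 * B := hT.trans (add_le_add (h2.trans h5) h4)
      _ = (d+2) * (q^3*B) := by ring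
      _ ≤ q * (q^3 * B) := h6
      _ = _ := by ring
  -- gradient at the bad point
  obtain ⟨z, hz, hlt⟩ := bad_point hu hr (x := y) (by linarith) hn hb
  rw [mem_ball] at hz
  have hzx : dist z x ≤ (8*h)/2 := by
    have := dist_triangle z y x
    rw [dist_eq_norm y x, ← hh] at this
    linarith
  have hc1 := cauchy' hu (x := x) (z := z) (s := 8*h) (by positivity) (by linarith) hzx 1
  rw [pow_one] at hc1
  have hgrad : ‖fderiv ℝ u y‖ ≤ 1/q^7 * B := by
    have hM := MM_nonneg u x (8*h)
    have hbz := bb_nonneg u 1 z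
    calc ‖fderiv ℝ u y‖ ≤ 10*(n+1)*r*bb u 1 z := hlt.le
      _ ≤ 10*(n+1)*t*(Cc n/(8*h) * (q^4 * B)) := by
        gcongr
        exact hc1.trans (by gcongr)
      _ = (10*(n+1)*Cc n) * (t/h) * (q^4*B) / 8 := by field_simp
      _ ≤ q * (1/q^12) * (q^4*B) / 8 := by
        gcongr; exact hq.c2
      _ = 1/q^7 * B / 8 := by field_simp
      _ ≤ _ := by have : 0 ≤ 1/q^7 * B := by positivity
                  linarith
  have hT2 := T2 hu hs hx (y := y) (by rw [← hh]; linarith) d v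
  rw [← hh] at hT2
  refine hT2.trans ?_
  refine mul_le_mul_of_nonneg_right ?_ (norm_nonneg v)
  rw [bb_bound]
  have hfin : ‖fderiv ℝ u y‖ + ∑ k ∈ Finset.range d, bb u k x * h ^ k + (Cc n * h / s) ^ (d+1) * MM u x s ≤ 1/q^6 * B := by
    have h7 : 1/q^9 ≤ 1/q^7 := by gcongr <;> norm_num
    have h8 : 1/q^7 * B * 3 ≤ 1/q^6 * B := by
      calc 1/q^7*B*3 ≤ 1/q^7*B*q := by gcongr; linarith [hq.c0]
        _ = _ := by field_simp
    have h9 : 1/q^9 * B ≤ 1/q^7 * B := by gcongr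
    linarith
  calc _ ≤ d.factorial * (1/q^6 * B) := by gcongr
    _ = _ := by rw [hB]; ring

lemma badLem0 (hq : QQ n D q) (hu : IsHarmonicOn u (ball 0 2)) (hn : 1 ≤ n) (hd : d ≤ D) (hs : 0 < s)
    (hx : ‖x‖ + s ≤ 1) (hy : ‖y‖ + s ≤ 1) (hx0 : ‖x0‖ + s ≤ 1) (hW0 : WW u q d x0 s)
    (hW : WW u q d x s) (ht : 0 < t) (hts : t ≤ s) (hL : LL u q d x t)
    (hr : 0 < r) (hrt : r ≤ t) (hb : y ∈ effCriticalSet u r)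
    (hxy : q^12 * t ≤ ‖y - x‖) (hclose : q^15 * ‖y - x‖ ≤ s) (hclose0 : q^15 * ‖x - x0‖ ≤ s) (v : E) :
    |iteratedFDeriv ℝ (d+1) u x0 (Function.update (fun _ => y - x) (Fin.last d) v)| ≤
      (1/q^5) * ‖iteratedFDeriv ℝ (d+1) u x0‖ * ‖y - x‖^d * ‖v‖ := by
  have h1q : 1 ≤ q := by linarith [hq.c0]
  have hδ : 1 / q^10 ≤ 1 := by rw [div_le_one (by positivity)]; exact one_le_pow₀ h1q
  have hA := osc10 hq hu hd hx0 hs hW0 hclose0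
  have h1 := badLem hq hu hn hd hs hx hy hW ht hts hL hr hrt hb hxy hclose v
  have h2 := norm_cmp hA hδ
  set A := iteratedFDeriv ℝ (d+1) u x
  set B := iteratedFDeriv ℝ (d+1) u x0
  set w := Function.update (fun _ : Fin (d+1) => y - x) (Fin.last d) v with hw
  have hprod : ∏ i, ‖w i‖ = ‖y-x‖^d * ‖v‖ := by
    rw [Fin.prod_univ_castSucc]
    simp [hw, (Fin.castSucc_lt_last _).ne]
  have h3 : |(A - B) w| ≤ ‖A - B‖ * (‖y-x‖^d * ‖v‖) := by
    rw [← hprod]; exact (A - B).le_opNorm w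
  have h4 : B w = A w - (A - B) w := by simp
  have h5 : (3:ℝ) * (1/q^6) ≤ 1/q^5 := by
    calc (3:ℝ) * (1/q^6) ≤ q * (1/q^6) := by gcongr; linarith [hq.c0]
      _ = _ := by field_simp
  have h6 : 1/q^10 ≤ 1/q^6 := by gcongr <;> norm_num
  rw [h4]
  set P := ‖y-x‖^d * ‖v‖ with hP
  have hP0 : 0 ≤ P := by positivity
  calc |A w - (A - B) w| ≤ |A w| + |(A-B) w| := abs_sub _ _
    _ ≤ 1/q^6 * (2 * ‖B‖) * P + 1/q^6 * ‖B‖ * P := by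
      refine add_le_add (h1.trans ?_) (h3.trans ?_)
      · rw [mul_assoc _ (‖y-x‖^d) _]; gcongr
      · exact mul_le_mul_of_nonneg_right (hA.trans (by gcongr)) hP0
    _ = 3 * (1/q^6) * (‖B‖ * P) := by ring
    _ ≤ 1/q^5 * (‖B‖ * P) := by gcongr
    _ = _ := by rw [hP]; ring

lemma transfer (hq : QQ n D q) (hu : IsHarmonicOn u (ball 0 2)) (hd : d ≤ D) (hs : 0 < s)
    (hx : ‖x‖ + s ≤ 1) (hWx : WW u q d x s) (hy : ‖y‖ + s ≤ 1) (hWy : WW u q d y s)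
    {tx ty : ℝ} (htx : 0 < tx) (hL : LL u q d x tx) (hty : q^5 * ty ≤ s) (h4 : q^4 * tx ≤ ty)
    (hxy : ‖x - y‖ ≤ ty / 2) (hclose : q^15 * ‖x - y‖ ≤ s) : LL u q d y (ty/2) := by
  have h1q : 1 ≤ q := by linarith [hq.c0]
  have hpw : ∀ k : ℕ, 1 ≤ k → (4:ℝ) ≤ q^k := fun k hk => by
    calc (4:ℝ) ≤ q := by linarith [hq.c0]
      _ = q^1 := (pow_one q).symm
      _ ≤ q^k := pow_le_pow_right₀ h1q hk
  have htxy : tx ≤ ty := by nlinarith [hpw 4 (by norm_num)]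
  have hty0 : 0 < ty := by linarith
  have htys : 4 * ty ≤ s := by nlinarith [hpw 5 (by norm_num)]
  have hbx := bb_nonneg u d x
  have hby := bb_nonneg u d y
  set B := bb u d x * ty^d with hB
  have hB0 : 0 ≤ B := by positivity
  have hM : MM u y (ty/2) ≤ MM u x ty := MM_mono hu (by linarith) (by linarith) (by
    rw [dist_comm, dist_eq_norm]; linarith)
  have hT := T1 hu (x := x) (s := s) hty0 hx (by linarith) d
  rw [Finset.sum_range_succ] at hT
  have hsum : ∑ k ∈ Finset.range d, bb u k x * ty^k ≤ B := by
    have : ∀ k ∈ Finset.range d, bb u k x * ty^k ≤ 1/q * B := by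
      intro k hk
      refine (LLb' hq hu hd (by linarith) htx hL (Finset.mem_range.1 hk) htxy).trans ?_
      refine mul_le_mul_of_nonneg_right ?_ hB0
      have : tx/ty ≤ 1/q^4 := by rw [div_le_div_iff₀ hty0 (by positivity)]; linarith
      calc q^2 * (tx/ty) ≤ q^2 * (1/q^4) := by gcongr
        _ = 1/q^2 := by field_simp
        _ ≤ 1/q^1 := by gcongr <;> norm_num
        _ = 1/q := by rw [pow_one]
    refine (Finset.sum_le_card_nsmul _ _ _ this).trans ?_
    rw [nsmul_eq_mul, Finset.card_range]
    have hdq : (d:ℝ) ≤ q := by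
      have : (d:ℝ) ≤ D := by exact_mod_cast hd
      linarith [hq.c4]
    calc (d:ℝ) * (1/q*B) ≤ q * (1/q*B) := by gcongr
      _ = B := by field_simp
  have hrem : (Cc n * ty / s) ^ (d+1) * MM u x s ≤ B := by
    refine (remW hq hd hWx hty0 (by linarith)).trans ?_
    refine mul_le_of_le_one_left hB0 ?_
    have : ty/s ≤ 1/q^5 := by rw [div_le_div_iff₀ hs (by positivity)]; linarith
    calc q^4 * (ty/s) ≤ q^4 * (1/q^5) := by gcongr
      _ = 1/q := by field_simp
      _ ≤ 1 := by rw [div_le_one (by positivity)]; exact h1q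
  have hcmp := norm_cmp (osc10 hq hu hd hy hs hWy hclose) (by
    rw [div_le_one (by positivity)]; exact one_le_pow₀ h1q)
  have hbb : bb u d x ≤ 2 * bb u d y := by
    unfold bb
    rw [← mul_div_assoc]
    gcongr
  unfold LL
  calc MM u y (ty/2) ≤ 3 * B := by linarith
    _ ≤ 3 * ((2 * bb u d y) * ty^d) := by rw [hB]; gcongr
    _ = (6 * 2^d) * (bb u d y * (ty/2)^d) := by rw [div_pow]; field_simp; ring
    _ ≤ q * (bb u d y * (ty/2)^d) := by
      gcongr
      calc (6:ℝ) * 2^d ≤ 8 * 8^D := by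
            gcongr <;> norm_num
            exact (pow_le_pow_left₀ (by norm_num) (by norm_num) d).trans (pow_le_pow_right₀ (by norm_num) hd)
        _ = 8^(D+1) := by ring
        _ ≤ q := hq.c3

end facts
end EC


namespace EC

section claim
variable {n : ℕ}
local notation "E" => EuclideanSpace ℝ (Fin n)
variable {D d : ℕ} {q : ℝ} {u : EuclideanSpace ℝ (Fin n) → ℝ} {x y x0 : EuclideanSpace ℝ (Fin n)} {s t r : ℝ}

/-- the counting claim -/
def CL (u : E → ℝ) (q r : ℝ) (d : ℕ) : Prop :=
  ∀ (A : Finset E) (z : E) (s : ℝ), 0 < s → s ≤ 1/8 → (∀ x ∈ A, dist x z ≤ s / q^16) →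
    (∀ x ∈ A, ‖x‖ ≤ 3/4) → (∀ x ∈ A, x ∈ effCriticalSet u r) →
    (∀ x ∈ A, ∀ y ∈ A, x ≠ y → r ≤ dist x y) → (∀ x ∈ A, UU u q d x s ∨ s < r) →
    (A.card : ℝ) ≤ q ^ (32 * n * (d+1)) * (max 1 (s/r)) ^ (n-2)

lemma posT (hu : IsHarmonicOn u (ball 0 2)) (hn : 1 ≤ n) (hs : 0 < s)
    (hx : ‖x‖ + s ≤ 1) (hW : WW u q d x s) (hr : 0 < r) (hrs : 6 * r ≤ s) (hb : x ∈ effCriticalSet u r) :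
    0 < bb u d x := by
  by_contra hcon
  have h0 : bb u d x = 0 := le_antisymm (not_lt.1 hcon) (bb_nonneg _ _ _)
  unfold WW at hW
  rw [h0, zero_mul, mul_zero] at hW
  obtain ⟨z, hz, hlt⟩ := bad_point hu hr (by linarith) hn hb
  have h4 := cauchy' hu hs hx (z := z) (by rw [mem_ball] at hz; linarith) 1
  have hM : MM u x s = 0 := le_antisymm hW (MM_nonneg _ _ _)
  rw [hM, mul_zero] at h4
  have : 10*((n:ℝ)+1)*r*bb u 1 z ≤ 0 := mul_nonpos_of_nonneg_of_nonpos (by positivity) h4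
  linarith [norm_nonneg (fderiv ℝ u x)]

lemma hsm_of (hq : QQ n D q) {e : ℕ} (he : e + 1 ≤ D) :
    1/q^5 * (2*((n:ℝ)+1))^n * ((n:ℝ)^(e+2) * (2^(e+1) * (1 + 2*n*(e+2)))) < 1 := by
  have h1q : 1 ≤ q := by linarith [hq.c0]
  have heD : (e:ℝ) + 1 ≤ D := by exact_mod_cast he
  have h1 : (n:ℝ)^(e+2) ≤ q := by
    rcases Nat.eq_zero_or_pos n with rfl | hn
    · simp; linarith
    · refine le_trans (pow_le_pow_right₀ (by exact_mod_cast hn) (by omega)) hq.c6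
  have h2 : (2:ℝ)^(e+1) * 4 ≤ q := by
    refine le_trans ?_ hq.c3
    calc (2:ℝ)^(e+1) * 4 ≤ 8^D * 8 := by
          gcongr <;> norm_num
          exact (pow_le_pow_left₀ (by norm_num) (by norm_num) _).trans (pow_le_pow_right₀ (by norm_num) he)
      _ = _ := by ring
  have h3 : 1 + 2*(n:ℝ)*(e+2) ≤ q := by
    refine le_trans ?_ hq.c7
    have hn0 : (0:ℝ) ≤ n := Nat.cast_nonneg n
    nlinarith
  have h4 : (2:ℝ)^(e+1) ≤ q / 4 := by linarith
  calc _ ≤ 1/q^5 * q * (q * (q/4 * q)) := by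
        gcongr
        exact hq.c5
    _ = 1/(4*q) := by field_simp
    _ < 1 := by rw [div_lt_one (by positivity)]; linarith

lemma packS (hq : QQ n D q) (hu : IsHarmonicOn u (ball 0 2)) (hn : 2 ≤ n) (hr : 0 < r) {e : ℕ} (hd : e + 1 ≤ D)
    (S : Finset E) {z : E} (hs : 0 < s) (hs8 : s ≤ 1/8) (hz : ∀ x ∈ S, dist x z ≤ s / q^16)
    (hnorm : ∀ x ∈ S, ‖x‖ ≤ 3/4) (hbad : ∀ x ∈ S, x ∈ effCriticalSet u r)
    (hW : ∀ x ∈ S, WW u q (e+1) x s) (t : E → ℝ)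
    (htk : ∀ x ∈ S, ∃ k : ℕ, t x = s / q^5 / 2^k) (hrt : ∀ x ∈ S, r ≤ t x)
    (hL : ∀ x ∈ S, LL u q (e+1) x (t x)) (hfinal : ∀ x ∈ S, t x / 2 < r ∨ ¬ LL u q (e+1) x (t x / 2))
    (hsel : ∀ x ∈ S, ∀ y ∈ S, x ≠ y → (t x ≤ t y ∧ ¬ dist x y < q^12 * t x) ∨ (t y ≤ t x ∧ ¬ dist y x < q^12 * t y)) :
    ∑ x ∈ S, t x ^ (n-2) ≤ 2 * (16 * (s / q^5)) ^ (n-2) := by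
  have h1q : 1 ≤ q := by linarith [hq.c0]
  have hq2 : (1024:ℝ) ≤ q^2 := by nlinarith [hq.c0]
  rcases S.eq_empty_or_nonempty with rfl | ⟨x0, hx0⟩
  · simp only [Finset.sum_empty]; positivity
  have hxs : ∀ x ∈ S, ‖x‖ + s ≤ 1 := fun x hx => by linarith [hnorm x hx]
  have ht0 : ∀ x ∈ S, 0 < t x := fun x hx => by linarith [hrt x hx]
  have htσ : ∀ x ∈ S, q^5 * t x ≤ s := fun x hx => by
    obtain ⟨k, hk⟩ := htk x hx
    have : t x ≤ s / q^5 := by rw [hk]; exact div_le_self (by positivity) (one_le_pow₀ (by norm_num))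
    rw [le_div_iff₀ (by positivity)] at this
    linarith
  have hts : ∀ x ∈ S, t x ≤ s := fun x hx => by
    have := htσ x hx
    have h5 : 1 ≤ q^5 := one_le_pow₀ h1q
    nlinarith [ht0 x hx]
  have hclose : ∀ x ∈ S, ∀ y ∈ S, q^15 * ‖x - y‖ < s := fun x hx y hy => by
    have h1 : ‖x - y‖ ≤ 2 * (s / q^16) := by
      rw [← dist_eq_norm]
      have := dist_triangle_right x y z
      linarith [hz x hx, hz y hy]
    calc q^15 * ‖x-y‖ ≤ q^15 * (2 * (s/q^16)) := by gcongr
      _ = 2 / q * s := by field_simp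
      _ < 1 * s := by
        gcongr
        rw [div_lt_one (by positivity)]; linarith [hq.c0]
      _ = s := one_mul s
  have hrs : 6 * r ≤ s := by
    have h5 : 6 ≤ q^5 := by
      calc (6:ℝ) ≤ q := by linarith [hq.c0]
        _ = q^1 := (pow_one q).symm
        _ ≤ q^5 := pow_le_pow_right₀ h1q (by norm_num)
    nlinarith [htσ x0 hx0, hrt x0 hx0]
  set T := iteratedFDeriv ℝ (e+2) u x0 with hT
  have hx02 : x0 ∈ ball (0:E) 2 := by
    rw [mem_ball, dist_zero_right]; linarith [hnorm x0 hx0]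
  have hT0 : 0 < ‖T‖ := by
    have h := posT hu (by omega) hs (hxs x0 hx0) (hW x0 hx0) hr hrs (hbad x0 hx0)
    have h2 := bb_bound (u := u) (e+1) x0
    rw [hT, h2]
    positivity
  obtain ⟨m, hm, π, hπ, hπ1, hπ2⟩ := Vmax hn (symT_iter isOpen_ball hu (e+2) x0 hx02) (trF_iter isOpen_ball hu e hx02)
    hT0 (η0 := 1/q^5) (by positivity) (hsm_of hq hd)
  -- separation
  have hsep1 : ∀ x ∈ S, ∀ y ∈ S, t x ≤ t y → q^12 * t x ≤ dist x y → t y / 2 ≤ dist x y := by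
    intro x hx y hy hxy hd2
    by_contra hcon
    push Not at hcon
    have hty := ht0 y hy
    by_cases h4 : q^4 * t x ≤ t y
    · have hLy := transfer hq hu hd hs (hxs x hx) (hW x hx) (hxs y hy) (hW y hy) (ht0 x hx) (hL x hx)
        (htσ y hy) h4 (by rw [← dist_eq_norm]; exact hcon.le) (hclose x hx y hy).le
      rcases hfinal y hy with h | h
      · have h5 : (2:ℝ) ≤ q^4 := by
          calc (2:ℝ) ≤ q := by linarith [hq.c0]
            _ = q^1 := (pow_one q).symm
            _ ≤ q^4 := pow_le_pow_right₀ h1q (by norm_num)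
        nlinarith [hrt x hx, ht0 x hx]
      · exact h hLy
    · push Not at h4
      have h5 : q^4 ≤ q^12 := pow_le_pow_right₀ h1q (by norm_num)
      nlinarith [ht0 x hx]
  have hsep : ∀ x ∈ S, ∀ y ∈ S, x ≠ y → t y / 2 ≤ dist x y := by
    intro x hx y hy hxy
    rcases hsel x hx y hy hxy with ⟨h1, h2⟩ | ⟨h1, h2⟩
    · exact hsep1 x hx y hy h1 (not_lt.1 h2)
    · have := hsep1 y hy x hx h1 (not_lt.1 h2)
      rw [dist_comm]; linarith
  have flip : ∀ a b : E, ‖b - a‖ ≤ 2 * ‖π (b - a)‖ → ‖a - b‖ ≤ 2 * ‖π (a - b)‖ := by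
    intro a b h
    rw [← neg_sub b a, map_neg, norm_neg, norm_neg]; exact h
  refine packTotal hm S t (by positivity) htk (z := z) (fun x hx => (hz x hx).trans ?_) π hπ hsep ?_ ?_
  · gcongr
    norm_num
  · intro x hx y hy hxy htxy
    apply flip
    apply hπ1
    have hle : q^12 * t x ≤ ‖y - x‖ := by
      rw [← dist_eq_norm]
      rcases hsel x hx y hy hxy with ⟨h1, h2⟩ | ⟨h1, h2⟩
      · rw [dist_comm]; exact not_lt.1 h2
      · rw [htxy]; exact not_lt.1 h2
    exact pairLem hq hu hd hs (hxs x hx) (hxs y hy) (hxs x0 hx0) (hW x hx) (hW x0 hx0) (ht0 x hx) (ht0 y hy)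
      (hts x hx) (hts y hy) (hL x hx) (hL y hy) hle (by rw [← htxy]; exact hle) (hclose y hy x hx) (hclose x hx x0 hx0).le
  · intro hmn x hx y hy hxy
    have core : ∀ a ∈ S, ∀ b ∈ S, q^12 * t a ≤ dist a b → ‖b - a‖ ≤ 2 * ‖π (b - a)‖ := by
      intro a ha b hb hab
      apply hπ2 hmn
      intro v
      exact badLem0 hq hu (by omega) hd hs (hxs a ha) (hxs b hb) (hxs x0 hx0) (hW x0 hx0) (hW a ha) (ht0 a ha)
        (hts a ha) (hL a ha) hr (hrt a ha) (hbad b hb) (by rw [← dist_eq_norm, dist_comm]; exact hab)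
        (hclose b hb a ha).le (hclose a ha x0 hx0).le v
    rcases hsel x hx y hy hxy with ⟨h1, h2⟩ | ⟨h1, h2⟩
    · exact flip x y (core x hx y hy (not_lt.1 h2))
    · exact core y hy x hx (not_lt.1 h2)

end claim
end EC


namespace EC

section claim2
variable {n : ℕ}
local notation "E" => EuclideanSpace ℝ (Fin n)
variable {D d : ℕ} {q : ℝ} {u : EuclideanSpace ℝ (Fin n) → ℝ} {x y x0 : EuclideanSpace ℝ (Fin n)} {s t r : ℝ}

lemma type1 (hq : QQ n D q) (hu : IsHarmonicOn u (ball 0 2)) (hn : 2 ≤ n) (hr : 0 < r) {e : ℕ} (hd : e + 1 ≤ D)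
    (ih : CL u q r e) (A : Finset E) {z : E} (hs : 0 < s) (hs8 : s ≤ 1/8) (hz : ∀ x ∈ A, dist x z ≤ s / q^16)
    (hnorm : ∀ x ∈ A, ‖x‖ ≤ 3/4) (hbad : ∀ x ∈ A, x ∈ effCriticalSet u r)
    (hsepr : ∀ x ∈ A, ∀ y ∈ A, x ≠ y → r ≤ dist x y)
    (hU : ∀ x ∈ A, UU u q (e+1) x s) (hrs : q^5 * r ≤ s) (hLσ : ∀ x ∈ A, LL u q (e+1) x (s / q^5)) :
    (A.card : ℝ) ≤ 2 * q^(30*n) * q^(32*n*(e+1)) * (s/r)^(n-2) := by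
  classical
  have h1q : 1 ≤ q := by linarith [hq.c0]
  have hq0 : 0 < q := by linarith
  set σ := s / q^5 with hσ
  have hσ0 : 0 < σ := by positivity
  have hrσ : r ≤ σ := by rw [hσ, le_div_iff₀ (by positivity)]; linarith
  have hσs : σ ≤ s := div_le_self hs.le (one_le_pow₀ h1q)
  have hxs : ∀ x ∈ A, ‖x‖ + s ≤ 1 := fun x hx => by linarith [hnorm x hx]
  have hch : ∀ x : E, ∃ t : ℝ, 0 < t ∧ (x ∈ A → (∃ k : ℕ, t = σ / 2 ^ k) ∧ r ≤ t ∧ LL u q (e+1) x t ∧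
      (t / 2 < r ∨ ¬ LL u q (e+1) x (t / 2))) := by
    intro x
    by_cases hx : x ∈ A
    · obtain ⟨t, h1, h2, h3⟩ := exists_stop (LL u q (e+1) x) hr hrσ (hLσ x hx)
      exact ⟨t, by linarith, fun _ => ⟨h1, h2, h3⟩⟩
    · exact ⟨1, one_pos, fun h => absurd h hx⟩
  choose t ht0 ht using hch
  have htσ : ∀ x ∈ A, t x ≤ σ := fun x hx => by
    obtain ⟨⟨k, hk⟩, _⟩ := ht x hx
    rw [hk]; exact div_le_self hσ0.le (one_le_pow₀ (by norm_num))
  obtain ⟨S, hSA, hsel, hcov⟩ := greedy t (fun x y => dist x y < q^12 * t x)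
    (fun x => by rw [dist_self]; have := ht0 x; positivity) A.card A le_rfl
  have hpack := packS hq hu hn hr hd S hs hs8 (fun x hx => hz x (hSA hx)) (fun x hx => hnorm x (hSA hx))
    (fun x hx => hbad x (hSA hx)) (fun x hx => UL hq hu hd (hxs x (hSA hx)) hs (hU x (hSA hx)) (hLσ x (hSA hx)))
    t (fun x hx => (ht x (hSA hx)).1) (fun x hx => (ht x (hSA hx)).2.1) (fun x hx => (ht x (hSA hx)).2.2.1)
    (fun x hx => (ht x (hSA hx)).2.2.2) hsel
  set K : E → Finset E := fun x => A.filter (fun y => t x ≤ t y ∧ dist x y < q^12 * t x) with hK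
  have hAK : A ⊆ S.biUnion K := by
    intro y hy
    obtain ⟨x, hx, h1⟩ := hcov y hy
    exact Finset.mem_biUnion.2 ⟨x, hx, Finset.mem_filter.2 ⟨hy, h1⟩⟩
  have hcard : (A.card : ℝ) ≤ ∑ x ∈ S, ((K x).card : ℝ) := by
    exact_mod_cast (Finset.card_le_card hAK).trans Finset.card_biUnion_le
  have hKb : ∀ x ∈ S, ((K x).card : ℝ) ≤ q^(30*n) * (q^(32*n*(e+1)) * (t x / r)^(n-2)) := by
    intro x hx
    have hxA := hSA hx
    have htx := ht0 x
    have hrtx := (ht x hxA).2.1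
    have hsub : ∀ x' ∈ K x, (((K x).filter (fun y => dist y x' < (t x / 2) / q^16)).card : ℝ) ≤
        q^(32*n*(e+1)) * (t x / r)^(n-2) := by
      intro x' _
      have hmem : ∀ y ∈ (K x).filter (fun y => dist y x' < (t x / 2) / q^16), y ∈ A ∧ t x ≤ t y ∧ dist y x' < (t x / 2) / q^16 := by
        intro y hy
        simp only [hK, Finset.mem_filter] at hy
        exact ⟨hy.1.1, hy.1.2.1, hy.2⟩
      refine (ih _ x' (t x / 2) (by positivity) (by linarith [htσ x hxA]) (fun y hy => (hmem y hy).2.2.le)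
        (fun y hy => hnorm y (hmem y hy).1) (fun y hy => hbad y (hmem y hy).1)
        (fun y hy w hw => hsepr y (hmem y hy).1 w (hmem w hw).1) (fun y hy => ?_)).trans ?_
      · obtain ⟨hyA, hxy, _⟩ := hmem y hy
        rcases (ht y hyA).2.2.2 with h | h
        · right; linarith
        · left
          obtain ⟨e', he', h2⟩ := Udown' hq hu hd (hxs y hyA) (hU y hyA) (t := t y / 2) (by linarith [ht0 y])
            (by
              have := htσ y hyA
              rw [hσ, le_div_iff₀ (by positivity)] at this
              have h3 : 0 < q^5 * t y := by have := ht0 y; positivity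
              linarith) h (ρ := t x / 2) (by positivity) (by linarith)
          obtain rfl : e = e' := by omega
          exact h2
      · have h1 : max 1 (t x / 2 / r) ≤ t x / r := by
          apply max_le
          · rw [le_div_iff₀ hr]; linarith
          · gcongr; linarith
        gcongr
    have h := subdiv (K x) (z := x) (R := q^12 * t x) (ε := (t x / 2) / q^16) (by positivity) (by positivity)
      (fun y hy => by
        simp only [hK, Finset.mem_filter] at hy
        rw [dist_comm]; exact hy.2.2.le) hsub (by positivity)
    refine h.trans ?_
    rw [pow_mul q 30 n]
    gcongr
    have e1 : 1 + 2 * (q^12 * t x) / (t x / 2 / q^16) = 1 + 4 * q^28 := by field_simp; ring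
    rw [e1]
    have h28 : 1 ≤ q^28 := one_le_pow₀ h1q
    calc 1 + 4 * q^28 ≤ 5 * q^28 := by linarith
      _ ≤ q^2 * q^28 := by gcongr; nlinarith [hq.c0]
      _ = q^30 := by ring
  calc (A.card : ℝ) ≤ ∑ x ∈ S, q^(30*n) * (q^(32*n*(e+1)) * (t x / r)^(n-2)) := hcard.trans (Finset.sum_le_sum hKb)
    _ = q^(30*n) * q^(32*n*(e+1)) / r^(n-2) * ∑ x ∈ S, t x^(n-2) := by
      rw [Finset.mul_sum]; refine Finset.sum_congr rfl fun x _ => ?_; rw [div_pow]; ring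
    _ ≤ q^(30*n) * q^(32*n*(e+1)) / r^(n-2) * (2 * s^(n-2)) := by
      gcongr
      refine hpack.trans ?_
      gcongr
      have h5 : (16:ℝ) ≤ q^5 := by
        calc (16:ℝ) ≤ q := by linarith [hq.c0]
          _ = q^1 := (pow_one q).symm
          _ ≤ q^5 := pow_le_pow_right₀ h1q (by norm_num)
      have : s = q^5 * σ := by rw [hσ]; field_simp
      nlinarith
    _ = _ := by rw [div_pow]; ring

lemma step (hq : QQ n D q) (hu : IsHarmonicOn u (ball 0 2)) (hn : 2 ≤ n) (hr : 0 < r) (hd : d ≤ D)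
    (ih : ∀ e, d = e + 1 → CL u q r e) : CL u q r d := by
  classical
  intro A z s hs hs8 hz hnorm hbad hsepr hU
  have h1q : 1 ≤ q := by linarith [hq.c0]
  have hq0 : 0 < q := by linarith
  have hmax1 : 1 ≤ max 1 (s/r) := le_max_left _ _
  by_cases hsr : s < q^10 * r
  · have h := sep_count A (z := z) hr (R := s/q^16) (by positivity) hz hsepr
    have h2 : 1 + 2 * (s/q^16) / r ≤ q := by
      have : s / q^16 / r ≤ 1 := by
        rw [div_div, div_le_one (by positivity)]
        have : q^10 ≤ q^16 := pow_le_pow_right₀ h1q (by norm_num)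
        nlinarith
      rw [mul_div_assoc]
      linarith [hq.c0]
    calc (A.card:ℝ) ≤ q^n := h.trans (by gcongr)
      _ ≤ q^(32*n*(d+1)) := pow_le_pow_right₀ h1q (by nlinarith [Nat.zero_le (n*d)])
      _ = q^(32*n*(d+1)) * 1 := (mul_one _).symm
      _ ≤ _ := by gcongr; exact one_le_pow₀ hmax1
  push Not at hsr
  have hr5 : q^5 * r ≤ s := le_trans (by gcongr <;> norm_num) hsr
  have hrs : r ≤ s := le_trans (le_mul_of_one_le_left hr.le (one_le_pow₀ h1q)) hr5
  have hU' : ∀ x ∈ A, UU u q d x s := fun x hx => (hU x hx).resolve_right (not_lt.2 hrs)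
  have hxs : ∀ x ∈ A, ‖x‖ + s ≤ 1 := fun x hx => by linarith [hnorm x hx]
  set σ := s / q^5 with hσ
  have hσ0 : 0 < σ := by positivity
  have hrσ : r ≤ σ := by rw [hσ, le_div_iff₀ (by positivity)]; linarith
  have hσs : σ ≤ s := div_le_self hs.le (one_le_pow₀ h1q)
  have hes : q^5 * σ = s := by rw [hσ]; field_simp
  set X := (s/r)^(n-2) with hX
  have hX0 : 0 ≤ X := by positivity
  set Pv := q^(32*n*d) with hPv
  have hPv0 : 0 < Pv := by positivity
  set A0 := A.filter (fun x => ¬ LL u q d x σ) with hA0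
  set A1 := A.filter (fun x => LL u q d x σ) with hA1
  have m0 : ∀ x ∈ A0, x ∈ A ∧ ¬ LL u q d x σ := fun x hx => Finset.mem_filter.1 hx
  have m1 : ∀ x ∈ A1, x ∈ A ∧ LL u q d x σ := fun x hx => Finset.mem_filter.1 hx
  have b0 : (A0.card:ℝ) ≤ q^(7*n) * (Pv * X) := by
    have h := subdiv A0 (z := z) (R := s/q^16) (ε := σ/q^16) (B := Pv * X) (by positivity) (by positivity)
      (fun x hx => hz x (m0 x hx).1) (fun x hx => ?_) (by positivity)
    · refine h.trans ?_
      rw [pow_mul]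
      gcongr
      have e1 : 1 + 2 * (s/q^16) / (σ/q^16) = 1 + 2 * q^5 := by rw [← hes]; field_simp
      rw [e1]
      have h28 : 1 ≤ q^5 := one_le_pow₀ h1q
      calc 1 + 2 * q^5 ≤ 3 * q^5 := by linarith
        _ ≤ q^2 * q^5 := by gcongr; nlinarith [hq.c0]
        _ = q^7 := by ring
    · obtain ⟨e, he, _⟩ := Udown' hq hu hd (hxs x (m0 x hx).1) (hU' x (m0 x hx).1) hσ0 hes.le (m0 x hx).2 hσ0 le_rfl
      have hm : ∀ y ∈ A0.filter (fun y => dist y x < σ/q^16), y ∈ A0 ∧ dist y x < σ/q^16 := fun y hy => Finset.mem_filter.1 hy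
      refine (ih e he _ x σ hσ0 (by linarith) (fun y hy => (hm y hy).2.le)
        (fun y hy => hnorm y (m0 y (hm y hy).1).1) (fun y hy => hbad y (m0 y (hm y hy).1).1)
        (fun y hy w hw => hsepr y (m0 y (hm y hy).1).1 w (m0 w (hm w hw).1).1) (fun y hy => Or.inl ?_)).trans ?_
      · have hy0 := m0 y (hm y hy).1
        obtain ⟨e', he', h2⟩ := Udown' hq hu hd (hxs y hy0.1) (hU' y hy0.1) hσ0 hes.le hy0.2 hσ0 le_rfl
        obtain rfl : e = e' := by omega
        exact h2
      · rw [hPv, hX, he]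
        have h1 : max 1 (σ / r) ≤ s / r := by
          apply max_le
          · rw [le_div_iff₀ hr]; linarith
          · gcongr
        gcongr
  have b1 : (A1.card:ℝ) ≤ 2 * q^(30*n) * Pv * X := by
    rcases Nat.eq_zero_or_pos d with h0 | hpos
    · have : A1 = ∅ := by
        rw [Finset.eq_empty_iff_forall_notMem]
        intro x hx
        have hxA := (m1 x hx).1
        have hUx := hU' x hxA
        rw [h0] at hUx
        exact base hq hu (by omega) (hxs x hxA) hr hr5 hUx (hbad x hxA)
      rw [this]
      simp only [Finset.card_empty, Nat.cast_zero]
      positivity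
    · obtain ⟨e, rfl⟩ : ∃ e, d = e + 1 := ⟨d - 1, by omega⟩
      exact type1 hq hu hn hr hd (ih e rfl) A1 hs hs8 (fun x hx => hz x (m1 x hx).1)
        (fun x hx => hnorm x (m1 x hx).1) (fun x hx => hbad x (m1 x hx).1)
        (fun x hx y hy => hsepr x (m1 x hx).1 y (m1 y hy).1) (fun x hx => hU' x (m1 x hx).1) hr5
        (fun x hx => (m1 x hx).2)
  have hsum : (A.card : ℝ) = A1.card + A0.card := by
    exact_mod_cast (Finset.card_filter_add_card_filter_not (s := A) (fun x => LL u q d x σ)).symm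
  have hXm : X ≤ (max 1 (s/r))^(n-2) := by
    rw [hX]; gcongr; exact le_max_right _ _
  have h7 : q^(7*n) ≤ q^(30*n) := pow_le_pow_right₀ h1q (by omega)
  calc (A.card:ℝ) ≤ 2 * q^(30*n) * Pv * X + q^(7*n) * (Pv * X) := by rw [hsum]; exact add_le_add b1 b0
    _ ≤ 2 * q^(30*n) * Pv * X + q^(30*n) * (Pv * X) := by gcongr
    _ = 3 * q^(30*n) * (Pv * X) := by ring
    _ ≤ q^(2*n) * q^(30*n) * (Pv * X) := by
      gcongr
      calc (3:ℝ) ≤ q := by linarith [hq.c0]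
        _ = q^1 := (pow_one q).symm
        _ ≤ q^(2*n) := pow_le_pow_right₀ h1q (by omega)
    _ = q^(32*n*(d+1)) * X := by rw [hPv]; ring
    _ ≤ _ := by gcongr

lemma claim (hq : QQ n D q) (hu : IsHarmonicOn u (ball 0 2)) (hn : 2 ≤ n) (hr : 0 < r) :
    ∀ d, d ≤ D → CL u q r d := by
  intro d
  induction d with
  | zero => intro hd; exact step hq hu hn hr hd (fun e he => by omega)
  | succ k ihk => intro hd; exact step hq hu hn hr hd (fun e he => by
      obtain rfl : k = e := by omega
      exact ihk (by omega))

end claim2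
end EC


namespace EC

section top

lemma QQ_exists (n : ℕ) : ∃ Q : ℝ, 1 ≤ Q ∧ ∀ D : ℕ, 1 ≤ D → QQ n D (Q ^ D) := by
  have hC := Cc_ge n
  have hn0 : (0:ℝ) ≤ n := Nat.cast_nonneg n
  have e1 : 0 ≤ Cc n ^ 2 := by positivity
  have e2 : 0 ≤ 10 * ((n:ℝ)+1) * Cc n := by positivity
  have e3 : 0 ≤ (2 * ((n:ℝ)+1)) ^ n := by positivity
  have e4 : 0 ≤ ((n:ℝ)+1)^2 := by positivity
  obtain ⟨Q, hQ⟩ : ∃ Q : ℝ, Q = 1024 + Cc n ^ 2 + 10 * ((n:ℝ)+1) * Cc n + (2 * ((n:ℝ)+1)) ^ n + ((n:ℝ)+1)^2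
    + (1 + 4 * (n:ℝ)) := ⟨_, rfl⟩
  have key : ∀ (P : ℝ) (D : ℕ), 0 ≤ P → P ≤ Q → P ^ D ≤ Q ^ D := fun P D h1 h2 => pow_le_pow_left₀ h1 h2 D
  have hQ1 : 1 ≤ Q := by linarith
  refine ⟨Q, hQ1, fun D hD => ?_⟩
  have hD0 : D ≠ 0 := by omega
  have hQD : Q ≤ Q ^ D := le_self_pow₀ hQ1 hD0
  have hDr : (1:ℝ) ≤ D := by exact_mod_cast hD
  constructor
  · linarith
  · calc Cc n ^ (D+1) ≤ Cc n ^ (2 * D) := pow_le_pow_right₀ hC (by omega)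
      _ = (Cc n ^ 2) ^ D := pow_mul _ _ _
      _ ≤ _ := key _ _ e1 (by linarith)
  · linarith
  · calc (8:ℝ) ^ (D+1) ≤ 8 ^ (2 * D) := pow_le_pow_right₀ (by norm_num) (by omega)
      _ = (64:ℝ) ^ D := by rw [pow_mul]; norm_num
      _ ≤ _ := key _ _ (by norm_num) (by linarith)
  · have := one_add_mul_le_pow (a := (2:ℝ)) (by norm_num) D
    have h2 := key 3 D (by norm_num) (by linarith)
    norm_num at this
    linarith
  · linarith
  · calc (n:ℝ) ^ (D+1) ≤ ((n:ℝ)+1) ^ (D+1) := pow_le_pow_left₀ hn0 (by linarith) _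
      _ ≤ ((n:ℝ)+1) ^ (2 * D) := pow_le_pow_right₀ (by linarith) (by omega)
      _ = (((n:ℝ)+1) ^ 2) ^ D := pow_mul _ _ _
      _ ≤ _ := key _ _ e4 (by linarith)
  · have := one_add_mul_le_pow (a := 4 * (n:ℝ)) (by linarith) D
    have h2 := key (1 + 4 * (n:ℝ)) D (by linarith) (by linarith)
    nlinarith

variable {n : ℕ}
local notation "E" => EuclideanSpace ℝ (Fin n)
variable {D : ℕ} {q N : ℝ} {u : EuclideanSpace ℝ (Fin n) → ℝ} {x : EuclideanSpace ℝ (Fin n)} {s r : ℝ}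

lemma dbl (hu : IsHarmonicOn u (ball 0 2))
    (hN : ∀ (x : E) (r : ℝ), 0 < r → ball x (2 * r) ⊆ ball 0 1 → doublingIndex u x r ≤ N)
    (hs : 0 < s) (h0 : 0 < MM u x s) (k : ℕ) (hx : ‖x‖ + 2 ^ k * s ≤ 1) :
    MM u x (2 ^ k * s) ≤ Real.exp N ^ k * MM u x s := by
  induction k with
  | zero => simp
  | succ k ih =>
    have hk : 0 < 2 ^ k * s := by positivity
    have e : (2:ℝ) ^ (k+1) * s = 2 * (2 ^ k * s) := by ring
    rw [e] at hx ⊢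
    have hx' : ‖x‖ + 2 ^ k * s ≤ 1 := by linarith
    have hge : s ≤ 2 ^ k * s := le_mul_of_one_le_left hs.le (one_le_pow₀ (by norm_num))
    have h1 : MM u x s ≤ MM u x (2 ^ k * s) := MM_mono hu hs hx' (by simpa using hge)
    have h2 : MM u x (2 ^ k * s) ≤ MM u x (2 * (2 ^ k * s)) := MM_mono hu hk hx (by rw [dist_self]; linarith)
    have h3 := hN x (2 ^ k * s) hk (ball_sub_one hx)
    unfold doublingIndex at h3
    change Real.log (MM u x (2 * (2 ^ k * s)) / MM u x (2 ^ k * s)) ≤ N at h3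
    have hp : 0 < MM u x (2 ^ k * s) := by linarith
    rw [Real.log_le_iff_le_exp (div_pos (by linarith) hp), div_le_iff₀ hp] at h3
    calc _ ≤ _ := h3
      _ ≤ Real.exp N * (Real.exp N ^ k * MM u x s) := by gcongr; exact ih hx'
      _ = _ := by ring

lemma topUU (hq : QQ n D q) (hn : 2 ≤ n) (hu : IsHarmonicOn u (ball 0 2))
    (hN : ∀ (x : E) (r : ℝ), 0 < r → ball x (2 * r) ⊆ ball 0 1 → doublingIndex u x r ≤ N)
    (hD : 4 * N ≤ D) {m : ℕ} (hm : 1 ≤ m) (hmC : Cc n ≤ 2 ^ m) (hx : ‖x‖ ≤ 3/4) :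
    UU u q D x ((1/4) ^ m / 4) := by
  set s0 : ℝ := (1/4) ^ m / 4 with hs0
  have hs : 0 < s0 := by positivity
  have hm4 : ((1:ℝ)/4) ^ m ≤ 1/4 := by
    calc ((1:ℝ)/4) ^ m ≤ (1/4) ^ 1 := pow_le_pow_of_le_one (by norm_num) (by norm_num) hm
      _ = _ := pow_one _
  by_contra hU
  have hneg : ∀ i ≤ D, q * (bb u i x * s0 ^ i) < MM u x s0 := by
    intro i hi
    by_contra h
    exact hU ⟨i, hi, not_lt.1 h⟩
  have hq0 : 0 < q := by linarith [hq.c0]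
  have hpos : 0 < MM u x s0 := by
    refine lt_of_le_of_lt ?_ (hneg 0 (Nat.zero_le _))
    have := bb_nonneg u 0 x
    positivity
  have e : (2:ℝ) ^ (2 * m) * s0 = 1/4 := by
    rw [hs0, pow_mul, ← mul_div_assoc, ← mul_pow]; norm_num
  have h1 := dbl hu hN hs hpos (2 * m) (by rw [e]; linarith)
  rw [e] at h1
  have h2 := T1 hu hs (show ‖x‖ + 1/4 ≤ 1 by linarith) (by rw [hs0]; linarith) D
  have e2 : Real.exp N ^ 2 ≤ 2 ^ D := by
    rw [← Real.exp_nat_mul, ← Real.exp_log (show (0:ℝ) < 2 ^ D by positivity), Real.log_pow]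
    apply Real.exp_le_exp.2
    have := Real.log_two_gt_d9
    push_cast
    nlinarith
  have h3 : (Cc n * s0 / (1/4)) ^ (D+1) * Real.exp N ^ (2 * m) ≤ 1/2 := by
    have a1 : Cc n * s0 / (1/4) ≤ (1/2) ^ m := by
      calc Cc n * s0 / (1/4) = Cc n * (1/4) ^ m := by rw [hs0]; ring
        _ ≤ 2 ^ m * (1/4) ^ m := by gcongr
        _ = _ := by rw [← mul_pow]; norm_num
    have a0 : 0 ≤ Cc n * s0 / (1/4) := by have := Cc_ge n; positivity
    calc (Cc n * s0 / (1/4)) ^ (D+1) * Real.exp N ^ (2 * m) ≤ ((1/2) ^ m) ^ (D+1) * Real.exp N ^ (2 * m) := by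
          gcongr
      _ = ((1/2) ^ (D+1) * Real.exp N ^ 2) ^ m := by
          rw [← pow_mul, mul_comm m, pow_mul, pow_mul (Real.exp N), ← mul_pow]
      _ ≤ ((1/2) ^ (D+1) * 2 ^ D) ^ m := by gcongr
      _ = (1/2) ^ m := by
          congr 1; rw [pow_succ, mul_right_comm, ← mul_pow]; norm_num
      _ ≤ (1/2) ^ 1 := pow_le_pow_of_le_one (by norm_num) (by norm_num) hm
      _ = 1/2 := pow_one _
  have h4 : (Cc n * s0 / (1/4)) ^ (D+1) * MM u x (1/4) ≤ 1/2 * MM u x s0 := by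
    have a0 : 0 ≤ Cc n * s0 / (1/4) := by have := Cc_ge n; positivity
    calc _ ≤ (Cc n * s0 / (1/4)) ^ (D+1) * (Real.exp N ^ (2 * m) * MM u x s0) := by gcongr
      _ = ((Cc n * s0 / (1/4)) ^ (D+1) * Real.exp N ^ (2 * m)) * MM u x s0 := by ring
      _ ≤ _ := by gcongr
  have h5 : q * ∑ k ∈ Finset.range (D+1), bb u k x * s0 ^ k ≤ (D+1) * MM u x s0 := by
    rw [Finset.mul_sum]
    calc _ ≤ ∑ k ∈ Finset.range (D+1), MM u x s0 :=
          Finset.sum_le_sum fun k hk => (hneg k (by rw [Finset.mem_range] at hk; omega)).le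
      _ = _ := by simp
  have h6 : 1/2 * MM u x s0 ≤ ∑ k ∈ Finset.range (D+1), bb u k x * s0 ^ k := by linarith
  have h7 : q * (1/2 * MM u x s0) ≤ (D+1) * MM u x s0 := (mul_le_mul_of_nonneg_left h6 hq0.le).trans h5
  have h8 : q ≤ 2 * ((D:ℝ)+1) := by
    refine le_of_mul_le_mul_right ?_ hpos
    linarith
  have h9 := hq.c7
  have hn2 : (2:ℝ) ≤ n := by exact_mod_cast hn
  have hD0 : (0:ℝ) ≤ D := Nat.cast_nonneg D
  nlinarith

lemma max_sep (S : Set E) {R : ℝ} (hr : 0 < r) (hR : 0 < R) (hS : ∀ x ∈ S, dist x 0 ≤ R) :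
    ∃ A : Finset E, (∀ x ∈ A, x ∈ S) ∧ (∀ x ∈ A, ∀ y ∈ A, x ≠ y → r ≤ dist x y) ∧
      ∀ y ∈ S, ∃ x ∈ A, dist y x < r := by
  classical
  let T : Set ℕ := {k | ∃ A : Finset E, (∀ x ∈ A, x ∈ S) ∧ (∀ x ∈ A, ∀ y ∈ A, x ≠ y → r ≤ dist x y) ∧ A.card = k}
  have hb : BddAbove T := by
    refine ⟨⌊(1 + 2 * R / r) ^ n⌋₊, ?_⟩
    rintro k ⟨A, h1, h2, rfl⟩
    exact Nat.le_floor (sep_count A hr hR (fun x hx => hS x (h1 x hx)) h2)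
  have hne : T.Nonempty := ⟨0, ∅, by simp⟩
  obtain ⟨A, h1, h2, h3⟩ := Nat.sSup_mem hne hb
  refine ⟨A, h1, h2, fun y hy => ?_⟩
  by_contra! hcon
  have hyA : y ∉ A := fun h => by have := hcon y h; rw [dist_self] at this; linarith
  have : A.card + 1 ∈ T := by
    refine ⟨insert y A, ?_, ?_, Finset.card_insert_of_notMem hyA⟩
    · intro x hx
      rcases Finset.mem_insert.1 hx with rfl | hx
      · exact hy
      · exact h1 x hx
    · intro a ha b hb hab
      rcases Finset.mem_insert.1 ha with ha1 | ha1 <;> rcases Finset.mem_insert.1 hb with hb1 | hb1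
      · exact absurd (ha1.trans hb1.symm) hab
      · rw [ha1]; exact hcon b hb1
      · rw [hb1, dist_comm]; exact hcon a ha1
      · exact h2 a ha1 b hb1 hab
  have := le_csSup hb this
  omega

lemma sub_thick (hr : r ≤ 1/16) : ball (0 : E) (1/2) ∩ thickening r (effCriticalSet u r) ⊆
    {y | ∃ x ∈ effCriticalSet u r, ‖x‖ ≤ 9/16 ∧ dist y x < r} := by
  rintro y ⟨hy, hy2⟩
  obtain ⟨x, hx, hd⟩ := mem_thickening_iff.1 hy2
  refine ⟨x, hx, ?_, hd⟩
  rw [mem_ball, dist_zero_right] at hy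
  have : ‖x‖ ≤ ‖y‖ + dist y x := by
    rw [dist_eq_norm, norm_sub_rev]
    simpa using norm_add_le y (x - y)
  linarith

lemma count (hq : QQ n D q) (hn : 2 ≤ n) (hu : IsHarmonicOn u (ball 0 2)) (hr : 0 < r) (hr1 : r ≤ 1)
    (hs : 0 < s) (hs8 : s ≤ 1/8) (hU : ∀ x : E, ‖x‖ ≤ 3/4 → UU u q D x s) (A : Finset E)
    (hA : ∀ x ∈ A, ‖x‖ ≤ 3/4) (hb : ∀ x ∈ A, x ∈ effCriticalSet u r)
    (hsep : ∀ x ∈ A, ∀ y ∈ A, x ≠ y → r ≤ dist x y) :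
    (A.card : ℝ) ≤ (1 + 2 / s) ^ n * q ^ (16 * n + 32 * n * (D+1)) * (1/r) ^ (n-2) := by
  classical
  have hq1 : 1 ≤ q := by linarith [hq.c0]
  have hq16 : 1 ≤ q ^ 16 := one_le_pow₀ hq1
  have hB : ∀ x ∈ A, ((A.filter (fun y => dist y x < s / q ^ 16)).card : ℝ) ≤
      q ^ (32 * n * (D+1)) * (1/r) ^ (n-2) := by
    intro x hx
    have hf : ∀ y ∈ A.filter (fun y => dist y x < s / q ^ 16), y ∈ A ∧ dist y x < s / q ^ 16 :=
      fun y hy => Finset.mem_filter.1 hy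
    have h := claim hq hu hn hr D le_rfl (A.filter (fun y => dist y x < s / q ^ 16)) x s hs hs8
      (fun y hy => (hf y hy).2.le) (fun y hy => hA y (hf y hy).1) (fun y hy => hb y (hf y hy).1)
      (fun y hy w hw => hsep y (hf y hy).1 w (hf w hw).1) (fun y hy => Or.inl (hU y (hA y (hf y hy).1)))
    refine h.trans ?_
    gcongr
    apply max_le
    · rw [le_div_iff₀ hr]; linarith
    · gcongr; linarith
  have h := subdiv A (z := 0) (R := 3/4) (ε := s / q ^ 16) (by positivity) (by norm_num)
    (fun x hx => by rw [dist_zero_right]; exact hA x hx) hB (by positivity)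
  refine h.trans ?_
  have h2 : 1 + 2 * (3/4) / (s / q ^ 16) ≤ (1 + 2 / s) * q ^ 16 := by
    have : 2 * (3/4) / (s / q ^ 16) = (3/2) / s * q ^ 16 := by field_simp; norm_num
    rw [this, add_mul, one_mul]
    gcongr
    norm_num
  calc (1 + 2 * (3/4) / (s / q ^ 16)) ^ n * (q ^ (32 * n * (D+1)) * (1/r) ^ (n-2))
      ≤ ((1 + 2 / s) * q ^ 16) ^ n * (q ^ (32 * n * (D+1)) * (1/r) ^ (n-2)) := by gcongr
    _ = _ := by rw [mul_pow, pow_add, pow_mul q 16 n]; ring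

lemma vol_bound (A : Finset E) (hr : 0 < r) {K : ℝ} (hK : (A.card : ℝ) ≤ K * (1/r) ^ (n-2)) (hn : 2 ≤ n) {S : Set E}
    (hS : ∀ y ∈ S, ∃ x ∈ A, dist y x < 2 * r) :
    volume S ≤ ENNReal.ofReal (K * 2 ^ n * (volume (ball (0:E) 1)).toReal * r ^ 2) := by
  have : Nonempty (Fin n) := ⟨⟨0, by omega⟩⟩
  have h1 : volume S ≤ ∑ x ∈ A, volume (ball x (2 * r)) := by
    refine (measure_mono ?_).trans (measure_biUnion_finset_le A _)
    intro y hy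
    obtain ⟨x, hx, h⟩ := hS y hy
    exact mem_biUnion (show x ∈ (A : Set E) from hx) h
  have hV : volume (ball (0:E) 1) ≠ ⊤ := measure_ball_lt_top.ne
  have h2 : ∀ x ∈ A, volume (ball x (2 * r)) = ENNReal.ofReal ((2 * r) ^ n * (volume (ball (0:E) 1)).toReal) := by
    intro x _
    rw [Measure.addHaar_ball _ _ (by positivity), ENNReal.ofReal_mul (by positivity), ENNReal.ofReal_toReal hV]
    simp
  rw [Finset.sum_congr rfl h2, Finset.sum_const, nsmul_eq_mul, ← ENNReal.ofReal_natCast,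
    ← ENNReal.ofReal_mul (by positivity)] at h1
  refine h1.trans (ENNReal.ofReal_le_ofReal ?_)
  have hV0 : 0 ≤ (volume (ball (0:E) 1)).toReal := ENNReal.toReal_nonneg
  calc (A.card : ℝ) * ((2 * r) ^ n * (volume (ball (0:E) 1)).toReal)
      ≤ K * (1/r) ^ (n-2) * ((2 * r) ^ n * (volume (ball (0:E) 1)).toReal) := by gcongr
    _ = _ := by
      obtain ⟨k, rfl⟩ := Nat.exists_eq_add_of_le hn
      have : 2 + k - 2 = k := by omega
      rw [this, mul_pow, pow_add r]
      have h3 : (1/r) ^ k * r ^ k = 1 := by rw [← mul_pow, one_div_mul_cancel hr.ne', one_pow]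
      linear_combination K * 2 ^ (2+k) * r ^ 2 * (volume (ball (0:EuclideanSpace ℝ (Fin (2+k))) 1)).toReal * h3

lemma low_dim (hn : n < 2) (hu : IsHarmonicOn u (ball 0 2)) (hr : 0 < r) (hx : ‖x‖ + 3 * r ≤ 1) :
    x ∉ effCriticalSet u r := by
  intro hb
  have hn' : n = 0 ∨ n = 1 := by omega
  rcases hn' with rfl | rfl
  · have h : sInf ((fun y => ‖fderiv ℝ u y‖ ^ 2) '' ball x r) < _ := hb
    have h0 : 0 ≤ sInf ((fun y => ‖fderiv ℝ u y‖ ^ 2) '' ball x r) := by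
      apply Real.sInf_nonneg; rintro _ ⟨y, _, rfl⟩; positivity
    simp only [Nat.cast_zero, zero_div, zero_mul] at h
    linarith
  · obtain ⟨z, hz, h⟩ := bad_point hu hr hx le_rfl hb
    have hz2 : z ∈ ball (0:EuclideanSpace ℝ (Fin 1)) 2 := by
      rw [mem_ball, dist_eq_norm] at hz
      rw [mem_ball, dist_zero_right]
      have := norm_add_le (z - x) x
      rw [sub_add_cancel] at this
      linarith
    have ht := trF_iter isOpen_ball hu 0 hz2
    have h0 : iteratedFDeriv ℝ 2 u z = 0 := by
      ext v
      let b := EuclideanSpace.basisFun (Fin 1) ℝ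
      have h1 := ht b 0 1 v (by simp)
      have hv : ∀ w : EuclideanSpace ℝ (Fin 1), w = w 0 • b 0 := by
        intro w; ext i; fin_cases i; simp [b]
      have h2 : v = fun i => (v i) 0 • b 0 := by ext1 i; exact hv _
      rw [Fintype.sum_unique] at h1
      rw [h2, ContinuousMultilinearMap.map_smul_univ]
      have h3 : Function.update (Function.update v 0 (b default)) 1 (b default) = fun _ => b 0 := by
        ext1 i; fin_cases i
        · simp
        · simp
      rw [h3] at h1
      simp [h1]
    have hbb : bb u 1 z = 0 := by unfold bb; rw [h0]; simp
    rw [hbb, mul_zero] at h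
    linarith [norm_nonneg (fderiv ℝ u x)]

end top
end EC


/-- **Volume estimate for the effective critical set (Naber–Valtorta).** If `u` is harmonic
on `B(0,2)` and the doubling index of `∇u` is bounded above by `N` on `B(0,1)`, then for all
`0 < r < 1`, `Vol(B(0,1/2) ∩ B_r(𝒞_r(u))) ≤ C^{N²} r²` with `C = C(n)`. -/
theorem effective_critical_set_volume (n : ℕ) :
    ∃ C : ℝ, 1 < C ∧
      ∀ (u : EuclideanSpace ℝ (Fin n) → ℝ) (N : ℝ), 1 ≤ N →
        IsHarmonicOn u (ball 0 2) →
        (∀ (x : EuclideanSpace ℝ (Fin n)) (r : ℝ), 0 < r → ball x (2 * r) ⊆ ball 0 1 →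
          doublingIndex u x r ≤ N) →
        ∀ r : ℝ, 0 < r → r < 1 →
          volume (ball (0 : EuclideanSpace ℝ (Fin n)) (1 / 2) ∩
              Metric.thickening r (effCriticalSet u r)) ≤
            ENNReal.ofReal (C ^ (N ^ 2) * r ^ 2) := by
  obtain ⟨Q, hQ1, hQ⟩ := EC.QQ_exists n
  obtain ⟨m0, hm0⟩ := pow_unbounded_of_one_lt (EC.Cc n) (show (1:ℝ) < 2 by norm_num)
  set m := m0 + 1 with hm
  have hmC : EC.Cc n ≤ 2 ^ m := hm0.le.trans (pow_le_pow_right₀ (by norm_num) (by omega))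
  set s0 : ℝ := (1/4) ^ m / 4 with hs0
  have hs : 0 < s0 := by positivity
  have hs8 : s0 ≤ 1/8 := by
    have : ((1:ℝ)/4) ^ m ≤ (1/4) ^ 1 := pow_le_pow_of_le_one (by norm_num) (by norm_num) (by omega)
    rw [pow_one] at this
    rw [hs0]; linarith
  set V : ℝ := (volume (ball (0 : EuclideanSpace ℝ (Fin n)) 1)).toReal with hV
  have hV0 : 0 ≤ V := ENNReal.toReal_nonneg
  set P : ℝ := (1 + 2 / s0) ^ n * 2 ^ n * V with hP
  have hP0 : 0 ≤ P := by positivity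
  have hQp : 1 ≤ Q ^ (1040 * n) := one_le_pow₀ hQ1
  have hPQ : 0 ≤ (P + 1) * Q ^ (1040 * n) := by positivity
  refine ⟨2 + 256 * V + (P + 1) * Q ^ (1040 * n), by linarith, ?_⟩
  intro u N hN1 hu hdb r hr hr1
  set C : ℝ := 2 + 256 * V + (P + 1) * Q ^ (1040 * n) with hC
  have hC1 : 1 ≤ C := by linarith
  have hN2 : 1 ≤ N ^ 2 := one_le_pow₀ hN1
  have hCN : C ≤ C ^ (N ^ 2) := by
    calc C = C ^ (1:ℝ) := (Real.rpow_one C).symm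
      _ ≤ _ := Real.rpow_le_rpow_of_exponent_le hC1 hN2
  rcases le_or_gt (1/16) r with hr16 | hr16
  · calc _ ≤ volume (ball (0 : EuclideanSpace ℝ (Fin n)) 1) :=
          measure_mono (inter_subset_left.trans (ball_subset_ball (by norm_num)))
      _ = ENNReal.ofReal V := (ENNReal.ofReal_toReal measure_ball_lt_top.ne).symm
      _ ≤ _ := by
        apply ENNReal.ofReal_le_ofReal
        have h1 : 1 ≤ 256 * r ^ 2 := by nlinarith
        calc V ≤ V * (256 * r ^ 2) := le_mul_of_one_le_right hV0 h1
          _ = 256 * V * r ^ 2 := by ring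
          _ ≤ C ^ (N ^ 2) * r ^ 2 := by gcongr; linarith
  have hsub := EC.sub_thick (u := u) hr16.le
  rcases lt_or_ge n 2 with hn | hn
  · have he : ball (0 : EuclideanSpace ℝ (Fin n)) (1 / 2) ∩ Metric.thickening r (effCriticalSet u r) = ∅ := by
      rw [eq_empty_iff_forall_notMem]
      intro y hy
      obtain ⟨x, hx, hx2, _⟩ := hsub hy
      exact EC.low_dim hn hu hr (by linarith) hx
    rw [he, measure_empty]
    exact zero_le
  set D : ℕ := ⌈4 * N⌉₊ with hD
  have hD4 : 4 * N ≤ D := Nat.le_ceil _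
  have hD5 : (D:ℝ) ≤ 5 * N := by
    have := Nat.ceil_lt_add_one (show 0 ≤ 4 * N by linarith)
    linarith
  have hD1 : 1 ≤ D := by
    have : (1:ℝ) ≤ D := by linarith
    exact_mod_cast this
  have hq := hQ D hD1
  obtain ⟨A, hA1, hA2, hA3⟩ := EC.max_sep (r := r) {x | x ∈ effCriticalSet u r ∧ ‖x‖ ≤ 3/4} (R := 3/4) hr
    (by norm_num) (fun x hx => by rw [dist_zero_right]; exact hx.2)
  have hc := EC.count hq hn hu hr hr1.le hs hs8
    (fun x hx => EC.topUU hq hn hu hdb hD4 (by omega) hmC hx) A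
    (fun x hx => (hA1 x hx).2) (fun x hx => (hA1 x hx).1) hA2
  refine (EC.vol_bound A hr hc hn (fun y hy => ?_)).trans (ENNReal.ofReal_le_ofReal ?_)
  · obtain ⟨x, hx, hx2, hxy⟩ := hsub hy
    obtain ⟨a, ha, hxa⟩ := hA3 x ⟨hx, by linarith⟩
    exact ⟨a, ha, by linarith [dist_triangle y x a]⟩
  · rw [← hV]
    have hexp : (Q ^ D) ^ (16 * n + 32 * n * (D+1)) ≤ (Q ^ (1040 * n)) ^ (N ^ 2) := by
      rw [← pow_mul, ← Real.rpow_natCast, ← Real.rpow_natCast, ← Real.rpow_mul (by linarith)]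
      apply Real.rpow_le_rpow_of_exponent_le hQ1
      push_cast
      have hn0 : (0:ℝ) ≤ n := Nat.cast_nonneg n
      have hDD : (D:ℝ) * (16 + 32 * (D + 1)) ≤ 1040 * N ^ 2 := by
        have hD0 : (0:ℝ) ≤ D := Nat.cast_nonneg D
        calc (D:ℝ) * (16 + 32 * (D + 1)) ≤ (5 * N) * (16 + 32 * (5 * N + 1)) := by gcongr
          _ ≤ _ := by nlinarith
      calc (D:ℝ) * (16 * n + 32 * n * (D + 1)) = n * (D * (16 + 32 * (D + 1))) := by ring
        _ ≤ n * (1040 * N ^ 2) := by gcongr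
        _ = _ := by ring
    have hP1 : P ≤ (P + 1) ^ (N ^ 2) := by
      calc P ≤ (P + 1) ^ (1:ℝ) := by rw [Real.rpow_one]; linarith
        _ ≤ _ := Real.rpow_le_rpow_of_exponent_le (by linarith) hN2
    have hfin : P * (Q ^ D) ^ (16 * n + 32 * n * (D+1)) ≤ C ^ (N ^ 2) := by
      calc _ ≤ (P + 1) ^ (N ^ 2) * (Q ^ (1040 * n)) ^ (N ^ 2) := by gcongr
        _ = ((P + 1) * Q ^ (1040 * n)) ^ (N ^ 2) := by rw [Real.mul_rpow (by linarith) (by linarith)]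
        _ ≤ _ := Real.rpow_le_rpow hPQ (by linarith) (by linarith)
    calc _ = P * (Q ^ D) ^ (16 * n + 32 * n * (D+1)) * r ^ 2 := by rw [hP]; ring
      _ ≤ _ := by gcongr
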